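/- Let (F|K,P) be a valued function field (F|K finitely generated of transcendence degree ≥ 1, P a valuation on F, not necessarily trivial on K) without transcendence defect, i.e., trdeg F|K = trdeg FP|KP + dim_ℚ(ℚ ⊗_ℤ (v_PF/v_PK)). If (K,P) is a defectless field, then (F,P) is a defectless field. -/

import Mathlib

/-! Common valuation-theoretic notions, following F.-V. Kuhlmann,
"On local uniformization in arbitrary characteristic I".

A valued field `(F, P)` is modelled by a field `F` together with a
`ValuationSubring F` (the valuation ring `𝓞` of the place `P`). -/

namespace LocalUnif

variable {F : Type*} [Field F]

/-- `x` lies in the maximal ideal of the valuation subring `O`,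
i.e. the residue `xP` is `0` (equivalently `v_P x > 0`, or `x = 0`). -/
def InMax (O : ValuationSubring F) (x : F) : Prop := x = 0 ∨ x⁻¹ ∉ O

/-- `x` is a unit of the valuation subring `O`, i.e. `v_P x = 0`. -/
def IsVUnit (O : ValuationSubring F) (x : F) : Prop := x ≠ 0 ∧ x ∈ O ∧ x⁻¹ ∈ O

/-- The valuation with valuation ring `O` is trivial on the subfield `K`;
equivalently, every nonzero element of `K` is a unit of `O`. -/
def TrivialOn (O : ValuationSubring F) (K : Subfield F) : Prop :=
  ∀ x ∈ K, x ∈ O ∧ x⁻¹ ∈ O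

/-- The residue field of `O` equals (the isomorphic image of) the subfield `K`:
every element of `O` is congruent to an element of `K` modulo the maximal ideal.
(For a place `P` of `F|K` this says that `P` is a rational place, `FP = K`.) -/
def ResidueEq (O : ValuationSubring F) (K : Subfield F) : Prop :=
  ∀ x ∈ O, ∃ c ∈ K, InMax O (x - c)

/-- The residue field of `O` is algebraic over (the image of) `K`; for a place of
`F|K` this says that `P` is zero-dimensional. -/
def ResidueAlgebraic (O : ValuationSubring F) (K : Subfield F) : Prop :=
  ∀ x ∈ O, ∃ p : Polynomial F, p ≠ 0 ∧ (∀ i, p.coeff i ∈ K) ∧ InMax O (Polynomial.eval x p)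

/-- The values `v_P (x i)` are rationally independent modulo `v_P K`:
no nontrivial ℤ-linear combination of the values lies in `ℚ ⊗ v_P K`
(equivalently, in `v_P K`, by clearing denominators). -/
def ValIndepMod (O : ValuationSubring F) (K : Subfield F) {ρ : ℕ} (x : Fin ρ → F) : Prop :=
  (∀ i, x i ≠ 0) ∧
  ∀ e : Fin ρ → ℤ, (∃ c ∈ K, c ≠ 0 ∧ IsVUnit O ((∏ i, x i ^ e i) / c)) → e = 0

/-- The residues `(y i)P` are algebraically independent over the residue field `KP`:
for every polynomial with coefficients in `𝓞_K = K ∩ O`, at least one of which is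
a unit, the value of the polynomial at `y` is a unit (so its residue is nonzero). -/
def ResIndep (O : ValuationSubring F) (K : Subfield F) {τ : ℕ} (y : Fin τ → F) : Prop :=
  (∀ i, y i ∈ O) ∧
  ∀ p : MvPolynomial (Fin τ) F, (∀ m, p.coeff m ∈ K ∧ p.coeff m ∈ O) →
    (∃ m, IsVUnit O (p.coeff m)) → ¬ InMax O (MvPolynomial.eval y p)

/-- `dim_ℚ (ℚ ⊗ (v_P F / v_P K)) = ρ`: there is a maximal set of `ρ` elements of `F`
whose values are rationally independent modulo `v_P K`. -/
def RatRankEq (O : ValuationSubring F) (K : Subfield F) (ρ : ℕ) : Prop :=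
  (∃ x : Fin ρ → F, ValIndepMod O K x) ∧ ∀ x : Fin (ρ + 1) → F, ¬ ValIndepMod O K x

/-- `trdeg (FP | KP) = τ`: there is a maximal set of `τ` elements of `O` whose
residues are algebraically independent over `KP`. -/
def ResTrdegEq (O : ValuationSubring F) (K : Subfield F) (τ : ℕ) : Prop :=
  (∃ y : Fin τ → F, ResIndep O K y) ∧ ∀ y : Fin (τ + 1) → F, ¬ ResIndep O K y

/-- `trdeg (F | K) = d`. -/
def TrdegEq (K : Subfield F) (d : ℕ) : Prop :=
  ∃ t : Fin d → F, IsTranscendenceBasis ↥K t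

/-- `P` is an Abhyankar place of `F|K`:
`trdeg F|K = trdeg FP|K + dim_ℚ (ℚ ⊗ v_P F)`. -/
def IsAbhyankar (O : ValuationSubring F) (K : Subfield F) : Prop :=
  ∃ d ρ τ : ℕ, d = ρ + τ ∧ TrdegEq K d ∧ RatRankEq O K ρ ∧ ResTrdegEq O K τ

/-- The value group of `O` is archimedean ordered (rank at most 1):
for any two positive values `v_P a, v_P b` there is `n` with `n · v_P a ≥ v_P b`. -/
def RankOne (O : ValuationSubring F) : Prop :=
  ∀ a b : F, a ≠ 0 → InMax O a → b ≠ 0 → InMax O b → ∃ n : ℕ, a ^ n / b ∈ O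

/-- The value group of `O` has (rank) at least `r`: there is a chain of `r` positive
values, each infinitely larger than the previous one. -/
def RankAtLeast (O : ValuationSubring F) (r : ℕ) : Prop :=
  ∃ a : Fin r → F, (∀ i, a i ≠ 0 ∧ InMax O (a i)) ∧
    ∀ i j : Fin r, i < j → ∀ n : ℕ, a i ^ n / a j ∉ O

/-- The value group of `O` has rank exactly `r`. -/
def RankEq (O : ValuationSubring F) (r : ℕ) : Prop :=
  RankAtLeast O r ∧ ¬ RankAtLeast O (r + 1)

/-- The valuation is discrete: its value group is order isomorphic to `ℤ`,
i.e. there is a uniformizer `π` with every value an integer multiple of `v_P π`. -/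
def IsDiscrete (O : ValuationSubring F) : Prop :=
  ∃ π : F, π ≠ 0 ∧ InMax O π ∧ ∀ x : F, x ≠ 0 → ∃ n : ℤ, IsVUnit O (x / π ^ n)

/-- `F|K` is an algebraic function field: a finitely generated field extension of
transcendence degree at least 1. -/
def IsFunctionField (K : Subfield F) : Prop :=
  (∃ S : Finset F, IntermediateField.adjoin ↥K (S : Set F) = ⊤) ∧
  ∃ x : F, Transcendental ↥K x

/-- The data of a weak uniformization of `(𝓛|𝓚, P)` (both subfields of an ambient
valued field `F`, `𝓚 ⊆ 𝓛`) with uniformizing transcendence basis `t` and generators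
`η`: there are polynomials `f i` in `n` variables `X₁, …, Xₙ` with coefficients in
`𝓞_𝓚[t₁,…,tₛ]` such that (U1) `X j` does not occur in `f i` for `i < j`,
(U2) `f i (η) = 0`, and (U3) the residue of `det J_f (η)` is nonzero; moreover `t`
is a transcendence basis of `𝓛|𝓚` inside `𝓞_𝓛` and `𝓛 = 𝓚(t, η)`. -/
def UnifData (𝓛 𝓚 : Subfield F) (O : ValuationSubring F) {s n : ℕ}
    (t : Fin s → F) (η : Fin n → F) : Prop :=
  (∀ i, t i ∈ 𝓛 ∧ t i ∈ O) ∧ (∀ i, η i ∈ 𝓛 ∧ η i ∈ O) ∧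
  AlgebraicIndependent ↥𝓚 t ∧
  (∀ z ∈ 𝓛, IsAlgebraic ↥(IntermediateField.adjoin ↥𝓚 (Set.range t)) z) ∧
  Subfield.closure ((𝓚 : Set F) ∪ Set.range t ∪ Set.range η) = 𝓛 ∧
  ∃ f : Fin n → MvPolynomial (Fin n) F,
    (∀ i m, (f i).coeff m ∈
      Subring.closure ((↑(𝓚.toSubring ⊓ O.toSubring) : Set F) ∪ Set.range t)) ∧
    (∀ i j : Fin n, (i : ℕ) < (j : ℕ) → MvPolynomial.degreeOf j (f i) = 0) ∧
    (∀ i, MvPolynomial.eval η (f i) = 0) ∧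
    IsVUnit O (Matrix.det (Matrix.of fun i j : Fin n =>
      MvPolynomial.eval η (MvPolynomial.pderiv j (f i))))

/-- `(𝓛|𝓚, P)` is uniformizable with respect to `ζ₁, …, ζ_m`:
there is a weak uniformization whose generators `η` include all the `ζ k`. -/
def UnifWrt (𝓛 𝓚 : Subfield F) (O : ValuationSubring F) {m : ℕ} (ζ : Fin m → F) : Prop :=
  ∃ (s n : ℕ) (t : Fin s → F) (η : Fin n → F),
    UnifData 𝓛 𝓚 O t η ∧ ∃ σ : Fin m → Fin n, ∀ k, η (σ k) = ζ k

/-- `(𝓛|𝓚, P)` is uniformizable: uniformizable with respect to every finite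
list of elements of `𝓞_𝓛`. -/
def UnifIn (𝓛 𝓚 : Subfield F) (O : ValuationSubring F) : Prop :=
  ∀ (m : ℕ) (ζ : Fin m → F), (∀ k, ζ k ∈ 𝓛 ∧ ζ k ∈ O) → UnifWrt 𝓛 𝓚 O ζ

section Defectless

variable {K L : Type*} [Field K] [Field L]

/-- The values of the `a i` lie in pairwise distinct cosets modulo the value group of
the ground field along `φ`; thus there are at least `e` distinct cosets. -/
def ValClassIndep (φ : K →+* L) (OL : ValuationSubring L) {e : ℕ} (a : Fin e → L) : Prop :=
  (∀ i, a i ≠ 0) ∧ ∀ i j : Fin e, i ≠ j →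
    ¬ ∃ c : K, c ≠ 0 ∧ IsVUnit OL (a i / (a j * φ c))

/-- The ramification index `e = (v_P L : v_P K)` of `OL` over the ground field along `φ`. -/
def RamIdxEq (φ : K →+* L) (OL : ValuationSubring L) (e : ℕ) : Prop :=
  (∃ a : Fin e → L, ValClassIndep φ OL a) ∧ ∀ a : Fin (e + 1) → L, ¬ ValClassIndep φ OL a

/-- The residues of the `b i` are linearly independent over the residue field of the
ground field along `φ`. -/
def ResLinIndep (φ : K →+* L) (OK : ValuationSubring K) (OL : ValuationSubring L)
    {f : ℕ} (b : Fin f → L) : Prop :=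
  (∀ i, b i ∈ OL) ∧ ∀ c : Fin f → K, (∀ i, c i ∈ OK) → (∃ i, ¬ InMax OK (c i)) →
    ¬ InMax OL (∑ i, φ (c i) * b i)

/-- The inertia degree `f = [LP : KP]` of `OL` over `(K, OK)` along `φ`. -/
def InertiaDegEq (φ : K →+* L) (OK : ValuationSubring K) (OL : ValuationSubring L)
    (f : ℕ) : Prop :=
  (∃ b : Fin f → L, ResLinIndep φ OK OL b) ∧ ∀ b : Fin (f + 1) → L, ¬ ResLinIndep φ OK OL b

end Defectless

/-- `(K, OK)` is a defectless (stable) valued field: for every finite extension `L|K`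
(inside a fixed algebraic closure) the fundamental equality
`[L : K] = ∑ᵢ eᵢ fᵢ` holds, the sum running over all extensions of the valuation. -/
def IsDefectless (K : Type*) [Field K] (OK : ValuationSubring K) : Prop :=
  ∀ L : IntermediateField K (AlgebraicClosure K), FiniteDimensional K ↥L →
    ∃ (g : ℕ) (Os : Fin g → ValuationSubring ↥L) (e f : Fin g → ℕ),
      Function.Injective Os ∧
      (∀ O' : ValuationSubring ↥L, O'.comap (algebraMap K ↥L) = OK ↔ ∃ i, O' = Os i) ∧
      (∀ i, RamIdxEq (algebraMap K ↥L) (Os i) (e i)) ∧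
      (∀ i, InertiaDegEq (algebraMap K ↥L) OK (Os i) (f i)) ∧
      Module.finrank K ↥L = ∑ i, e i * f i

/-- The extension `𝓛|𝓚` of subfields of `F` is separable (in the general sense of
MacLane): every finitely generated subextension is separably generated, i.e. admits
a separating transcendence basis. -/
def IsSeparableExt (𝓚 𝓛 : Subfield F) : Prop :=
  ∀ S : Finset F, ↑S ⊆ (𝓛 : Set F) →
    ∃ (d : ℕ) (u : Fin d → F), (∀ i, u i ∈ 𝓛) ∧ AlgebraicIndependent ↥𝓚 u ∧
      ∀ x ∈ Subfield.closure ((𝓚 : Set F) ∪ ↑S),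
        IsSeparable ↥(IntermediateField.adjoin ↥𝓚 (Set.range u)) x

/-- The embedding of a subfield `K`, on which the valuation is trivial, into
the residue field of `O`. -/
noncomputable def resEmb (O : ValuationSubring F) (K : Subfield F) (h : ∀ x ∈ K, x ∈ O) :
    ↥K →+* IsLocalRing.ResidueField ↥O :=
  (IsLocalRing.residue ↥O).comp
    { toFun := fun x => (⟨x.1, h x.1 x.2⟩ : ↥O)
      map_one' := rfl
      map_mul' := fun _ _ => rfl
      map_zero' := rfl
      map_add' := fun _ _ => rfl }

end LocalUnif



set_option linter.unusedSectionVars false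

namespace GST

universe u

structure ENorm {E V Γ : Type*} [Field E] [AddCommGroup V] [Module E V]
    [LinearOrderedCommGroupWithZero Γ] (v : Valuation E Γ) (N : V → Γ) : Prop where
  eq_zero_iff : ∀ b, N b = 0 ↔ b = 0
  add_le : ∀ a b, N (a + b) ≤ max (N a) (N b)
  smul : ∀ (c : E) b, N (c • b) = v c * N b

def Orth (E : Type*) {V Γ ι : Type*} [Field E] [AddCommGroup V] [Module E V]
    [LinearOrderedCommGroupWithZero Γ] [Fintype ι] (N : V → Γ) (Z : ι → V) : Prop :=
  (∀ j, Z j ≠ 0) ∧ ∀ (c : ι → E) j, N (c j • Z j) ≤ N (∑ i, c i • Z i)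

def Spans (E : Type*) {V Γ ι : Type*} [Field E] [AddCommGroup V] [Module E V]
    [LinearOrderedCommGroupWithZero Γ] [Fintype ι] (N : V → Γ) (Z : ι → V) : Prop :=
  ∀ b, b ≠ 0 → ∃ c : ι → E, N (b - ∑ i, c i • Z i) < N b

section norm

variable {E V Γ ι : Type*} [Field E] [AddCommGroup V] [Module E V]
    [LinearOrderedCommGroupWithZero Γ] {v : Valuation E Γ} {N : V → Γ}

namespace ENorm

theorem zero (h : ENorm v N) : N 0 = 0 := (h.eq_zero_iff 0).2 rfl

theorem ne (h : ENorm v N) {b : V} (hb : b ≠ 0) : N b ≠ 0 := fun h' => hb ((h.eq_zero_iff b).1 h')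

theorem pos (h : ENorm v N) {b : V} (hb : b ≠ 0) : 0 < N b := zero_lt_iff.2 (h.ne hb)

theorem neg (h : ENorm v N) (b : V) : N (-b) = N b := by
  have := h.smul (-1) b
  simpa using this

theorem sub_le (h : ENorm v N) (a b : V) : N (a - b) ≤ max (N a) (N b) := by
  rw [sub_eq_add_neg, ← h.neg b]; exact h.add_le _ _

theorem sub_comm (h : ENorm v N) (a b : V) : N (a - b) = N (b - a) := by
  rw [← h.neg, neg_sub]

theorem add_lt (h : ENorm v N) {a b : V} {g : Γ} (ha : N a < g) (hb : N b < g) : N (a + b) < g :=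
  (h.add_le a b).trans_lt (max_lt ha hb)

theorem sub_lt (h : ENorm v N) {a b : V} {g : Γ} (ha : N a < g) (hb : N b < g) : N (a - b) < g :=
  (h.sub_le a b).trans_lt (max_lt ha hb)

theorem sum_le (h : ENorm v N) {s : Finset ι} {f : ι → V} {g : Γ} (hf : ∀ i ∈ s, N (f i) ≤ g) :
    N (∑ i ∈ s, f i) ≤ g := by
  classical
  induction s using Finset.induction_on with
  | empty => simp [h.zero]
  | insert a s ha ih =>
    rw [Finset.sum_insert ha]
    exact (h.add_le _ _).trans (max_le (hf _ (Finset.mem_insert_self _ _))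
      (ih fun i hi => hf i (Finset.mem_insert_of_mem hi)))

theorem sum_lt (h : ENorm v N) {s : Finset ι} {f : ι → V} {g : Γ} (hg : g ≠ 0)
    (hf : ∀ i ∈ s, N (f i) < g) : N (∑ i ∈ s, f i) < g := by
  classical
  induction s using Finset.induction_on with
  | empty => simpa [h.zero] using zero_lt_iff.2 hg
  | insert a s ha ih =>
    rw [Finset.sum_insert ha]
    exact h.add_lt (hf _ (Finset.mem_insert_self _ _))
      (ih fun i hi => hf i (Finset.mem_insert_of_mem hi))

theorem eq_of_sub_lt (h : ENorm v N) {a b : V} (hab : N (a - b) < N a) : N b = N a := by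
  apply le_antisymm
  · have := h.sub_le a (a - b)
    rw [sub_sub_cancel] at this
    exact this.trans (max_le le_rfl hab.le)
  · by_contra hlt
    push Not at hlt
    have := h.add_lt hab hlt
    rw [sub_add_cancel] at this
    exact lt_irrefl _ this

theorem eq_of_sub_lt' (h : ENorm v N) {a b : V} (hab : N (a - b) < N b) : N a = N b := by
  rw [h.sub_comm] at hab
  exact h.eq_of_sub_lt hab

theorem smul_sub_lt (h : ENorm v N) {a b : V} (hab : N (a - b) < N a) (c : E) (hc : c ≠ 0) :
    N (c • a - c • b) < N (c • a) := by
  rw [← smul_sub, h.smul, h.smul]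
  exact mul_lt_mul_of_pos_left hab (zero_lt_iff.2 ((Valuation.ne_zero_iff v).2 hc))

end ENorm

variable [Fintype ι]

theorem Orth.linearIndependent (h : ENorm v N) {Z : ι → V} (hZ : Orth E N Z) :
    LinearIndependent E Z := by
  rw [Fintype.linearIndependent_iff]
  intro c hc j
  have := hZ.2 c j
  rw [hc, h.zero, le_zero_iff, h.eq_zero_iff] at this
  exact (smul_eq_zero.1 this).resolve_right (hZ.1 j)

theorem Orth.le_iff (h : ENorm v N) {Z : ι → V} (hZ : Orth E N Z) (c : ι → E) (g : Γ) :
    N (∑ i, c i • Z i) ≤ g ↔ ∀ i, N (c i • Z i) ≤ g :=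
  ⟨fun hh i => (hZ.2 c i).trans hh, fun hh => h.sum_le fun i _ => hh i⟩

/-- small perturbations of orthogonal families -/
theorem Orth.perturb_sum (h : ENorm v N) {Z Z' : ι → V} (hZ : Orth E N Z)
    (hp : ∀ j, N (Z j - Z' j) < N (Z j)) (c : ι → E) (hc : ∑ i, c i • Z i ≠ 0) :
    N (∑ i, c i • Z i - ∑ i, c i • Z' i) < N (∑ i, c i • Z i) := by
  rw [← Finset.sum_sub_distrib]
  refine h.sum_lt (h.ne hc) fun i _ => ?_
  by_cases hci : c i = 0
  · simpa [hci, h.zero] using h.pos hc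
  · exact (h.smul_sub_lt (hp i) _ hci).trans_le (hZ.2 c i)

theorem Orth.perturb (h : ENorm v N) {Z Z' : ι → V} (hZ : Orth E N Z)
    (hp : ∀ j, N (Z j - Z' j) < N (Z j)) : Orth E N Z' := by
  refine ⟨fun j => ?_, fun c j => ?_⟩
  · have := h.eq_of_sub_lt (hp j)
    intro h0
    rw [h0, h.zero] at this
    exact h.ne (hZ.1 j) this.symm
  · have e : N (c j • Z' j) = N (c j • Z j) := by
      rw [h.smul, h.smul, h.eq_of_sub_lt (hp j)]
    by_cases hc : ∑ i, c i • Z i = 0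
    · have := Fintype.linearIndependent_iff.1 (hZ.linearIndependent h) c hc j
      rw [this]; simp [h.zero]
    · rw [e, h.eq_of_sub_lt (hZ.perturb_sum h hp c hc)]
      exact hZ.2 c j

theorem Spans.perturb (h : ENorm v N) {Z Z' : ι → V} (hZ : Orth E N Z) (hs : Spans E N Z)
    (hp : ∀ j, N (Z j - Z' j) < N (Z j)) : Spans E N Z' := by
  intro b hb
  obtain ⟨c, hc⟩ := hs b hb
  have e := h.eq_of_sub_lt hc
  have hne : ∑ i, c i • Z i ≠ 0 := by
    intro h0; rw [h0, h.zero] at e; exact h.ne hb e.symm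
  refine ⟨c, ?_⟩
  have := h.add_lt hc ((hZ.perturb_sum h hp c hne).trans_eq e)
  simpa using this

theorem Orth.reindex {κ : Type*} [Fintype κ] {Z : ι → V} (hZ : Orth E N Z) (e : κ ≃ ι) :
    Orth E N (Z ∘ e) := by
  refine ⟨fun j => hZ.1 _, fun c j => ?_⟩
  have := hZ.2 (c ∘ e.symm) (e j)
  rw [← e.sum_comp (fun i => (c ∘ e.symm) i • Z i)] at this
  simpa using this

theorem Spans.reindex {κ : Type*} [Fintype κ] {Z : ι → V} (hZ : Spans E N Z) (e : κ ≃ ι) :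
    Spans E N (Z ∘ e) := by
  intro b hb
  obtain ⟨c, hc⟩ := hZ b hb
  refine ⟨c ∘ e, ?_⟩
  rw [← e.sum_comp] at hc
  exact hc

/-- the exchange bound -/
theorem Orth.card_le (h : ENorm v N) {κ : Type*} [Fintype κ] {Z : ι → V}
    (hZ : Orth E N Z) {Y : κ → V} (hY : Spans E N Y) : Fintype.card ι ≤ Fintype.card κ := by
  choose c hc using fun i => hY (Z i) (hZ.1 i)
  have := (hZ.perturb h hc).linearIndependent h
  have hm : ∀ i, ∑ k, c i k • Y k ∈ Submodule.span E (Set.range Y) := fun i =>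
    Submodule.sum_mem _ fun k _ => Submodule.smul_mem _ _ (Submodule.subset_span ⟨k, rfl⟩)
  have l2 : LinearIndependent E (fun i => (⟨_, hm i⟩ : Submodule.span E (Set.range Y))) :=
    LinearIndependent.of_comp (Submodule.subtype _) this
  have := FiniteDimensional.span_of_finite E (Set.finite_range Y)
  exact l2.fintype_card_le_finrank.trans (finrank_range_le_card Y)

theorem Orth.option (h : ENorm v N) {Z : ι → V} (hZ : Orth E N Z) {b : V} (hb : b ≠ 0)
    (hm : ∀ c : ι → E, N b ≤ N (b - ∑ i, c i • Z i)) :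
    Orth E N (fun o : Option ι => o.elim b Z) := by
  refine ⟨fun j => by cases j; exacts [hb, hZ.1 _], fun c j => ?_⟩
  rw [Fintype.sum_option]
  simp only [Option.elim]
  have key : N (c none • b) ≤ N (c none • b + ∑ i, c (some i) • Z i) := by
    by_cases h0 : c none = 0
    · simp [h0, h.zero]
    · have := hm (fun i => - (c none)⁻¹ * c (some i))
      have e : c none • b + ∑ i, c (some i) • Z i
          = c none • (b - ∑ i, (- (c none)⁻¹ * c (some i)) • Z i) := by
        rw [smul_sub, Finset.smul_sum, sub_eq_add_neg, ← Finset.sum_neg_distrib]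
        congr 1
        refine Finset.sum_congr rfl fun i _ => ?_
        rw [smul_smul, ← neg_smul]
        congr 1
        field_simp
      rw [e, h.smul, h.smul]
      exact mul_le_mul_right this _
  cases j with
  | none => exact key
  | some j =>
    refine (hZ.2 (fun i => c (some i)) j).trans ?_
    have := h.sub_le (c none • b + ∑ i, c (some i) • Z i) (c none • b)
    rw [add_sub_cancel_left] at this
    exact this.trans (max_le le_rfl key)

theorem spans_of_maximal (h : ENorm v N) {Z : ι → V} (hZ : Orth E N Z)
    (hm : ∀ Y : Option ι → V, ¬ Orth E N Y) : Spans E N Z := by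
  intro b hb
  by_contra hcon
  push Not at hcon
  exact hm _ (hZ.option h hb hcon)

end norm

end GST


set_option linter.unusedSectionVars false

namespace GST

section val

variable {E L Γ ι : Type*} [Field E] [Field L] [Algebra E L]
    [LinearOrderedCommGroupWithZero Γ] {v : Valuation E Γ}

theorem ENorm.ofVal {w : Valuation L Γ} (hw : ∀ e, w (algebraMap E L e) = v e) : ENorm v w where
  eq_zero_iff b := Valuation.zero_iff w
  add_le a b := w.map_add a b
  smul c b := by rw [Algebra.smul_def, map_mul, hw]

theorem ENorm.self (w : Valuation L Γ) : ENorm (w.comap (algebraMap E L)) w :=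
  ENorm.ofVal fun _ => rfl

theorem ENorm.sup [Fintype ι] [Nonempty ι] {w : ι → Valuation L Γ}
    (hw : ∀ i e, w i (algebraMap E L e) = v e) :
    ENorm v (fun b : L => Finset.univ.sup fun i => w i b) where
  eq_zero_iff b := by
    constructor
    · intro h
      have := Finset.le_sup (f := fun i => w i b) (Finset.mem_univ (Classical.arbitrary ι))
      rw [h, le_zero_iff] at this
      exact (Valuation.zero_iff _).1 this
    · rintro rfl
      simp only [map_zero, ← bot_eq_zero]
      exact Finset.sup_bot _
  add_le a b := by
    refine Finset.sup_le fun i _ => ?_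
    exact ((w i).map_add a b).trans (max_le_max
      (Finset.le_sup (f := fun i => w i a) (Finset.mem_univ i))
      (Finset.le_sup (f := fun i => w i b) (Finset.mem_univ i)))
  smul c b := by
    obtain ⟨i, _, hi⟩ := Finset.exists_mem_eq_sup Finset.univ Finset.univ_nonempty
      (fun i => w i b)
    rw [hi]
    apply le_antisymm
    · refine Finset.sup_le fun j _ => ?_
      rw [Algebra.smul_def, map_mul, hw, ← hi]
      exact mul_le_mul_right (Finset.le_sup (f := fun i => w i b) (Finset.mem_univ j)) _
    · rw [← hw i, ← map_mul, ← Algebra.smul_def]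
      exact Finset.le_sup (f := fun i => w i (c • b)) (Finset.mem_univ i)

/-- products of orthogonal families in towers -/
theorem Orth.tower {F κ : Type*} [Field F] [Algebra E F] [Algebra F L] [IsScalarTower E F L]
    [Fintype ι] [Fintype κ]
    {w : Valuation L Γ} {X : ι → F} {Y : κ → L} (hY : Orth F w Y)
    (hX : Orth E (w.comap (algebraMap F L)) X) :
    Orth E w (fun p : ι × κ => algebraMap F L (X p.1) * Y p.2) := by
  refine ⟨fun p => mul_ne_zero (by simpa using hX.1 p.1) (hY.1 _), fun c p => ?_⟩
  have e : ∑ p : ι × κ, c p • (algebraMap F L (X p.1) * Y p.2)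
      = ∑ k, (∑ i, c (i, k) • X i) • Y k := by
    rw [Fintype.sum_prod_type_right]
    refine Finset.sum_congr rfl fun k _ => ?_
    rw [Finset.sum_smul]
    refine Finset.sum_congr rfl fun i _ => ?_
    rw [Algebra.smul_def (c (i, k) • X i), Algebra.smul_def (c (i,k)) (X i), map_mul,
      Algebra.smul_def, mul_assoc, ← IsScalarTower.algebraMap_apply]
  rw [e]
  refine le_trans ?_ (hY.2 (fun k => ∑ i, c (i, k) • X i) p.2)
  have := hX.2 (fun i => c (i, p.2)) p.1
  simp only [Valuation.comap_apply, Prod.mk.eta] at this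
  rw [Algebra.smul_def (∑ i, _), map_mul, ← smul_mul_assoc, map_mul]
  refine mul_le_mul_left (le_trans (le_of_eq ?_) this) _
  simp [Algebra.smul_def, ← IsScalarTower.algebraMap_apply E F L]

theorem Spans.tower {F κ : Type*} [Field F] [Algebra E F] [Algebra F L] [IsScalarTower E F L]
    [Fintype ι] [Fintype κ]
    {w : Valuation L Γ} {X : ι → F} {Y : κ → L} (hYo : Orth F w Y) (hY : Spans F w Y)
    (hX : Spans E (w.comap (algebraMap F L)) X) :
    Spans E w (fun p : ι × κ => algebraMap F L (X p.1) * Y p.2) := by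
  intro b hb
  obtain ⟨f, hf⟩ := hY b hb
  have hN : ENorm (w.comap (algebraMap F L)) w := ENorm.self w
  have ef := hN.eq_of_sub_lt hf
  have : ∀ k, ∃ c : ι → E, f k ≠ 0 →
      (w.comap (algebraMap F L)) (f k - ∑ i, c i • X i) < (w.comap (algebraMap F L)) (f k) := by
    intro k
    by_cases h : f k = 0
    · exact ⟨0, fun h' => (h' h).elim⟩
    · obtain ⟨c, hc⟩ := hX _ h
      exact ⟨c, fun _ => hc⟩
  choose c hc using this
  classical
  refine ⟨fun p => if f p.2 = 0 then 0 else c p.2 p.1, ?_⟩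
  have e : ∑ p : ι × κ, (if f p.2 = 0 then 0 else c p.2 p.1) • (algebraMap F L (X p.1) * Y p.2)
      = ∑ k, (if f k = 0 then 0 else ∑ i, c k i • X i) • Y k := by
    rw [Fintype.sum_prod_type_right]
    refine Finset.sum_congr rfl fun k _ => ?_
    dsimp only
    split_ifs with h
    · simp
    rw [Finset.sum_smul]
    refine Finset.sum_congr rfl fun i _ => ?_
    rw [Algebra.smul_def (c k i • X i), Algebra.smul_def (c k i) (X i), map_mul,
      Algebra.smul_def, mul_assoc, ← IsScalarTower.algebraMap_apply]
  rw [e]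
  have : b - ∑ k, (if f k = 0 then 0 else ∑ i, c k i • X i) • Y k
      = (b - ∑ k, f k • Y k) + ∑ k, (f k - (if f k = 0 then 0 else ∑ i, c k i • X i)) • Y k := by
    simp only [sub_smul, Finset.sum_sub_distrib]; ring
  rw [this]
  refine hN.add_lt hf (hN.sum_lt (hN.ne hb) fun k _ => ?_)
  split_ifs with h
  · simpa [h] using hN.pos hb
  · have h1 := hYo.2 f k
    rw [ef] at h1
    refine lt_of_lt_of_le ?_ h1
    rw [hN.smul, hN.smul]
    exact mul_lt_mul_of_pos_right (hc k h) (hN.pos (hYo.1 k))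

end val

section loc

variable {E L Γ ι : Type*} [Field E] [Field L] [Algebra E L]
    [LinearOrderedCommGroupWithZero Γ] [Fintype ι]

/-- a finite family of distinct valuations of `L` agreeing on `E`, torsion over `E` -/
structure Fam (v : Valuation E Γ) (w : ι → Valuation L Γ) : Prop where
  hw : ∀ i e, w i (algebraMap E L e) = v e
  tor : ∀ i b, b ≠ 0 → ∃ k : ℕ, k ≠ 0 ∧ ∃ c : E, c ≠ 0 ∧ w i b ^ k = v c
  inj : Function.Injective w

theorem val_eq_one_of_sub {w : Valuation L Γ} {a : L} (h : w (a - 1) < 1) : w a = 1 := by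
  have := Valuation.map_add_eq_of_lt_left (v := w) (x := 1) (y := a - 1) (by simpa using h)
  simpa using this

theorem geom_val_le {w : Valuation L Γ} {y : L} (hy : w y ≤ 1) (r : ℕ) :
    w (∑ i ∈ Finset.range r, y ^ i) ≤ 1 :=
  Valuation.map_sum_le _ fun i _ => by rw [map_pow]; exact pow_le_one₀ zero_le hy

theorem geom_val_mul {w : Valuation L Γ} {y : L} (hy : w y ≤ 1) {m : ℕ}
    (hm : w (∑ i ∈ Finset.range m, y ^ i) < 1) (k : ℕ) :
    w (∑ i ∈ Finset.range (m * k), y ^ i) < 1 := by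
  induction k with
  | zero => simp
  | succ k ih =>
    rw [Nat.mul_succ, Finset.sum_range_add]
    refine Valuation.map_add_lt _ ih ?_
    simp only [pow_add]
    rw [← Finset.mul_sum, map_mul, map_pow]
    exact (mul_le_of_le_one_left' (pow_le_one₀ zero_le hy)).trans_lt hm

theorem geom_exists (w : Valuation L Γ) (y : L) : ∃ m : ℕ, m ≠ 0 ∧
    ∀ k, w y ≤ 1 → w (∑ i ∈ Finset.range (m * k + 1), y ^ i) = 1 := by
  by_cases h : w y ≤ 1 ∧ ∃ m : ℕ, m ≠ 0 ∧ w (∑ i ∈ Finset.range m, y ^ i) < 1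
  · obtain ⟨hy, m, hm, hlt⟩ := h
    refine ⟨m, hm, fun k _ => ?_⟩
    rw [Finset.sum_range_succ']
    simp only [pow_succ, ← Finset.sum_mul, pow_zero]
    apply val_eq_one_of_sub
    rw [add_sub_cancel_right, map_mul]
    exact (mul_le_of_le_one_right' hy).trans_lt (geom_val_mul hy hlt k)
  · refine ⟨1, one_ne_zero, fun k hy => ?_⟩
    push Not at h
    exact le_antisymm (geom_val_le hy _) (h hy _ (by simp))

theorem geom_big {w : Valuation L Γ} {y : L} (hy : 1 < w y) (r : ℕ) :
    w (∑ i ∈ Finset.range (r + 1), y ^ i) = w y ^ r := by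
  rw [Finset.sum_range_succ, Valuation.map_add_eq_of_lt_right, map_pow]
  rw [map_pow]
  refine Valuation.map_sum_lt _ (pow_ne_zero _ (zero_lt_one.trans hy).ne') fun i hi => ?_
  rw [map_pow]
  exact pow_lt_pow_right₀ hy (Finset.mem_range.1 hi)

/-- the flattening function -/
theorem exists_flat (w : ι → Valuation L Γ) (y : L) : ∃ s : L, ∀ l,
    (w l y ≤ 1 → w l s = 1) ∧ (w l y < 1 → w l (s - 1) < 1) ∧ w l s ≤ 1 ∧ w l (s * y) ≤ 1 := by
  choose m hm hk using fun l => geom_exists (w l) y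
  set R := ∏ l, m l with hR
  have hR0 : R ≠ 0 := Finset.prod_ne_zero_iff.2 fun l _ => hm l
  set q := ∑ i ∈ Finset.range (R + 1), y ^ i with hq
  have h1 : ∀ l, w l y ≤ 1 → w l q = 1 := by
    intro l hl
    obtain ⟨k, hk'⟩ := Finset.dvd_prod_of_mem m (Finset.mem_univ l)
    have := hk l k hl
    rw [← hk'] at this
    exact this
  refine ⟨q⁻¹, fun l => ⟨fun h => ?_, fun h => ?_, ?_, ?_⟩⟩
  · rw [map_inv₀, h1 l h, inv_one]
  · have hq1 := h1 l h.le
    have hq0 : q ≠ 0 := fun h0 => by simp [h0] at hq1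
    have e : q⁻¹ - 1 = -((q - 1) * q⁻¹) := by field_simp; ring
    rw [e, Valuation.map_neg, map_mul, map_inv₀, hq1, inv_one, mul_one, hq,
      Finset.sum_range_succ']
    simp only [pow_succ, ← Finset.sum_mul, pow_zero, add_sub_cancel_right, map_mul]
    exact (mul_le_of_le_one_left' (geom_val_le h.le _)).trans_lt h
  · rcases le_or_gt (w l y) 1 with h | h
    · rw [map_inv₀, h1 l h, inv_one]
    · rw [map_inv₀, geom_big h]
      exact inv_le_one_of_one_le₀ (one_le_pow₀ h.le)
  · rcases le_or_gt (w l y) 1 with h | h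
    · rw [map_mul, map_inv₀, h1 l h, inv_one, one_mul]; exact h
    · rw [map_mul, map_inv₀, geom_big h, inv_mul_le_iff₀ (pow_pos (zero_lt_one.trans h) _), mul_one]
      exact le_self_pow₀ h.le hR0

variable {v : Valuation E Γ} {w : ι → Valuation L Γ}

theorem Fam.sep (H : Fam v w) {i l : ι} (hil : i ≠ l) : ∃ y, w i y = 1 ∧ w l y < 1 := by
  have : ∃ b, w i b ≠ w l b := by
    by_contra hc
    push Not at hc
    exact hil (H.inj (Valuation.ext hc))
  obtain ⟨b, hb⟩ := this
  have hb0 : b ≠ 0 := by rintro rfl; simp at hb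
  have main : ∀ b, b ≠ 0 → w l b < w i b → ∃ y, w i y = 1 ∧ w l y < 1 := by
    intro b hb0 hlt
    obtain ⟨k, hk, c, hc, h⟩ := H.tor i b hb0
    have hvc : v c ≠ 0 := (Valuation.ne_zero_iff _).2 hc
    refine ⟨b ^ k / algebraMap E L c, ?_, ?_⟩
    · rw [map_div₀, map_pow, h, H.hw, div_self hvc]
    · rw [map_div₀, map_pow, H.hw, div_lt_one₀ (zero_lt_iff.2 hvc), ← h]
      exact pow_lt_pow_left₀ hlt zero_le hk
  rcases lt_or_gt_of_ne hb with h | h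
  · refine main b⁻¹ (inv_ne_zero hb0) ?_
    rw [map_inv₀, map_inv₀]
    exact inv_strictAnti₀ (zero_lt_iff.2 ((Valuation.ne_zero_iff _).2 hb0)) h
  · exact main b hb0 h

theorem Fam.exists_t (H : Fam v w) (i : ι) : ∃ t, w i t = 1 ∧ ∀ l, l ≠ i → w l t < 1 := by
  classical
  have : ∀ l, ∃ y, w i y = 1 ∧ (l ≠ i → w l y < 1) ∧ ∀ j, w j y ≤ 1 := by
    intro l
    by_cases h : l = i
    · exact ⟨1, by simp, fun h' => (h' h).elim, by simp⟩
    · obtain ⟨y, h1, h2⟩ := H.sep (Ne.symm h)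
      obtain ⟨s, hs⟩ := exists_flat w y
      refine ⟨s * y, ?_, fun _ => ?_, fun j => (hs j).2.2.2⟩
      · rw [map_mul, (hs i).1 h1.le, h1, one_mul]
      · rw [map_mul, (hs l).1 h2.le, one_mul]; exact h2
  choose y h1 h2 h3 using this
  refine ⟨∏ l, y l, by rw [map_prod]; exact Finset.prod_eq_one fun l _ => h1 l, fun l hl => ?_⟩
  rw [← Finset.mul_prod_erase _ _ (Finset.mem_univ l), map_mul, map_prod]
  refine (mul_le_of_le_one_right' ?_).trans_lt (h2 l hl)
  exact Finset.prod_le_one' fun j _ => h3 j l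

theorem Fam.exists_eps (H : Fam v w) :
    ∃ ε : ι → L, ∀ i, w i (ε i - 1) < 1 ∧ ∀ l, l ≠ i → w l (ε i) < 1 := by
  classical
  choose t h1 h2 using H.exists_t
  set T := ∑ i, t i with hT
  have hr : ∀ i, w i (∑ j ∈ Finset.univ.erase i, t j) < 1 := fun i =>
    Valuation.map_sum_lt _ one_ne_zero fun j hj => h2 j i (Finset.ne_of_mem_erase hj).symm
  have hTi : ∀ i, T = t i + ∑ j ∈ Finset.univ.erase i, t j := fun i =>
    (Finset.add_sum_erase _ _ (Finset.mem_univ i)).symm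
  have hT1 : ∀ i, w i T = 1 := by
    intro i
    rw [hTi i, Valuation.map_add_eq_of_lt_left, h1]
    rw [h1]; exact hr i
  refine ⟨fun i => t i / T, fun i => ⟨?_, fun l hl => ?_⟩⟩
  · have hT0 : T ≠ 0 := by intro h0; have := hT1 i; simp [h0] at this
    have : t i / T - 1 = -((∑ j ∈ Finset.univ.erase i, t j) / T) := by
      field_simp; rw [hTi i]; ring
    rw [this, Valuation.map_neg, map_div₀, hT1, div_one]
    exact hr i
  · rw [map_div₀, hT1, div_one]; exact h2 i l hl

/-- localization of an element at one valuation -/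
theorem Fam.localize (H : Fam v w) (i : ι) (b : L) (hb : b ≠ 0) :
    ∃ b', w i (b - b') < w i b ∧ ∀ l, l ≠ i → w l b' < w i b := by
  obtain ⟨ε, hε⟩ := H.exists_eps
  obtain ⟨k, hk, c, hc, h⟩ := H.tor i b hb
  have hvc : v c ≠ 0 := (Valuation.ne_zero_iff _).2 hc
  have hb0 : ∀ l, 0 < w l b := fun l => zero_lt_iff.2 ((Valuation.ne_zero_iff _).2 hb)
  set y := (1 - ε i) * (b ^ k / algebraMap E L c) with hy
  obtain ⟨s, hs⟩ := exists_flat w y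
  have yi : w i y < 1 := by
    rw [hy, map_mul, map_div₀, map_pow, h, H.hw, div_self hvc, mul_one, Valuation.map_sub_swap]
    exact (hε i).1
  have yl : ∀ l, l ≠ i → w l y = w l b ^ k / w i b ^ k := by
    intro l hl
    rw [hy, map_mul, map_div₀, map_pow, h, H.hw]
    rw [Valuation.map_sub_eq_of_lt_left, map_one, one_mul]
    simpa using (hε i).2 l hl
  have sl : ∀ l, l ≠ i → w l (s * b) ≤ w i b := by
    intro l hl
    rw [map_mul]
    rcases le_or_gt (w l b) (w i b) with h' | h'
    · exact (mul_le_of_le_one_left' (hs l).2.2.1).trans h'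
    · have h4 := (hs l).2.2.2
      rw [map_mul, yl l hl] at h4
      have : w l b / w i b ≤ w l b ^ k / w i b ^ k := by
        rw [← div_pow]
        exact le_self_pow₀ ((one_le_div₀ (hb0 i)).2 h'.le) hk
      have h5 := (mul_le_mul_right this (w l s)).trans h4
      rwa [← mul_div_assoc, div_le_one₀ (hb0 i)] at h5
  refine ⟨s * ε i * b, ?_, fun l hl => ?_⟩
  · have : b - s * ε i * b = -(((s - 1) * ε i + (ε i - 1)) * b) := by ring
    rw [this, Valuation.map_neg, map_mul]
    refine mul_lt_of_lt_one_left (hb0 i) (Valuation.map_add_lt _ ?_ (hε i).1)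
    rw [map_mul, val_eq_one_of_sub (hε i).1, mul_one]
    exact (hs i).2.1 yi
  · have : s * ε i * b = ε i * (s * b) := by ring
    rw [this, map_mul]
    calc w l (ε i) * w l (s * b) ≤ w l (ε i) * w i b := mul_le_mul_right (sl l hl) _
      _ < w i b := mul_lt_of_lt_one_left (hb0 i) ((hε i).2 l hl)

/-- the joint family -/
theorem Fam.joint [Nonempty ι] (H : Fam v w) {κ : ι → Type*} [∀ i, Fintype (κ i)]
    (Z : ∀ i, κ i → L) (hZ : ∀ i, Orth E (w i) (Z i)) :
    ∃ Z' : (Σ i, κ i) → L,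
      Orth E (fun b => Finset.univ.sup fun i => w i b) Z' ∧
      ((∀ i, Spans E (w i) (Z i)) → Spans E (fun b => Finset.univ.sup fun i => w i b) Z') := by
  choose Z' h1 h2 using fun (p : Σ i, κ i) => H.localize p.1 (Z p.1 p.2) ((hZ p.1).1 p.2)
  have nrm : ∀ i, ENorm v (w i) := fun i => ENorm.ofVal (H.hw i)
  have hZ' : ∀ i, Orth E (w i) (fun k => Z' ⟨i, k⟩) := fun i =>
    (hZ i).perturb (nrm i) fun k => h1 ⟨i, k⟩
  have hv : ∀ p : Σ i, κ i, w p.1 (Z' p) = w p.1 (Z p.1 p.2) := fun p =>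
    (nrm p.1).eq_of_sub_lt (h1 p)
  have other : ∀ (p : Σ i, κ i) (c : E) l g, g ≠ 0 → l ≠ p.1 → w p.1 (c • Z' p) ≤ g →
      w l (c • Z' p) < g := by
    intro p c l g hg hl hle
    by_cases hc : c = 0
    · simpa [hc] using zero_lt_iff.2 hg
    refine lt_of_lt_of_le ?_ hle
    rw [(nrm l).smul, (nrm p.1).smul, hv]
    exact mul_lt_mul_of_pos_left (h2 p l hl) (zero_lt_iff.2 ((Valuation.ne_zero_iff v).2 hc))
  have le' : ∀ (p : Σ i, κ i) (c : E) l, w l (c • Z' p) ≤ w p.1 (c • Z' p) := by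
    intro p c l
    by_cases hl : l = p.1
    · subst hl; exact le_rfl
    by_cases hc : c = 0
    · simp [hc]
    · have : c • Z' p ≠ 0 := smul_ne_zero hc ((hZ' p.1).1 p.2)
      exact (other p c l _ ((nrm p.1).ne this) hl le_rfl).le
  classical
  refine ⟨Z', ⟨fun p => (hZ' p.1).1 p.2, fun c p => ?_⟩, fun hs b hb => ?_⟩
  · refine Finset.sup_le fun l _ => (le' p (c p) l).trans ?_
    obtain ⟨q, _, hq⟩ := Finset.exists_max_image Finset.univ (fun q : Σ i, κ i => w q.1 (c q • Z' q))
      ⟨p, Finset.mem_univ p⟩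
    refine (hq p (Finset.mem_univ _)).trans ?_
    refine le_trans ?_ (Finset.le_sup (f := fun i => w i (∑ i, c i • Z' i)) (Finset.mem_univ q.1))
    by_cases h0 : w q.1 (c q • Z' q) = 0
    · rw [h0]; exact zero_le
    rw [Fintype.sum_sigma, ← Finset.add_sum_erase _ _ (Finset.mem_univ q.1)]
    have hge := (hZ' q.1).2 (fun k => c ⟨q.1, k⟩) q.2
    rw [Valuation.map_add_eq_of_lt_left]
    · exact hge
    · refine lt_of_lt_of_le ?_ hge
      refine Valuation.map_sum_lt _ h0 fun l hl => Valuation.map_sum_lt _ h0 fun k _ => ?_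
      exact other ⟨l, k⟩ _ q.1 _ h0 (Finset.ne_of_mem_erase hl).symm (hq ⟨l, k⟩ (Finset.mem_univ _))
  · have hs' : ∀ i, Spans E (w i) (fun k => Z' ⟨i, k⟩) := fun i =>
      (hs i).perturb (nrm i) (hZ i) fun k => h1 ⟨i, k⟩
    choose c hc using fun i => hs' i b hb
    set M := Finset.univ.sup fun i => w i b with hM
    have hleM : ∀ i, w i b ≤ M := fun i => Finset.le_sup (f := fun i => w i b) (Finset.mem_univ i)
    have hM0 : M ≠ 0 := by
      intro h0
      have := hleM (Classical.arbitrary ι)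
      rw [h0, le_zero_iff] at this
      exact hb ((Valuation.zero_iff _).1 this)
    refine ⟨fun p => if w p.1 b = M then c p.1 p.2 else 0, ?_⟩
    refine (Finset.sup_lt_iff (bot_lt_iff_ne_bot.2 (by rwa [bot_eq_zero]))).2 fun i _ => ?_
    have hoth : ∀ l, l ≠ i → w i (∑ k, (if w l b = M then c l k else 0) • Z' ⟨l, k⟩) < M := by
      intro l hl
      refine Valuation.map_sum_lt _ hM0 fun k _ => ?_
      split_ifs with h
      · refine other ⟨l, k⟩ _ i _ hM0 hl.symm ?_
        rw [← h, ← (nrm l).eq_of_sub_lt (hc l)]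
        exact (hZ' l).2 (c l) k
      · simpa using zero_lt_iff.2 hM0
    rw [Fintype.sum_sigma, ← Finset.add_sum_erase _ _ (Finset.mem_univ i), ← sub_sub]
    refine Valuation.map_sub_lt _ ?_
      (Valuation.map_sum_lt _ hM0 fun l hl => hoth l (Finset.ne_of_mem_erase hl))
    dsimp only
    split_ifs with h
    · exact (hc i).trans_eq h
    · simpa only [zero_smul, Finset.sum_const_zero, sub_zero] using lt_of_le_of_ne (hleM i) h

end loc

end GST


set_option linter.unusedSectionVars false

namespace GST

theorem val_le_iff {L : Type*} [Field L] (A : ValuationSubring L) {a b : L} (hb : b ≠ 0) :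
    A.valuation a ≤ A.valuation b ↔ a / b ∈ A := by
  rw [← A.valuation_le_one_iff, map_div₀,
    div_le_one₀ (zero_lt_iff.2 ((Valuation.ne_zero_iff _).2 hb))]

theorem exists_two {L Γ ι : Type*} [Field L] [LinearOrderedCommGroupWithZero Γ]
    (w : Valuation L Γ) (s : Finset ι) (f : ι → L) (h0 : ∑ i ∈ s, f i = 0)
    (hne : ∃ i ∈ s, f i ≠ 0) : ∃ i ∈ s, ∃ j ∈ s, i ≠ j ∧ f i ≠ 0 ∧ w (f i) = w (f j) := by
  classical
  obtain ⟨i0, hi0, hfi0⟩ := hne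
  obtain ⟨i, hi, hmax⟩ := Finset.exists_max_image s (fun i => w (f i)) ⟨i0, hi0⟩
  have hfi : w (f i) ≠ 0 := fun h => by
    have := hmax i0 hi0
    rw [h, le_zero_iff, Valuation.zero_iff] at this
    exact hfi0 this
  by_contra hcon
  push Not at hcon
  have hlt : w (∑ j ∈ s.erase i, f j) < w (f i) := by
    refine Valuation.map_sum_lt _ hfi fun j hj => ?_
    obtain ⟨hj1, hj2⟩ := Finset.mem_erase.1 hj
    exact lt_of_le_of_ne (hmax j hj2)
      (hcon i hi j hj2 hj1.symm ((Valuation.ne_zero_iff _).1 hfi)).symm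
  have := Valuation.map_add_eq_of_lt_left w hlt
  rw [Finset.add_sum_erase _ _ hi, h0, map_zero] at this
  exact hfi this.symm

theorem exists_tor {E L Γ : Type*} [Field E] [Field L] [Algebra E L]
    [LinearOrderedCommGroupWithZero Γ] (w : Valuation L Γ) {b : L} (hb : b ≠ 0)
    (ha : IsIntegral E b) : ∃ k : ℕ, k ≠ 0 ∧ k ≤ (minpoly E b).natDegree ∧
      ∃ c : E, c ≠ 0 ∧ w b ^ k = w (algebraMap E L c) := by
  have h0 : ∑ i ∈ Finset.range ((minpoly E b).natDegree + 1),
      algebraMap E L ((minpoly E b).coeff i) * b ^ i = 0 := by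
    have := minpoly.aeval E b
    rw [Polynomial.aeval_eq_sum_range] at this
    simpa [Algebra.smul_def] using this
  have key : ∀ i j : ℕ, i < j → j ≤ (minpoly E b).natDegree →
      algebraMap E L ((minpoly E b).coeff i) * b ^ i ≠ 0 →
      w (algebraMap E L ((minpoly E b).coeff i) * b ^ i)
        = w (algebraMap E L ((minpoly E b).coeff j) * b ^ j) →
      ∃ k : ℕ, k ≠ 0 ∧ k ≤ (minpoly E b).natDegree ∧
      ∃ c : E, c ≠ 0 ∧ w b ^ k = w (algebraMap E L c) := by
    intro i j hij hj hne heq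
    have hwb : w b ≠ 0 := (Valuation.ne_zero_iff _).2 hb
    have hi0 : (minpoly E b).coeff i ≠ 0 := fun h => hne (by simp [h])
    have hj0 : (minpoly E b).coeff j ≠ 0 := fun h => by
      simp only [h, map_zero, zero_mul] at heq
      exact hne ((Valuation.zero_iff _).1 heq)
    refine ⟨j - i, by omega, by omega, (minpoly E b).coeff i / (minpoly E b).coeff j,
      div_ne_zero hi0 hj0, ?_⟩
    rw [map_mul, map_mul, map_pow, map_pow] at heq
    have hj1 : w (algebraMap E L ((minpoly E b).coeff j)) ≠ 0 :=
      (Valuation.ne_zero_iff _).2 (by simpa using hj0)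
    rw [map_div₀, map_div₀, eq_div_iff hj1]
    have e : w b ^ j = w b ^ (j - i) * w b ^ i := by rw [← pow_add]; congr 1; omega
    rw [e, ← mul_assoc] at heq
    rw [mul_right_cancel₀ (pow_ne_zero i hwb) heq, mul_comm]
  obtain ⟨i, hi, j, hj, hij, hfi, heq⟩ := exists_two w _ _ h0
    ⟨(minpoly E b).natDegree, by simp, by simp [minpoly.monic ha, hb]⟩
  rw [Finset.mem_range, Nat.lt_succ_iff] at hi hj
  rcases lt_or_gt_of_ne hij with h | h
  · exact key i j h hj hfi heq
  · refine key j i h hi (fun h' => hfi ?_) heq.symm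
    rw [h', map_zero] at heq
    exact (Valuation.zero_iff _).1 heq

def Ext (E L : Type*) [Field E] [Field L] [Algebra E L] (O : ValuationSubring E) :
    Set (ValuationSubring L) := {W | W.comap (algebraMap E L) = O}

section ext

variable {E L : Type*} [Field E] [Field L] [Algebra E L] {O : ValuationSubring E}
  {W : ValuationSubring L}

theorem Ext.le_iff (hW : W ∈ Ext E L O) (a b : E) :
    W.valuation (algebraMap E L a) ≤ W.valuation (algebraMap E L b) ↔
      O.valuation a ≤ O.valuation b := by
  by_cases hb : b = 0
  · simp [hb]
  · rw [val_le_iff _ hb, val_le_iff _ (by simpa using hb), ← map_div₀]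
    rw [← show W.comap (algebraMap E L) = O from hW]
    rfl

theorem Ext.eq_iff (hW : W ∈ Ext E L O) (a b : E) :
    W.valuation (algebraMap E L a) = W.valuation (algebraMap E L b) ↔
      O.valuation a = O.valuation b := by
  rw [le_antisymm_iff, le_antisymm_iff, (Ext.le_iff hW), (Ext.le_iff hW)]

theorem Ext.tor [FiniteDimensional E L] (b : L) (hb : b ≠ 0) :
    ∃ c : E, c ≠ 0 ∧
      W.valuation b ^ (Module.finrank E L).factorial = W.valuation (algebraMap E L c) := by
  obtain ⟨k, hk, hkn, c, hc, h⟩ := exists_tor W.valuation hb (IsIntegral.of_finite E b)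
  have : k ∣ (Module.finrank E L).factorial :=
    Nat.dvd_factorial (Nat.pos_of_ne_zero hk) (hkn.trans (minpoly.natDegree_le b))
  obtain ⟨m, hm⟩ := this
  refine ⟨c ^ m, pow_ne_zero _ hc, ?_⟩
  rw [hm, pow_mul, h, map_pow, map_pow]

/-- the common value group -/
theorem Ext.exists_common [FiniteDimensional E L] (hW : W ∈ Ext E L O) :
    ∃ w : Valuation L O.ValueGroup, (∀ a b, w a ≤ w b ↔ W.valuation a ≤ W.valuation b) ∧
      ∀ b, ∀ c : E, W.valuation b ^ (Module.finrank E L).factorial = W.valuation (algebraMap E L c)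
        → w b = O.valuation c := by
  set M := (Module.finrank E L).factorial with hM
  have hM0 : M ≠ 0 := Nat.factorial_ne_zero _
  have : ∀ b : L, ∃ c : E, W.valuation b ^ M = W.valuation (algebraMap E L c) := by
    intro b
    by_cases hb : b = 0
    · exact ⟨0, by simp [hb, hM0]⟩
    · obtain ⟨c, _, h⟩ := Ext.tor (E := E) (W := W) b hb
      exact ⟨c, h⟩
  choose f hf using this
  have uniq : ∀ b, ∀ c : E, W.valuation b ^ M = W.valuation (algebraMap E L c) →
      O.valuation (f b) = O.valuation c := by
    intro b c h
    rw [hf b, (Ext.eq_iff hW)] at h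
    exact h
  have hle : ∀ a b, O.valuation (f a) ≤ O.valuation (f b) ↔ W.valuation a ≤ W.valuation b := by
    intro a b
    rw [← (Ext.le_iff hW), ← hf, ← hf]
    exact pow_le_pow_iff_left₀ zero_le zero_le hM0
  refine ⟨⟨⟨⟨fun b => O.valuation (f b), ?_⟩, ?_, ?_⟩, ?_⟩, hle, uniq⟩
  · rw [uniq 0 0 (by simp [hM0]), map_zero]
  · show O.valuation (f 1) = 1
    rw [uniq 1 1 (by simp), map_one]
  · intro a b
    show O.valuation (f (a * b)) = O.valuation (f a) * O.valuation (f b)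
    rw [uniq (a * b) (f a * f b) (by simp only [map_mul, mul_pow, hf]), map_mul]
  · intro a b
    show O.valuation (f (a + b)) ≤ max (O.valuation (f a)) (O.valuation (f b))
    rw [le_max_iff, hle, hle, ← le_max_iff]
    exact W.valuation.map_add a b

/-- the common restriction -/
noncomputable def vpow (E L : Type*) [Field E] [Field L] [Algebra E L] (O : ValuationSubring E) :
    Valuation E O.ValueGroup :=
  O.valuation.map (powMonoidWithZeroHom (Nat.factorial_ne_zero (Module.finrank E L)))
    (fun _ _ h => pow_le_pow_left' h _)

theorem vpow_apply (e : E) : vpow E L O e = O.valuation e ^ (Module.finrank E L).factorial := rfl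

noncomputable def Ext.cv [FiniteDimensional E L] (hW : W ∈ Ext E L O) :
    Valuation L O.ValueGroup := (Ext.exists_common hW).choose

theorem Ext.cv_le_iff [FiniteDimensional E L] (hW : W ∈ Ext E L O) (a b : L) :
    (Ext.cv hW) a ≤ (Ext.cv hW) b ↔ W.valuation a ≤ W.valuation b :=
  (Ext.exists_common hW).choose_spec.1 a b

theorem Ext.cv_eq [FiniteDimensional E L] (hW : W ∈ Ext E L O) {b : L} {c : E}
    (h : W.valuation b ^ (Module.finrank E L).factorial = W.valuation (algebraMap E L c)) :
    (Ext.cv hW) b = O.valuation c :=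
  (Ext.exists_common hW).choose_spec.2 b c h

theorem Ext.cv_le_one_iff [FiniteDimensional E L] (hW : W ∈ Ext E L O) (a : L) :
    (Ext.cv hW) a ≤ 1 ↔ a ∈ W := by
  rw [← map_one (Ext.cv hW), (Ext.cv_le_iff hW), map_one, W.valuation_le_one_iff]

theorem Ext.cv_lt_iff [FiniteDimensional E L] (hW : W ∈ Ext E L O) (a b : L) :
    (Ext.cv hW) a < (Ext.cv hW) b ↔ W.valuation a < W.valuation b := by
  rw [← not_le, ← not_le, (Ext.cv_le_iff hW)]

theorem Ext.cv_algebraMap [FiniteDimensional E L] (hW : W ∈ Ext E L O) (e : E) :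
    (Ext.cv hW) (algebraMap E L e) = vpow E L O e := by
  rw [Ext.cv_eq hW (c := e ^ (Module.finrank E L).factorial) (by simp), vpow_apply, map_pow]

theorem Ext.fam [FiniteDimensional E L] {s : Finset (ValuationSubring L)}
    (hs : ∀ W ∈ s, W ∈ Ext E L O) :
    Fam (vpow E L O) (fun W : s => (Ext.cv (hs W.1 W.2))) where
  hw i e := Ext.cv_algebraMap _ e
  tor i b hb := by
    obtain ⟨c, hc, h⟩ := Ext.tor (E := E) (W := i.1) b hb
    refine ⟨(Module.finrank E L).factorial, Nat.factorial_ne_zero _, c, hc, ?_⟩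
    rw [Ext.cv_eq _ h, vpow_apply]
  inj i j hij := by
    apply Subtype.ext
    ext a
    rw [← (Ext.cv_le_one_iff (hs i.1 i.2)), ← (Ext.cv_le_one_iff (hs j.1 j.2))]
    dsimp only at hij
    rw [hij]

theorem orth_cv [FiniteDimensional E L] (hW : W ∈ Ext E L O) {ι : Type*} [Fintype ι] (Z : ι → L) :
    Orth E (Ext.cv hW) Z ↔ Orth E W.valuation Z := by
  simp only [Orth, (Ext.cv_le_iff hW)]

theorem spans_cv [FiniteDimensional E L] (hW : W ∈ Ext E L O) {ι : Type*} [Fintype ι] (Z : ι → L) :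
    Spans E (Ext.cv hW) Z ↔ Spans E W.valuation Z := by
  simp only [Spans, (Ext.cv_lt_iff hW)]

end ext

section rk

variable (E : Type*) {L : Type*} [Field E] [Field L] [Algebra E L]

noncomputable def rk (W : ValuationSubring L) : ℕ :=
  sSup {k | ∃ Z : Fin k → L, Orth E W.valuation Z}

variable {E}

theorem orth_card_le_finrank [FiniteDimensional E L] {W : ValuationSubring L} {ι : Type*}
    [Fintype ι] {Z : ι → L} (hZ : Orth E W.valuation Z) : Fintype.card ι ≤ Module.finrank E L :=
  (hZ.linearIndependent (ENorm.self _)).fintype_card_le_finrank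

theorem rk_bdd [FiniteDimensional E L] (W : ValuationSubring L) :
    BddAbove {k | ∃ Z : Fin k → L, Orth E W.valuation Z} :=
  ⟨Module.finrank E L, by rintro k ⟨Z, hZ⟩; simpa using orth_card_le_finrank hZ⟩

theorem le_rk [FiniteDimensional E L] {W : ValuationSubring L} {ι : Type*}
    [Fintype ι] {Z : ι → L} (hZ : Orth E W.valuation Z) : Fintype.card ι ≤ rk E W :=
  le_csSup (rk_bdd W) ⟨_, hZ.reindex (Fintype.equivFin ι).symm⟩

theorem rk_spec [FiniteDimensional E L] (W : ValuationSubring L) :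
    ∃ Z : Fin (rk E W) → L, Orth E W.valuation Z ∧ Spans E W.valuation Z := by
  have : rk E W ∈ {k | ∃ Z : Fin k → L, Orth E W.valuation Z} := by
    refine Nat.sSup_mem ⟨0, ?_⟩ (rk_bdd W)
    exact ⟨Fin.elim0, fun j => j.elim0, fun c j => j.elim0⟩
  obtain ⟨Z, hZ⟩ := this
  refine ⟨Z, hZ, spans_of_maximal (ENorm.self _) hZ fun Y hY => ?_⟩
  have := le_rk hY
  simp at this

theorem rk_eq [FiniteDimensional E L] {W : ValuationSubring L} {ι : Type*}
    [Fintype ι] {Z : ι → L} (hZ : Orth E W.valuation Z) (hs : Spans E W.valuation Z) :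
    rk E W = Fintype.card ι := by
  refine le_antisymm ?_ (le_rk hZ)
  obtain ⟨Y, hY, _⟩ := rk_spec (E := E) W
  simpa using hY.card_le (ENorm.self _) hs

theorem rk_pos [FiniteDimensional E L] (W : ValuationSubring L) : 0 < rk E W := by
  have : Orth E W.valuation (fun _ : Fin 1 => (1 : L)) := by
    refine ⟨fun _ => one_ne_zero, fun c j => ?_⟩
    have : j = 0 := Subsingleton.elim _ _
    subst this
    simp
  exact Nat.lt_of_lt_of_le (by simp) (le_rk this)

theorem comap_val_le_iff {F : Type*} [Field F] [Algebra F L] (W : ValuationSubring L) (a b : F) :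
    (W.comap (algebraMap F L)).valuation a ≤ (W.comap (algebraMap F L)).valuation b ↔
     (W.valuation.comap (algebraMap F L)) a ≤ (W.valuation.comap (algebraMap F L)) b :=
  (Ext.le_iff (O := W.comap (algebraMap F L)) rfl a b).symm

theorem orth_comap {F ι : Type*} [Fintype ι] [Field F] [Algebra E F] [Algebra F L]
    (W : ValuationSubring L) (Z : ι → F) :
    Orth E (W.comap (algebraMap F L)).valuation Z ↔
      Orth E (W.valuation.comap (algebraMap F L)) Z := by
  simp only [Orth, comap_val_le_iff]

theorem spans_comap {F ι : Type*} [Fintype ι] [Field F] [Algebra E F] [Algebra F L]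
    (W : ValuationSubring L) (Z : ι → F) :
    Spans E (W.comap (algebraMap F L)).valuation Z ↔
      Spans E (W.valuation.comap (algebraMap F L)) Z := by
  simp only [Spans, ← not_le, comap_val_le_iff]

theorem rk_tower (F : Type*) [Field F] [Algebra E F] [Algebra F L] [IsScalarTower E F L]
    [FiniteDimensional E F] [FiniteDimensional F L] [FiniteDimensional E L]
    (W : ValuationSubring L) :
    rk E W = rk E (W.comap (algebraMap F L)) * rk F W := by
  obtain ⟨X, hX, hXs⟩ := rk_spec (E := E) (W.comap (algebraMap F L))
  obtain ⟨Y, hY, hYs⟩ := rk_spec (E := F) W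
  rw [orth_comap] at hX
  rw [spans_comap] at hXs
  rw [rk_eq (hY.tower hX) (hYs.tower hY hXs)]
  simp

variable {O : ValuationSubring E}

theorem sum_rk_le [FiniteDimensional E L] {s : Finset (ValuationSubring L)}
    (hs : ∀ W ∈ s, W ∈ Ext E L O) : ∑ W ∈ s, rk E W ≤ Module.finrank E L := by
  rcases s.eq_empty_or_nonempty with rfl | hne
  · simp
  choose Z hZ hZs using fun W : s => rk_spec (E := E) W.1
  have : Nonempty s := hne.to_subtype
  obtain ⟨Z', hZ', _⟩ := (Ext.fam hs).joint Z (fun W => (orth_cv _ _).2 (hZ W))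
  have := (hZ'.linearIndependent (ENorm.sup (Ext.fam hs).hw)).fintype_card_le_finrank
  rw [Fintype.card_sigma] at this
  simp only [Fintype.card_fin] at this
  rwa [Finset.sum_coe_sort s (fun W => rk E W)] at this

theorem ext_finite (E L : Type*) [Field E] [Field L] [Algebra E L] [FiniteDimensional E L]
    (O : ValuationSubring E) : (Ext E L O).Finite := by
  by_contra hinf
  obtain ⟨s, hs, hc⟩ := Set.Infinite.exists_subset_card_eq hinf (Module.finrank E L + 1)
  have h1 := sum_rk_le (O := O) (s := s) (fun W hW => hs hW)
  have h2 : s.card ≤ ∑ W ∈ s, rk E W := by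
    rw [Finset.card_eq_sum_ones]
    exact Finset.sum_le_sum fun W _ => rk_pos W
  omega

variable (L O) in
noncomputable def dg : ℕ := ∑ᶠ W ∈ Ext E L O, rk E W

theorem dg_eq [FiniteDimensional E L] : dg L O = ∑ W ∈ (ext_finite E L O).toFinset, rk E W :=
  finsum_mem_eq_finite_toFinset_sum _ _

theorem dg_le [FiniteDimensional E L] : dg L O ≤ Module.finrank E L := by
  rw [dg_eq]; exact sum_rk_le fun W hW => by simpa using hW

theorem sum_le_dg [FiniteDimensional E L] {s : Finset (ValuationSubring L)}
    (hs : ∀ W ∈ s, W ∈ Ext E L O) : ∑ W ∈ s, rk E W ≤ dg L O := by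
  rw [dg_eq]
  exact Finset.sum_le_sum_of_subset fun W hW => by simpa using hs W hW

theorem dg_tower (F : Type*) [Field F] [Algebra E F] [Algebra F L] [IsScalarTower E F L]
    [FiniteDimensional E F] [FiniteDimensional F L] [FiniteDimensional E L] :
    dg L O = ∑ U ∈ (ext_finite E F O).toFinset, rk E U * dg L U := by
  classical
  have hc : ∀ W : ValuationSubring L, (W.comap (algebraMap F L)).comap (algebraMap E F)
      = W.comap (algebraMap E L) := by
    intro W
    rw [ValuationSubring.comap_comap, ← IsScalarTower.algebraMap_eq]
  rw [dg_eq, ← Finset.sum_fiberwise_of_maps_to (t := (ext_finite E F O).toFinset)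
    (g := fun W => W.comap (algebraMap F L))]
  · refine Finset.sum_congr rfl fun U hU => ?_
    rw [dg_eq, Finset.mul_sum]
    have hU' : U.comap (algebraMap E F) = O := by simpa [Ext] using hU
    refine Finset.sum_congr ?_ fun W hW => ?_
    · ext W
      simp only [Finset.mem_filter, Set.Finite.mem_toFinset, Ext, Set.mem_ofPred_eq]
      constructor
      · exact fun h => h.2
      · intro h
        refine ⟨?_, h⟩
        rw [← hc, h, hU']
    · have : W.comap (algebraMap F L) = U := by simpa [Ext] using hW
      rw [rk_tower F W, this]
  · intro W hW
    simp only [Set.Finite.mem_toFinset, Ext, Set.mem_ofPred_eq] at hW ⊢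
    rw [hc, hW]

variable (L O) in
/-- the fundamental equality -/
def Good : Prop := dg L O = Module.finrank E L

theorem Good.of_finset [FiniteDimensional E L] {s : Finset (ValuationSubring L)}
    (hs : ∀ W ∈ s, W ∈ Ext E L O) (h : Module.finrank E L ≤ ∑ W ∈ s, rk E W) : Good L O :=
  le_antisymm dg_le (h.trans (sum_le_dg hs))

section
variable (F : Type*) [Field F] [Algebra E F] [Algebra F L] [IsScalarTower E F L]
    [FiniteDimensional E F] [FiniteDimensional F L] [FiniteDimensional E L]

theorem Good.tower (h1 : Good F O) (h2 : ∀ U ∈ Ext E F O, Good L U) : Good L O := by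
  unfold Good at h1 ⊢
  rw [dg_tower F, ← Module.finrank_mul_finrank E F L, ← h1, dg_eq, Finset.sum_mul]
  exact Finset.sum_congr rfl fun U hU => by rw [h2 U (by simpa using hU)]

theorem Good.down (h : Good L O) : Good F O ∧ ∀ U ∈ Ext E F O, Good L U := by
  unfold Good at h
  have hF : ∑ U ∈ (ext_finite E F O).toFinset, rk E U * Module.finrank F L
      = Module.finrank E L := by
    apply le_antisymm
    · rw [← Finset.sum_mul, ← dg_eq, ← Module.finrank_mul_finrank E F L]
      exact Nat.mul_le_mul_right _ dg_le
    · rw [← h, dg_tower F]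
      exact Finset.sum_le_sum fun U _ => Nat.mul_le_mul_left _ dg_le
  constructor
  · rw [← Finset.sum_mul, ← dg_eq, ← Module.finrank_mul_finrank E F L] at hF
    exact Nat.eq_of_mul_eq_mul_right Module.finrank_pos hF
  · rw [dg_tower F, ← hF] at h
    have := (Finset.sum_eq_sum_iff_of_le
      (fun U _ => Nat.mul_le_mul_left (rk E U) (dg_le (L := L) (O := U)))).1 h
    intro U hU
    exact Nat.eq_of_mul_eq_mul_left (rk_pos U) (this U (by simpa using hU))

end

end rk

end GST


set_option linter.unusedSectionVars false

namespace GST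

universe u

/-! ### transport -/

section transport

variable {E L E' L' : Type*} [Field E] [Field L] [Algebra E L] [Field E'] [Field L'] [Algebra E' L']

theorem comap_equiv_val_le (f : L ≃+* L') (W : ValuationSubring L') (a b : L) :
    (W.comap (f : L →+* L')).valuation a ≤ (W.comap (f : L →+* L')).valuation b ↔
      W.valuation (f a) ≤ W.valuation (f b) := by
  by_cases hb : b = 0
  · simp [hb]
  · rw [val_le_iff _ hb, val_le_iff _ (by simpa using hb), ← map_div₀]
    rfl

theorem orth_equiv (e : E ≃+* E') (f : L ≃+* L')
    (h : ∀ x, f (algebraMap E L x) = algebraMap E' L' (e x)) (W : ValuationSubring L')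
    {ι : Type*} [Fintype ι] (Z : ι → L) :
    Orth E (W.comap (f : L →+* L')).valuation Z ↔ Orth E' W.valuation (f ∘ Z) := by
  have hs : ∀ (c : E) (b : L), f (c • b) = e c • f b := by
    intro c b; rw [Algebra.smul_def, Algebra.smul_def, map_mul, h]
  simp only [Orth, comap_equiv_val_le, map_sum, hs, Function.comp]
  refine and_congr (by simp) ⟨fun hh c j => ?_, fun hh c j => hh (e ∘ c) j⟩
  simpa using hh (e.symm ∘ c) j

theorem rk_equiv (e : E ≃+* E') (f : L ≃+* L')
    (h : ∀ x, f (algebraMap E L x) = algebraMap E' L' (e x)) (W : ValuationSubring L') :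
    rk E (W.comap (f : L →+* L')) = rk E' W := by
  unfold rk
  congr 1
  ext k
  constructor
  · rintro ⟨Z, hZ⟩
    exact ⟨_, (orth_equiv e f h W Z).1 hZ⟩
  · rintro ⟨Z, hZ⟩
    refine ⟨f.symm ∘ Z, (orth_equiv e f h W _).2 ?_⟩
    have : f ∘ f.symm ∘ Z = Z := by ext; simp
    rwa [this]

theorem Good.equiv [FiniteDimensional E L] [FiniteDimensional E' L'] (e : E ≃+* E') (f : L ≃+* L')
    (h : ∀ x, f (algebraMap E L x) = algebraMap E' L' (e x)) {O' : ValuationSubring E'}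
    (hg : Good L' O') : Good L (O'.comap (e : E →+* E')) := by
  classical
  have inj : Function.Injective (fun W : ValuationSubring L' => W.comap (f : L →+* L')) := by
    intro W W' hWW
    ext x
    have : f.symm x ∈ W.comap (f : L →+* L') ↔ f.symm x ∈ W'.comap (f : L →+* L') := by
      dsimp only at hWW
      rw [hWW]
    simpa [ValuationSubring.mem_comap] using this
  refine Good.of_finset
    (s := (ext_finite E' L' O').toFinset.image (fun W => W.comap (f : L →+* L'))) ?_ ?_
  · intro W hW
    obtain ⟨W', hW', rfl⟩ := Finset.mem_image.1 hW
    have hW'' : W'.comap (algebraMap E' L') = O' := by simpa [Ext] using hW'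
    show (W'.comap (f : L →+* L')).comap (algebraMap E L) = _
    rw [← hW'', ValuationSubring.comap_comap, ValuationSubring.comap_comap]
    congr 1
    ext x
    exact h x
  · rw [Finset.sum_image (fun _ _ _ _ hh => inj hh)]
    simp only [rk_equiv e f h]
    rw [← dg_eq, show dg L' O' = Module.finrank E' L' from hg]
    refine le_of_eq (Algebra.finrank_eq_of_equiv_equiv e f ?_)
    ext x
    exact (h x).symm

end transport

def Stable (E : Type u) [Field E] (O : ValuationSubring E) : Prop :=
  ∀ (L : Type u) [Field L] [Algebra E L] [FiniteDimensional E L], Good L O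

/-! ### conjugation -/

theorem multiset_prod_le_one {Γ : Type*} [LinearOrderedCommGroupWithZero Γ] {m : Multiset Γ}
    (h : ∀ x ∈ m, x ≤ 1) : m.prod ≤ 1 := by
  induction m using Multiset.induction_on with
  | empty => simp
  | cons a m ih =>
    rw [Multiset.prod_cons]
    exact mul_le_one' (h a (by simp)) (ih fun x hx => h x (Multiset.mem_cons_of_mem hx))


theorem Ext.conj {E L : Type*} [Field E] [Field L] [Algebra E L] [FiniteDimensional E L]
    [Normal E L] {O : ValuationSubring E} {V₁ V₂ : ValuationSubring L}
    (h1 : V₁ ∈ Ext E L O) (h2 : V₂ ∈ Ext E L O) :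
    ∃ σ : L ≃ₐ[E] L, V₂ = V₁.comap (σ : L →+* L) := by
  classical
  by_contra hcon
  push Not at hcon
  obtain ⟨S, hS⟩ : ∃ S : Finset (ValuationSubring L), ∀ W, W ∈ S ↔ W ∈ Ext E L O :=
    ⟨(ext_finite E L O).toFinset, fun W => by simp⟩
  have H := Ext.fam (s := S) (O := O) (fun W hW => (hS W).1 hW)
  obtain ⟨ε, hε⟩ := H.exists_eps
  have hmem : ∀ W ∈ Ext E L O, ∀ σ : L ≃ₐ[E] L, W.comap (σ : L →+* L) ∈ S := by
    intro W hW σ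
    rw [hS]
    show (W.comap (σ : L →+* L)).comap (algebraMap E L) = O
    rw [ValuationSubring.comap_comap, ← show W.comap (algebraMap E L) = O from hW]
    congr 1
    ext x
    simp
  set t := ∑ i : S, if (∃ σ : L ≃ₐ[E] L, i.1 = V₁.comap (σ : L →+* L)) then ε i else 0 with ht
  have t2 : ∀ i : S, (¬ ∃ σ : L ≃ₐ[E] L, i.1 = V₁.comap (σ : L →+* L)) → i.1.valuation t < 1 := by
    intro i hi
    have hiE : i.1 ∈ Ext E L O := (hS _).1 i.2
    rw [← map_one i.1.valuation, ← Ext.cv_lt_iff hiE, map_one]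
    refine Valuation.map_sum_lt _ one_ne_zero fun j _ => ?_
    split_ifs with hj
    · exact (hε j).2 i (by rintro rfl; exact hi hj)
    · simp
  have t1 : ∀ i : S, (∃ σ : L ≃ₐ[E] L, i.1 = V₁.comap (σ : L →+* L)) → i.1.valuation t = 1 := by
    intro i hi
    have hiE : i.1 ∈ Ext E L O := (hS _).1 i.2
    have : Ext.cv hiE t = 1 := by
      apply val_eq_one_of_sub
      rw [ht, ← Finset.add_sum_erase _ _ (Finset.mem_univ i), if_pos hi, add_sub_right_comm]
      refine Valuation.map_add_lt _ (hε i).1 (Valuation.map_sum_lt _ one_ne_zero fun j hj => ?_)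
      split_ifs with hj'
      · exact (hε j).2 i (Finset.ne_of_mem_erase hj).symm
      · simp
    rw [← map_one (Ext.cv hiE)] at this
    rw [← map_one i.1.valuation]
    exact le_antisymm ((Ext.cv_le_iff hiE _ _).1 this.le) ((Ext.cv_le_iff hiE _ _).1 this.ge)
  have cm : ∀ (W : ValuationSubring L) (σ : L ≃ₐ[E] L) (a : L),
      (W.comap (σ : L →+* L)).valuation a ≤ 1 ↔ W.valuation (σ a) ≤ 1 := by
    intro W σ a
    have := comap_equiv_val_le (σ : L ≃+* L) W a 1
    rw [map_one, map_one, map_one] at this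
    exact this
  have cm' : ∀ (W : ValuationSubring L) (σ : L ≃ₐ[E] L) (a : L),
      1 ≤ (W.comap (σ : L →+* L)).valuation a ↔ 1 ≤ W.valuation (σ a) := by
    intro W σ a
    have := comap_equiv_val_le (σ : L ≃+* L) W 1 a
    rw [map_one, map_one, map_one] at this
    exact this
  have int : IsIntegral E t := IsIntegral.of_finite E t
  have hsp : ((minpoly E t).map (algebraMap E L)).Splits := Normal.splits inferInstance t
  have hroot : ∀ r ∈ ((minpoly E t).map (algebraMap E L)).roots, ∃ σ : L ≃ₐ[E] L, r = σ t := by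
    intro r hr
    have : IsConjRoot E t r := by
      rw [isConjRoot_iff_aeval_eq_zero int]
      rw [Polynomial.mem_roots (Polynomial.map_ne_zero (minpoly.ne_zero int)),
        Polynomial.IsRoot.def, Polynomial.eval_map_algebraMap] at hr
      exact hr
    obtain ⟨σ, hσ⟩ := (isConjRoot_iff_exists_algEquiv).1 this
    exact ⟨σ.symm, by rw [← hσ]; simp⟩
  have hcoeff := hsp.coeff_zero_eq_prod_roots_of_monic ((minpoly.monic int).map _)
  rw [Polynomial.coeff_map] at hcoeff
  have v1 : V₁.valuation (algebraMap E L ((minpoly E t).coeff 0)) = 1 := by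
    rw [hcoeff, map_mul, map_pow, Valuation.map_neg, map_one, one_pow, one_mul, map_multiset_prod]
    refine Multiset.prod_eq_one fun x hx => ?_
    obtain ⟨r, hr, rfl⟩ := Multiset.mem_map.1 hx
    obtain ⟨σ, rfl⟩ := hroot r hr
    have := t1 ⟨_, hmem V₁ h1 σ⟩ ⟨σ, rfl⟩
    exact le_antisymm ((cm _ _ _).1 this.le) ((cm' _ _ _).1 this.ge)
  have v2 : V₂.valuation (algebraMap E L ((minpoly E t).coeff 0)) < 1 := by
    rw [hcoeff, map_mul, map_pow, Valuation.map_neg, map_one, one_pow, one_mul, map_multiset_prod]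
    have hlt : ∀ r ∈ ((minpoly E t).map (algebraMap E L)).roots, V₂.valuation r < 1 := by
      intro r hr
      obtain ⟨σ, rfl⟩ := hroot r hr
      have : ¬ ∃ τ : L ≃ₐ[E] L, V₂.comap (σ : L →+* L) = V₁.comap (τ : L →+* L) := by
        rintro ⟨τ, hτ⟩
        apply hcon (σ.symm.trans τ)
        ext x
        have : σ.symm x ∈ V₂.comap (σ : L →+* L) ↔ σ.symm x ∈ V₁.comap (τ : L →+* L) := by
          rw [hτ]
        simpa [ValuationSubring.mem_comap] using this
      have := t2 ⟨_, hmem V₂ h2 σ⟩ this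
      rw [← not_le] at this ⊢
      rwa [cm'] at this
    have hne : ((minpoly E t).map (algebraMap E L)).roots ≠ 0 := by
      intro h0
      have := hsp.natDegree_eq_card_roots
      rw [h0, Polynomial.natDegree_map] at this
      exact (minpoly.natDegree_pos int).ne' (by simpa using this)
    obtain ⟨r, hr⟩ := Multiset.exists_mem_of_ne_zero hne
    obtain ⟨m, hm⟩ := Multiset.exists_cons_of_mem hr
    rw [hm] at hlt ⊢
    rw [Multiset.map_cons, Multiset.prod_cons]
    refine lt_of_le_of_lt (mul_le_of_le_one_right' ?_) (hlt r (by simp))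
    refine multiset_prod_le_one fun x hx => ?_
    obtain ⟨r', hr', rfl⟩ := Multiset.mem_map.1 hx
    exact (hlt r' (Multiset.mem_cons_of_mem hr')).le
  have := (Ext.eq_iff h1 ((minpoly E t).coeff 0) 1).1 (by simpa using v1)
  have := (Ext.eq_iff h2 ((minpoly E t).coeff 0) 1).2 this
  rw [this] at v2
  simp at v2

/-! ### coarsening -/

section coarse

variable {F L : Type*} [Field F] [Field L] [Algebra F L]

def coarse (O : ValuationSubring F) (W : ValuationSubring L) : ValuationSubring L :=
  ValuationSubring.ofSubring
    { carrier := {b | ∃ f ∈ O, f ≠ 0 ∧ W.valuation b ≤ W.valuation (algebraMap F L f)}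
      mul_mem' := by
        rintro a b ⟨f, hf, hf0, ha⟩ ⟨g, hg, hg0, hb⟩
        refine ⟨f * g, O.mul_mem _ _ hf hg, mul_ne_zero hf0 hg0, ?_⟩
        rw [map_mul, map_mul, map_mul]
        exact mul_le_mul' ha hb
      one_mem' := ⟨1, O.one_mem, one_ne_zero, by simp⟩
      add_mem' := by
        rintro a b ⟨f, hf, hf0, ha⟩ ⟨g, hg, hg0, hb⟩
        rcases le_total (W.valuation (algebraMap F L f)) (W.valuation (algebraMap F L g)) with h | h
        · exact ⟨g, hg, hg0, (W.valuation.map_add _ _).trans (max_le (ha.trans h) hb)⟩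
        · exact ⟨f, hf, hf0, (W.valuation.map_add _ _).trans (max_le ha (hb.trans h))⟩
      zero_mem' := ⟨1, O.one_mem, one_ne_zero, by simp⟩
      neg_mem' := by
        rintro a ⟨f, hf, hf0, ha⟩
        exact ⟨f, hf, hf0, by rwa [Valuation.map_neg]⟩ }
    (fun x => by
      rcases W.mem_or_inv_mem x with h | h
      · exact Or.inl ⟨1, O.one_mem, one_ne_zero, by simpa using (W.valuation_le_one_iff _).2 h⟩
      · exact Or.inr ⟨1, O.one_mem, one_ne_zero, by
          simpa only [map_one] using (W.valuation_le_one_iff _).2 h⟩)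

theorem mem_coarse {O : ValuationSubring F} {W : ValuationSubring L} {b : L} :
    b ∈ coarse O W ↔ ∃ f ∈ O, f ≠ 0 ∧ W.valuation b ≤ W.valuation (algebraMap F L f) := Iff.rfl

theorem le_coarse (O : ValuationSubring F) (W : ValuationSubring L) : W ≤ coarse O W := by
  intro b hb
  exact ⟨1, O.one_mem, one_ne_zero, by simpa using (W.valuation_le_one_iff _).2 hb⟩

theorem coarse_mem {O O' : ValuationSubring F} (h : O' ≤ O) {W : ValuationSubring L}
    (hW : W ∈ Ext F L O') : coarse O W ∈ Ext F L O := by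
  show (coarse O W).comap (algebraMap F L) = O
  ext a
  rw [ValuationSubring.mem_comap, mem_coarse]
  constructor
  · rintro ⟨f, hf, hf0, hle⟩
    rw [Ext.le_iff hW, val_le_iff _ hf0] at hle
    have := O.mul_mem _ _ (h hle) hf
    rwa [div_mul_cancel₀ _ hf0] at this
  · intro ha
    by_cases h0 : a = 0
    · exact ⟨1, O.one_mem, one_ne_zero, by simp [h0]⟩
    · exact ⟨a, ha, h0, le_rfl⟩

theorem Good.coarse [FiniteDimensional F L] {O O' : ValuationSubring F} (h : O' ≤ O)
    (hg : Good L O') : Good L O := by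
  classical
  set S' := (ext_finite F L O').toFinset with hS'
  refine Good.of_finset (s := S'.image (fun W => GST.coarse O W)) ?_ ?_
  · intro W hW
    obtain ⟨W', hW', rfl⟩ := Finset.mem_image.1 hW
    exact coarse_mem h (by simpa [hS'] using hW')
  rw [← show dg L O' = Module.finrank F L from hg, dg_eq,
    ← Finset.sum_fiberwise_of_maps_to (t := S'.image (fun W => GST.coarse O W))
      (g := fun W => GST.coarse O W) (fun W hW => Finset.mem_image_of_mem _ hW)]
  refine Finset.sum_le_sum fun W hW => ?_
  set s := S'.filter (fun W' => GST.coarse O W' = W) with hs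
  have hs' : ∀ W' ∈ s, W' ∈ Ext F L O' := fun W' hW' => by
    simpa [hS'] using (Finset.mem_filter.1 hW').1
  have hsW : ∀ W' ∈ s, GST.coarse O W' = W := fun W' hW' => (Finset.mem_filter.1 hW').2
  have hWE : W ∈ Ext F L O := by
    obtain ⟨W', hW', rfl⟩ := Finset.mem_image.1 hW
    exact coarse_mem h (by simpa [hS'] using hW')
  choose Z hZ hZs using fun W : s => rk_spec (E := F) W.1
  rcases s.eq_empty_or_nonempty with h0 | hne
  · rw [h0]; simp
  have : Nonempty s := hne.to_subtype
  obtain ⟨Z', hZ', _⟩ := (Ext.fam hs').joint Z (fun W => (orth_cv _ _).2 (hZ W))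
  have hπ : ∀ (i : s) (b : L),
      ValuationSubring.mapOfLE O' O h (Ext.cv (hs' i.1 i.2) b) = Ext.cv hWE b := by
    intro i b
    by_cases hb : b = 0
    · simp [hb]
    obtain ⟨c, hc, hbc⟩ := Ext.tor (E := F) (W := i.1) b hb
    have hle : i.1 ≤ W := by rw [← hsW i.1 i.2]; exact le_coarse O i.1
    have hbc' := congrArg (ValuationSubring.mapOfLE i.1 W hle) hbc
    rw [map_pow, ValuationSubring.mapOfLE_valuation_apply,
      ValuationSubring.mapOfLE_valuation_apply] at hbc'
    rw [Ext.cv_eq _ hbc, Ext.cv_eq _ hbc', ValuationSubring.mapOfLE_valuation_apply]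
  have ho : Orth F W.valuation Z' := by
    rw [← orth_cv hWE]
    refine ⟨hZ'.1, fun c j => ?_⟩
    have h1 := hZ'.2 c j
    dsimp only at h1
    obtain ⟨l, _, hl⟩ := Finset.exists_mem_eq_sup Finset.univ Finset.univ_nonempty
      (fun i : s => Ext.cv (hs' i.1 i.2) (∑ i, c i • Z' i))
    rw [hl] at h1
    have h2 := (Finset.le_sup (f := fun i : s => Ext.cv (hs' i.1 i.2) (c j • Z' j))
      (Finset.mem_univ l)).trans h1
    have h3 := ValuationSubring.monotone_mapOfLE O' O h h2
    rwa [hπ, hπ] at h3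
  have := le_rk ho
  rw [Fintype.card_sigma] at this
  simp only [Fintype.card_fin] at this
  rwa [Finset.sum_coe_sort s (fun W => rk F W)] at this

end coarse

theorem Stable.coarse {F : Type u} [Field F] {O O' : ValuationSubring F} (h : O' ≤ O)
    (hs : Stable F O') : Stable F O := fun L _ _ _ => Good.coarse h (hs L)

end GST


set_option linter.unusedSectionVars false

namespace GST

open LocalUnif

universe u

theorem inMax_iff {L : Type*} [Field L] (W : ValuationSubring L) (x : L) :
    InMax W x ↔ W.valuation x < 1 := by
  unfold InMax
  by_cases hx : x = 0
  · simp [hx]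
  · rw [← W.valuation_le_one_iff, map_inv₀, or_iff_right hx, not_le,
      one_lt_inv₀ (zero_lt_iff.2 ((Valuation.ne_zero_iff _).2 hx))]

theorem isVUnit_iff {L : Type*} [Field L] (W : ValuationSubring L) (x : L) :
    IsVUnit W x ↔ W.valuation x = 1 := by
  unfold IsVUnit
  by_cases hx : x = 0
  · simp [hx]
  · rw [← W.valuation_le_one_iff, ← W.valuation_le_one_iff, map_inv₀,
      inv_le_one₀ (zero_lt_iff.2 ((Valuation.ne_zero_iff _).2 hx)), le_antisymm_iff]
    simp [hx]

theorem le_sum_of_distinct {L Γ ι : Type*} [Field L] [Fintype ι] [LinearOrderedCommGroupWithZero Γ]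
    (w : Valuation L Γ) (f : ι → L) (h : ∀ i j, i ≠ j → f i ≠ 0 → w (f i) ≠ w (f j)) (i : ι) :
    w (f i) ≤ w (∑ j, f j) := by
  classical
  obtain ⟨m, _, hm⟩ := Finset.exists_max_image Finset.univ (fun i => w (f i)) ⟨i, Finset.mem_univ i⟩
  refine (hm i (Finset.mem_univ _)).trans ?_
  by_cases h0 : w (f m) = 0
  · rw [h0]; exact zero_le
  rw [← Finset.add_sum_erase _ _ (Finset.mem_univ m), Valuation.map_add_eq_of_lt_left]
  refine Valuation.map_sum_lt _ h0 fun j hj => lt_of_le_of_ne (hm j (Finset.mem_univ _)) ?_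
  exact (h m j (Finset.ne_of_mem_erase hj).symm ((Valuation.ne_zero_iff _).1 h0)).symm

section EF

variable {E L : Type*} [Field E] [Field L] [Algebra E L] {O : ValuationSubring E}
  {W : ValuationSubring L}

theorem Ext.lt_iff (hW : W ∈ Ext E L O) (a b : E) :
    W.valuation (algebraMap E L a) < W.valuation (algebraMap E L b) ↔
      O.valuation a < O.valuation b := by
  rw [← not_le, ← not_le, Ext.le_iff hW]

theorem resLin_le (hW : W ∈ Ext E L O) {f : ℕ} {b : Fin f → L}
    (hb : ResLinIndep (algebraMap E L) O W b) (c : Fin f → E) (k : Fin f) :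
    W.valuation (algebraMap E L (c k)) ≤ W.valuation (∑ i, algebraMap E L (c i) * b i) := by
  obtain ⟨m, _, hm⟩ := Finset.exists_max_image Finset.univ (fun i => O.valuation (c i))
    ⟨k, Finset.mem_univ k⟩
  refine ((Ext.le_iff hW _ _).2 (hm k (Finset.mem_univ _))).trans ?_
  by_cases h0 : c m = 0
  · simp [h0]
  have := hb.2 (fun i => c i / c m)
    (fun i => (val_le_iff _ h0).1 (hm i (Finset.mem_univ _)))
    ⟨m, by rw [inMax_iff, div_self h0]; simp⟩
  rw [inMax_iff, not_lt] at this
  have e : ∑ i, algebraMap E L (c i) * b i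
      = algebraMap E L (c m) * ∑ i, algebraMap E L (c i / c m) * b i := by
    rw [Finset.mul_sum]
    refine Finset.sum_congr rfl fun i _ => ?_
    rw [← mul_assoc, ← map_mul, mul_div_cancel₀ _ h0]
  rw [e, map_mul]
  exact le_mul_of_one_le_right' this

theorem resLin_val (hW : W ∈ Ext E L O) {f : ℕ} {b : Fin f → L}
    (hb : ResLinIndep (algebraMap E L) O W b) (k : Fin f) : W.valuation (b k) = 1 := by
  classical
  refine le_antisymm ((W.valuation_le_one_iff _).2 (hb.1 k)) ?_
  have := resLin_le hW hb (fun i => if i = k then 1 else 0) k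
  simpa using this

theorem EF_orth (hW : W ∈ Ext E L O) {e f : ℕ} {a : Fin e → L} {b : Fin f → L}
    (ha : ValClassIndep (algebraMap E L) W a) (hb : ResLinIndep (algebraMap E L) O W b) :
    Orth E W.valuation (fun p : Fin e × Fin f => a p.1 * b p.2) := by
  have hb1 := resLin_val hW hb
  have hb0 : ∀ k, b k ≠ 0 := fun k h0 => by have := hb1 k; simp [h0] at this
  refine ⟨fun p => mul_ne_zero (ha.1 _) (hb0 _), fun c p => ?_⟩
  have e1 : ∑ p : Fin e × Fin f, c p • (a p.1 * b p.2)
      = ∑ j, a j * ∑ k, algebraMap E L (c (j, k)) * b k := by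
    rw [Fintype.sum_prod_type]
    refine Finset.sum_congr rfl fun j _ => ?_
    rw [Finset.mul_sum]
    refine Finset.sum_congr rfl fun k _ => ?_
    rw [Algebra.smul_def]; ring
  -- value of an inner sum
  have inner : ∀ c : Fin f → E, (∑ k, algebraMap E L (c k) * b k) ≠ 0 →
      ∃ d : E, d ≠ 0 ∧ W.valuation (∑ k, algebraMap E L (c k) * b k)
        = W.valuation (algebraMap E L d) := by
    intro c hc
    have hne : Nonempty (Fin f) := by
      by_contra h
      rw [not_nonempty_iff] at h
      exact hc (by simp)
    obtain ⟨m, _, hm⟩ := Finset.exists_max_image Finset.univ (fun i => O.valuation (c i))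
      ⟨Classical.arbitrary _, Finset.mem_univ _⟩
    have heq : W.valuation (∑ k, algebraMap E L (c k) * b k)
        = W.valuation (algebraMap E L (c m)) := by
      refine le_antisymm (Valuation.map_sum_le _ fun i _ => ?_) (resLin_le hW hb c m)
      rw [map_mul, hb1, mul_one, Ext.le_iff hW]
      exact hm i (Finset.mem_univ _)
    refine ⟨c m, fun h0 => ?_, heq⟩
    rw [h0, map_zero, map_zero, Valuation.zero_iff] at heq
    exact hc heq
  rw [e1]
  refine le_trans ?_ (le_sum_of_distinct W.valuation _ ?_ p.1)
  · have := resLin_le hW hb (fun k => c (p.1, k)) p.2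
    rw [Algebra.smul_def, map_mul, map_mul, map_mul, hb1, mul_one, mul_comm]
    exact mul_le_mul_right this _
  · intro i j hij hne heq
    have hi := right_ne_zero_of_mul hne
    have hj : ∑ k, algebraMap E L (c (j, k)) * b k ≠ 0 := by
      intro h0
      rw [h0, mul_zero, map_zero, Valuation.zero_iff] at heq
      exact hne heq
    obtain ⟨d1, h1, hd1⟩ := inner (fun k => c (i, k)) hi
    obtain ⟨d2, h2, hd2⟩ := inner (fun k => c (j, k)) hj
    refine ha.2 i j hij ⟨d2 / d1, div_ne_zero h2 h1, ?_⟩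
    rw [isVUnit_iff]
    rw [map_mul, map_mul, hd1, hd2, ← map_mul, ← map_mul] at heq
    have hA : a j * algebraMap E L d2 ≠ 0 := mul_ne_zero (ha.1 j) (by simpa using h2)
    have hd1' : algebraMap E L d1 ≠ 0 := by simpa using h1
    have : a i / (a j * algebraMap E L (d2 / d1)) = (a i * algebraMap E L d1) / (a j * algebraMap E L d2) := by
      rw [map_div₀]; field_simp
    rw [this, map_div₀, heq, div_self ((Valuation.ne_zero_iff _).2 hA)]

theorem resLin_one (hW : W ∈ Ext E L O) :
    ResLinIndep (algebraMap E L) O W (fun _ : Fin 1 => (1 : L)) := by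
  refine ⟨fun _ => W.one_mem, fun c hc ⟨i, hi⟩ => ?_⟩
  rw [inMax_iff] at hi ⊢
  have : i = 0 := Subsingleton.elim _ _
  subst this
  rw [← map_one O.valuation, ← Ext.lt_iff hW] at hi
  simpa using hi

theorem valClass_one :
    ValClassIndep (algebraMap E L) W (fun _ : Fin 1 => (1 : L)) :=
  ⟨fun _ => one_ne_zero, fun i j hij => (hij (Subsingleton.elim _ _)).elim⟩

theorem exists_max_nat (P : ℕ → Prop) (h0 : P 0) (B : ℕ) (hB : ∀ k, P k → k ≤ B) :
    ∃ k, P k ∧ ¬ P (k + 1) := by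
  by_contra hcon
  push Not at hcon
  have : ∀ k, P k := fun k => Nat.rec h0 (fun k ih => hcon k ih) k
  have := hB (B + 1) (this _)
  omega

theorem exists_ramIdx [FiniteDimensional E L] (hW : W ∈ Ext E L O) :
    ∃ e, RamIdxEq (algebraMap E L) W e := by
  obtain ⟨k, h1, h2⟩ := exists_max_nat
    (fun k => ∃ a : Fin k → L, ValClassIndep (algebraMap E L) W a)
    ⟨Fin.elim0, fun i => i.elim0, fun i => i.elim0⟩ (Module.finrank E L) (by
      rintro k ⟨a, ha⟩
      have := orth_card_le_finrank (EF_orth hW ha (resLin_one hW))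
      simpa using this)
  push Not at h2
  exact ⟨k, h1, h2⟩

theorem exists_inertia [FiniteDimensional E L] (hW : W ∈ Ext E L O) :
    ∃ f, InertiaDegEq (algebraMap E L) O W f := by
  obtain ⟨k, h1, h2⟩ := exists_max_nat
    (fun k => ∃ b : Fin k → L, ResLinIndep (algebraMap E L) O W b)
    ⟨Fin.elim0, fun i => i.elim0, fun c hc ⟨i, _⟩ => i.elim0⟩ (Module.finrank E L) (by
      rintro k ⟨b, hb⟩
      have := orth_card_le_finrank (EF_orth hW valClass_one hb)
      simpa using this)
  push Not at h2
  exact ⟨k, h1, h2⟩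

theorem EF_rk [FiniteDimensional E L] (hW : W ∈ Ext E L O) {e f : ℕ}
    (he : RamIdxEq (algebraMap E L) W e) (hf : InertiaDegEq (algebraMap E L) O W f) :
    rk E W = e * f := by
  obtain ⟨⟨a, ha⟩, hamax⟩ := he
  obtain ⟨⟨b, hb⟩, hbmax⟩ := hf
  rw [rk_eq (EF_orth hW ha hb)]
  · simp
  intro d hd
  -- the value of d
  have h1 : ∃ j, ∃ c : E, c ≠ 0 ∧ W.valuation d = W.valuation (a j * algebraMap E L c) := by
    by_contra hcon
    push Not at hcon
    refine hamax (Fin.cons d a) ⟨fun i => ?_, fun i j hij => ?_⟩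
    · refine Fin.cases hd (fun i => ha.1 i) i
    · rintro ⟨c, hc, hu⟩
      rw [isVUnit_iff, map_div₀] at hu
      revert hij hu
      refine Fin.cases ?_ (fun i => ?_) i <;> refine Fin.cases ?_ (fun j => ?_) j
      · intro h; exact (h rfl).elim
      · intro _ hu
        simp only [Fin.cons_zero, Fin.cons_succ] at hu
        exact hcon j c hc (eq_of_div_eq_one hu)
      · intro _ hu
        simp only [Fin.cons_zero, Fin.cons_succ] at hu
        refine hcon i c⁻¹ (inv_ne_zero hc) ?_
        have hu := eq_of_div_eq_one hu
        rw [map_mul, hu, map_mul, map_inv₀, map_inv₀, mul_assoc, mul_inv_cancel₀, mul_one]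
        exact (Valuation.ne_zero_iff _).2 (by simpa using hc)
      · intro hij hu
        simp only [Fin.cons_succ] at hu
        rw [← map_div₀] at hu
        exact ha.2 i j (fun h => hij (by rw [h])) ⟨c, hc, (isVUnit_iff _ _).2 hu⟩
  obtain ⟨j, c, hc, hval⟩ := h1
  have hg0 : a j * algebraMap E L c ≠ 0 := mul_ne_zero (ha.1 j) (by simpa using hc)
  set g := a j * algebraMap E L c with hg
  set x := d / g with hx
  have hx1 : W.valuation x = 1 := by
    rw [hx, map_div₀, hval, div_self ((Valuation.ne_zero_iff _).2 hg0)]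
  have h2 : ∃ r : Fin f → E, W.valuation (x - ∑ k, algebraMap E L (r k) * b k) < 1 := by
    by_contra hcon
    push Not at hcon
    refine hbmax (Fin.cons x b) ⟨fun i => ?_, fun r hr ⟨i, hi⟩ => ?_⟩
    · exact Fin.cases ((W.valuation_le_one_iff _).1 hx1.le) (fun i => hb.1 i) i
    rw [Fin.sum_univ_succ]
    simp only [Fin.cons_zero, Fin.cons_succ]
    by_cases h0 : InMax O (r 0)
    · have := hb.2 (fun k => r k.succ) (fun k => hr _) (by
        revert hi
        refine Fin.cases (fun h => (h h0).elim) (fun i hi => ⟨i, hi⟩) i)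
      rw [inMax_iff] at this ⊢
      rw [inMax_iff, ← map_one O.valuation, ← Ext.lt_iff hW, map_one, map_one] at h0
      intro hlt
      refine this ?_
      have h3 := Valuation.map_sub_lt W.valuation hlt
        (y := algebraMap E L (r 0) * x) (by rwa [map_mul, hx1, mul_one])
      rwa [add_sub_cancel_left] at h3
    · have hr0 : r 0 ≠ 0 := fun h => h0 (Or.inl h)
      have h3 := hcon (fun k => - (r k.succ / r 0))
      rw [inMax_iff] at h0 ⊢
      rw [not_lt] at h0 ⊢
      have hr1 : 1 ≤ W.valuation (algebraMap E L (r 0)) := by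
        rw [← map_one O.valuation, ← Ext.le_iff hW] at h0
        simpa using h0
      have e2 : algebraMap E L (r 0) * x + ∑ i : Fin f, algebraMap E L (r i.succ) * b i
          = algebraMap E L (r 0) * (x - ∑ k, algebraMap E L (- (r k.succ / r 0)) * b k) := by
        rw [mul_sub, Finset.mul_sum, sub_eq_add_neg, ← Finset.sum_neg_distrib]
        congr 1
        refine Finset.sum_congr rfl fun k _ => ?_
        rw [← mul_assoc, ← map_mul, ← neg_mul, ← map_neg]
        congr 2
        field_simp
      rw [e2, map_mul]
      exact one_le_mul hr1 h3
  obtain ⟨r, hr⟩ := h2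
  classical
  refine ⟨fun p => if p.1 = j then c * r p.2 else 0, ?_⟩
  have e3 : ∑ p : Fin e × Fin f, (if p.1 = j then c * r p.2 else 0) • (a p.1 * b p.2)
      = g * ∑ k, algebraMap E L (r k) * b k := by
    rw [Fintype.sum_prod_type, Finset.sum_eq_single j]
    · rw [Finset.mul_sum]
      refine Finset.sum_congr rfl fun k _ => ?_
      rw [if_pos rfl, Algebra.smul_def, map_mul, hg]; ring
    · intro i _ hi
      simp [hi]
    · simp
  have e4 : d = g * x := by rw [hx, mul_div_cancel₀ _ hg0]
  rw [e3]
  conv_lhs => rw [e4]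
  rw [← mul_sub, map_mul, hval]
  exact mul_lt_of_lt_one_right (zero_lt_iff.2 ((Valuation.ne_zero_iff _).2 hg0)) hr

end EF

theorem Stable.isDefectless {E : Type u} [Field E] {O : ValuationSubring E} (h : Stable E O) :
    IsDefectless E O := by
  intro L hL
  have hg : dg L O = Module.finrank E L := h L
  obtain ⟨S, hS⟩ : ∃ S : Finset (ValuationSubring L), ∀ W, W ∈ S ↔ W ∈ Ext E L O :=
    ⟨(ext_finite E L O).toFinset, fun W => by simp⟩
  have hmem : ∀ i : Fin S.card, (S.equivFin.symm i).1 ∈ Ext E L O :=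
    fun i => (hS _).1 (S.equivFin.symm i).2
  choose e he using fun i => exists_ramIdx (hmem i)
  choose f hf using fun i => exists_inertia (hmem i)
  refine ⟨S.card, fun i => (S.equivFin.symm i).1, e, f, ?_, ?_, he, hf, ?_⟩
  · exact Subtype.val_injective.comp S.equivFin.symm.injective
  · intro O'
    rw [show (O'.comap (algebraMap E L) = O) ↔ O' ∈ S from (hS O').symm]
    constructor
    · intro h'
      exact ⟨S.equivFin ⟨O', h'⟩, by simp⟩
    · rintro ⟨i, rfl⟩
      exact (S.equivFin.symm i).2
  · have : S = (ext_finite E L O).toFinset := by ext W; simp [hS]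
    rw [← hg, dg_eq, ← this, ← Finset.sum_coe_sort, ← S.equivFin.symm.sum_comp]
    exact Finset.sum_congr rfl fun i _ => EF_rk (hmem i) (he i) (hf i)

theorem Stable.of_isDefectless {E : Type u} [Field E] {O : ValuationSubring E}
    (h : IsDefectless E O) : Stable E O := by
  classical
  intro L _ _ _
  let φ : L →ₐ[E] AlgebraicClosure E := IsAlgClosed.lift
  let ψ : L ≃ₐ[E] φ.fieldRange := AlgEquiv.ofInjectiveField φ
  have hfd : FiniteDimensional E φ.fieldRange := ψ.toLinearEquiv.finiteDimensional
  obtain ⟨g, Os, e, f, hinj, hOs, he, hf, hsum⟩ := h φ.fieldRange hfd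
  have hmem : ∀ i, Os i ∈ Ext E φ.fieldRange O := fun i => (hOs _).2 ⟨i, rfl⟩
  have hG : Good φ.fieldRange O := by
    refine Good.of_finset (s := Finset.univ.image Os) ?_ ?_
    · intro W hW
      obtain ⟨i, _, rfl⟩ := Finset.mem_image.1 hW
      exact hmem i
    · rw [Finset.sum_image (fun _ _ _ _ hh => hinj hh), hsum]
      exact Finset.sum_le_sum fun i _ => (EF_rk (hmem i) (he i) (hf i)).ge
  have := Good.equiv (RingEquiv.refl E) (ψ : L ≃+* φ.fieldRange) (fun x => by simp) hG
  have h2 : O = O.comap ((RingEquiv.refl E : E ≃+* E) : E →+* E) := by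
    ext x; rfl
  rw [h2]; exact this

end GST


set_option linter.unusedSectionVars false

namespace GST

universe u

section imm

variable {K Ω Γ : Type*} [Field K] [Field Ω] [Algebra K Ω] [LinearOrderedCommGroupWithZero Γ]

/-- approximable by an element of `K` -/
def Appr (K : Type*) {Ω Γ : Type*} [Field K] [Field Ω] [Algebra K Ω]
    [LinearOrderedCommGroupWithZero Γ] (v : Valuation Ω Γ) (y : Ω) : Prop :=
  ∃ d : K, v (y - algebraMap K Ω d) < v y

variable {v : Valuation Ω Γ}

theorem Appr.ne_zero {y : Ω} (h : Appr K v y) : y ≠ 0 := by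
  rintro rfl
  obtain ⟨d, hd⟩ := h
  simp at hd

theorem Appr.val {y : Ω} (h : Appr K v y) : ∃ d : K, d ≠ 0 ∧ v (algebraMap K Ω d) = v y ∧
    v (y - algebraMap K Ω d) < v y := by
  obtain ⟨d, hd⟩ := h
  have := (ENorm.self (E := K) v).eq_of_sub_lt hd
  refine ⟨d, ?_, this, hd⟩
  rintro rfl
  simp at hd

theorem Appr.mul {y z : Ω} (hy : Appr K v y) (hz : Appr K v z) : Appr K v (y * z) := by
  have h1 := zero_lt_iff.2 (v.ne_zero_iff.2 hy.ne_zero)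
  have h2 := zero_lt_iff.2 (v.ne_zero_iff.2 hz.ne_zero)
  obtain ⟨d, hd0, hd, hyd⟩ := hy.val
  obtain ⟨e, he0, he, hze⟩ := hz.val
  refine ⟨d * e, ?_⟩
  have : y * z - algebraMap K Ω (d * e) =
      (y - algebraMap K Ω d) * z + algebraMap K Ω d * (z - algebraMap K Ω e) := by
    rw [map_mul]; ring
  rw [this, map_mul]
  refine v.map_add_lt ?_ ?_
  · rw [map_mul]; exact mul_lt_mul_of_pos_right hyd h2
  · rw [map_mul, hd]; exact mul_lt_mul_of_pos_left hze h1

theorem Appr.inv {y : Ω} (hy : Appr K v y) : Appr K v y⁻¹ := by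
  have h1 := v.ne_zero_iff.2 hy.ne_zero
  have h0 := hy.ne_zero
  obtain ⟨d, hd0, hd, hyd⟩ := hy.val
  refine ⟨d⁻¹, ?_⟩
  have hd0' : algebraMap K Ω d ≠ 0 := by simpa using hd0
  have : y⁻¹ - algebraMap K Ω d⁻¹ = (algebraMap K Ω d - y) * (y⁻¹ * (algebraMap K Ω d)⁻¹) := by
    rw [map_inv₀]; field_simp
  rw [this, map_mul, map_mul, v.map_sub_swap, map_inv₀, map_inv₀, hd]
  calc _ < v y * ((v y)⁻¹ * (v y)⁻¹) := mul_lt_mul_of_pos_right hyd (zero_lt_iff.2 (by simp [h0]))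
    _ = _ := by field_simp

theorem Appr.const {d : K} (hd : d ≠ 0) : Appr K v (algebraMap K Ω d) :=
  ⟨d, by simpa using zero_lt_iff.2 (v.ne_zero_iff.2 (by simpa using hd))⟩

/-- approximable by something approximable -/
theorem Appr.of_sub {y z : Ω} (hz : Appr K v z) (h : v (y - z) < v z) : Appr K v y := by
  have e := (ENorm.self (E := K) v).eq_of_sub_lt' h
  obtain ⟨d, hd⟩ := hz
  refine ⟨d, ?_⟩
  rw [← sub_add_sub_cancel y z, e]
  exact v.map_add_lt h hd

def Imm (v : Valuation Ω Γ) (K' : IntermediateField K Ω) : Prop :=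
  ∀ y ∈ K', y ≠ 0 → Appr K v y

theorem appr_of_alg [IsAlgClosed K] {K' : IntermediateField K Ω} (h : Imm v K') {y : Ω}
    (hy : IsAlgebraic K' y) (hy0 : y ≠ 0) : Appr K v y := by
  obtain ⟨k, hk, -, c, hc0, hc⟩ := exists_tor v hy0 hy.isIntegral
  obtain ⟨d, hd0, hd, -⟩ := (h c.1 c.2 (by simpa using hc0)).val
  obtain ⟨e, he⟩ := IsAlgClosed.exists_pow_nat_eq d (Nat.pos_of_ne_zero hk)
  have he0 : e ≠ 0 := by rintro rfl; rw [zero_pow hk] at he; exact hd0 he.symm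
  have he0' : algebraMap K Ω e ≠ 0 := by simpa using he0
  have hye : v y = v (algebraMap K Ω e) := by
    refine (pow_left_inj₀ zero_le zero_le hk).1 ?_
    rw [hc, ← map_pow, ← map_pow, he, hd]; rfl
  -- the unit
  set u := y / algebraMap K Ω e with hu
  have hu1 : v u = 1 := by rw [hu, map_div₀, hye, div_self (v.ne_zero_iff.2 he0')]
  suffices hs : Appr K v u by
    have := hs.mul (Appr.const (v := v) he0)
    rwa [hu, div_mul_cancel₀ _ he0'] at this
  have hualg : IsAlgebraic K' u := by
    have h2 : IsAlgebraic K' (algebraMap K Ω e) :=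
      isAlgebraic_algebraMap (A := Ω) (⟨_, K'.algebraMap_mem e⟩ : K')
    rw [hu, div_eq_mul_inv]
    exact hy.mul h2.inv
  obtain ⟨p, hp0, hp⟩ := hualg
  -- maximal coefficient
  obtain ⟨m, hm, hmax⟩ := Finset.exists_max_image p.support (fun j => v (p.coeff j))
    (Polynomial.nonempty_support_iff.2 hp0)
  have hm0 : p.coeff m ≠ 0 := Polynomial.mem_support_iff.1 hm
  have hmv : v (p.coeff m : Ω) ≠ 0 := v.ne_zero_iff.2 (by simpa using hm0)
  have hmax' : ∀ j, v (p.coeff j : Ω) ≤ v (p.coeff m : Ω) := fun j => by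
    by_cases hj : j ∈ p.support
    · exact hmax j hj
    · rw [Polynomial.notMem_support_iff.1 hj]; simp
  have hex : ∀ j, ∃ d : K, v ((p.coeff j : Ω) / p.coeff m - algebraMap K Ω d) < 1 ∧
      (d ≠ 0 → v (algebraMap K Ω d) = 1) ∧ (j = m → d ≠ 0) := by
    intro j
    by_cases hj : v (p.coeff j : Ω) = v (p.coeff m : Ω)
    · have hjm : v ((p.coeff j : Ω) / p.coeff m) = 1 := by rw [map_div₀, hj, div_self hmv]
      have : (p.coeff j : Ω) / p.coeff m ≠ 0 := by
        intro h0; rw [h0] at hjm; simp at hjm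
      obtain ⟨d, hd0, hd, hlt⟩ :=
        (h _ (K'.div_mem (p.coeff j).2 (p.coeff m).2) this).val
      exact ⟨d, hjm ▸ hlt, fun _ => hd.trans hjm, fun _ => hd0⟩
    · refine ⟨0, ?_, fun h => (h rfl).elim, fun h => (hj (h ▸ rfl)).elim⟩
      rw [map_zero, sub_zero, map_div₀, div_lt_one₀ (zero_lt_iff.2 hmv)]
      exact lt_of_le_of_ne (hmax' j) hj
  choose d hd1 hd2 hd3 using hex
  set q : Polynomial K := ∑ j ∈ p.support, Polynomial.monomial j (d j) with hq
  have hqc : ∀ j, q.coeff j = if j ∈ p.support then d j else 0 := fun j => by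
    rw [hq, Polynomial.finsetSum_coeff]
    simp [Polynomial.coeff_monomial]
  have hq0 : q ≠ 0 := fun h0 => by
    have := hqc m
    rw [h0, if_pos hm] at this
    exact hd3 m rfl (by simpa using this.symm)
  have hlead : v (algebraMap K Ω q.leadingCoeff) = 1 := by
    have h1 := hqc q.natDegree
    have h2 : q.coeff q.natDegree ≠ 0 := Polynomial.leadingCoeff_ne_zero.2 hq0
    rw [Polynomial.leadingCoeff]
    split_ifs at h1
    · rw [h1]; exact hd2 _ (h1 ▸ h2)
    · exact (h2 h1).elim
  have hqu : v (Polynomial.aeval u q) < 1 := by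
    have h1 : Polynomial.aeval u q = ∑ j ∈ p.support, algebraMap K Ω (d j) * u ^ j := by
      rw [hq, map_sum]; simp [Polynomial.aeval_monomial]
    have h2 : (0 : Ω) = ∑ j ∈ p.support, (p.coeff j : Ω) / p.coeff m * u ^ j := by
      rw [Polynomial.aeval_eq_sum_range, ] at hp
      have : ∑ j ∈ p.support, (p.coeff j : Ω) * u ^ j = 0 := by
        have h3 := Polynomial.aeval_def u p
        rw [Polynomial.eval₂_eq_sum, Polynomial.sum_def] at h3
        rw [Polynomial.aeval_eq_sum_range, hp] at h3
        exact h3.symm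
      rw [← zero_div (p.coeff m : Ω), ← this, Finset.sum_div]
      exact Finset.sum_congr rfl fun j _ => by ring
    have h3 : Polynomial.aeval u q = ∑ j ∈ p.support,
        -((p.coeff j : Ω) / p.coeff m - algebraMap K Ω (d j)) * u ^ j := by
      rw [h1, ← sub_zero (∑ j ∈ p.support, algebraMap K Ω (d j) * u ^ j), h2,
        ← Finset.sum_sub_distrib]
      exact Finset.sum_congr rfl fun j _ => by ring
    rw [h3]
    refine v.map_sum_lt one_ne_zero fun j _ => ?_
    rw [map_mul, map_pow, hu1, one_pow, mul_one, Valuation.map_neg]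
    exact hd1 j
  have hsp := IsAlgClosed.splits q
  have hfac := hsp.eq_prod_roots
  by_contra hcon
  have hge : ∀ r : K, 1 ≤ v (u - algebraMap K Ω r) := fun r => by
    by_contra hr
    exact hcon ⟨r, by rw [hu1]; exact not_le.1 hr⟩
  refine hqu.not_ge ?_
  rw [hfac, map_mul, map_mul, Polynomial.aeval_C, hlead, one_mul]
  induction q.roots using Multiset.induction_on with
  | empty => simp
  | cons r s ih =>
    rw [Multiset.map_cons, Multiset.prod_cons, map_mul, map_mul]
    refine one_le_mul ?_ ih
    simpa using hge r

theorem exists_max_imm [IsAlgClosed K] [IsAlgClosed Ω] (v : Valuation Ω Γ) :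
    ∃ K' : IntermediateField K Ω, Imm v K' ∧
      ∀ z : Ω, (∀ a ∈ K', Appr K v (z - a)) → z ∈ K' := by
  obtain ⟨K', -, hK'⟩ := zorn_le_nonempty₀ {K' : IntermediateField K Ω | Imm v K'} (by
    intro c hc hchain y hy
    refine ⟨sSup c, ?_, fun z hz => le_sSup hz⟩
    intro x hx hx0
    have : ∃ F ∈ c, x ∈ F := by
      rw [sSup_eq_iSup'] at hx
      have : Nonempty c := ⟨⟨y, hy⟩⟩
      rw [← SetLike.mem_coe, IntermediateField.coe_iSup_of_directed hchain.directedOn.directed_val] at hx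
      obtain ⟨F, hF⟩ := Set.mem_iUnion.1 hx
      exact ⟨F.1, F.2, hF⟩
    obtain ⟨F, hF, hxF⟩ := this
    exact hc hF x hxF hx0) (⊥ : IntermediateField K Ω) (by
    intro y hy hy0
    obtain ⟨d, rfl⟩ := IntermediateField.mem_bot.1 hy
    exact Appr.const (by simpa using hy0))
  have himm : Imm v K' := hK'.prop
  have hmax : ∀ K'' : IntermediateField K Ω, Imm v K'' → K' ≤ K'' → K'' ≤ K' :=
    fun K'' h1 h2 => hK'.le_of_ge h1 h2
  refine ⟨K', himm, fun z hz => ?_⟩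
  have halg : ∀ y : Ω, IsAlgebraic K' y → y ∈ K' := by
    intro y hy
    refine hmax ((algebraicClosure K' Ω).restrictScalars K) ?_ ?_ ?_
    · intro w hw hw0
      exact appr_of_alg himm ((mem_algebraicClosure_iff).1 hw) hw0
    · intro w hw
      exact (mem_algebraicClosure_iff).2 (isAlgebraic_algebraMap (A := Ω) (⟨w, hw⟩ : K'))
    · exact (mem_algebraicClosure_iff).2 hy
  have hpoly : ∀ p : Polynomial K', p ≠ 0 → Appr K v (Polynomial.aeval z p) := by
    intro p hp
    have hsp : (p.map (algebraMap K' Ω)).Splits := IsAlgClosed.splits _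
    have hmem : ∀ r ∈ (p.map (algebraMap K' Ω)).roots, r ∈ K' := fun r hr => by
      refine halg r ⟨p, hp, ?_⟩
      have := (Polynomial.mem_roots'.1 hr).2
      rwa [Polynomial.IsRoot, Polynomial.eval_map_algebraMap] at this
    rw [← Polynomial.eval_map_algebraMap, hsp.eq_prod_roots, Polynomial.eval_mul, Polynomial.eval_C]
    refine Appr.mul ?_ ?_
    · rw [Polynomial.leadingCoeff_map]
      refine himm _ (p.leadingCoeff).2 ?_
      simpa using hp
    · revert hmem
      induction (p.map (algebraMap K' Ω)).roots using Multiset.induction_on with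
      | empty => intro _; simpa using Appr.const (v := v) (Ω := Ω) (one_ne_zero (α := K))
      | cons r s ih =>
        intro hmem
        rw [Multiset.map_cons, Multiset.prod_cons, Polynomial.eval_mul]
        refine Appr.mul ?_ (ih fun r hr => hmem r (Multiset.mem_cons_of_mem hr))
        simpa using hz r (hmem r (Multiset.mem_cons_self r s))
  refine hmax ((IntermediateField.adjoin K' {z}).restrictScalars K) ?_ ?_ ?_
  · intro w hw hw0
    obtain ⟨r, s, hrs⟩ := (IntermediateField.mem_adjoin_simple_iff K' (α := z) w).1 hw
    have hr : Polynomial.aeval z r ≠ 0 := fun h => hw0 (by rw [hrs, h, zero_div])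
    have hs : Polynomial.aeval z s ≠ 0 := fun h => hw0 (by rw [hrs, h, div_zero])
    rw [hrs, div_eq_mul_inv]
    exact (hpoly r (fun h => hr (by simp [h]))).mul (hpoly s (fun h => hs (by simp [h]))).inv
  · intro w hw
    exact (IntermediateField.adjoin K' {z}).algebraMap_mem ⟨w, hw⟩
  · exact IntermediateField.mem_adjoin_simple_self K' z

end imm

end GST


set_option linter.unusedSectionVars false

namespace GST

universe u

section ultra

open Filter

variable {I K L Ω Λ Γ : Type*} [Field K] [Field L] [Algebra K L] [Field Ω] [Field Λ]
  [LinearOrderedCommGroupWithZero Γ] {φ : Ultrafilter I}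

structure Ultra (φ : Ultrafilter I) (π : (I → L) →+* Λ) : Prop where
  surj : Function.Surjective π
  eq_iff : ∀ f g, π f = π g ↔ ∀ᶠ i in (φ : Filter I), f i = g i

theorem ultra_germ (φ : Ultrafilter I) (L : Type*) [Field L] :
    Ultra φ (Germ.coeRingHom (φ : Filter I) : (I → L) →+* Germ (φ : Filter I) L) :=
  ⟨fun y => y.inductionOn fun f => ⟨f, rfl⟩, fun _ _ => Germ.coe_eq⟩

theorem Ultra.exists_val {π : (I → L) →+* Λ} (h : Ultra φ π) (w : Valuation L Γ) :
    ∃ A : ValuationSubring Λ, ∀ f g, A.valuation (π f) ≤ A.valuation (π g) ↔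
      ∀ᶠ i in (φ : Filter I), w (f i) ≤ w (g i) := by
  have hinv : ∀ f : I → L, (π f)⁻¹ = π (fun i => (f i)⁻¹) := by
    intro f
    by_cases h0 : π f = 0
    · rw [h0, inv_zero, ← map_zero π, h.eq_iff]
      rw [← map_zero π, h.eq_iff] at h0
      filter_upwards [h0] with i hi
      rw [hi]; simp
    · refine (eq_inv_of_mul_eq_one_right ?_).symm
      rw [← map_mul, ← map_one π, h.eq_iff]
      rw [← map_zero π, h.eq_iff, ← Ultrafilter.eventually_not] at h0
      filter_upwards [h0] with i hi
      exact mul_inv_cancel₀ hi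
  let A : ValuationSubring Λ :=
    { carrier := {y | ∃ f, π f = y ∧ ∀ᶠ i in (φ : Filter I), w (f i) ≤ 1}
      mul_mem' := by
        rintro _ _ ⟨f, rfl, hf⟩ ⟨g, rfl, hg⟩
        refine ⟨f * g, map_mul _ _ _, ?_⟩
        filter_upwards [hf, hg] with i h1 h2
        rw [Pi.mul_apply, map_mul]; exact mul_le_one' h1 h2
      one_mem' := ⟨1, map_one _, by simp⟩
      add_mem' := by
        rintro _ _ ⟨f, rfl, hf⟩ ⟨g, rfl, hg⟩
        refine ⟨f + g, map_add _ _ _, ?_⟩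
        filter_upwards [hf, hg] with i h1 h2
        exact w.map_add_le h1 h2
      zero_mem' := ⟨0, map_zero _, by simp⟩
      neg_mem' := by
        rintro _ ⟨f, rfl, hf⟩
        refine ⟨-f, map_neg _ _, ?_⟩
        filter_upwards [hf] with i h1
        rwa [Pi.neg_apply, Valuation.map_neg]
      mem_or_inv_mem' := by
        intro y
        obtain ⟨f, rfl⟩ := h.surj y
        rcases φ.em (fun i => w (f i) ≤ 1) with h1 | h1
        · exact Or.inl ⟨f, rfl, h1⟩
        · refine Or.inr ⟨fun i => (f i)⁻¹, (hinv f).symm, ?_⟩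
          filter_upwards [h1] with i h2
          rw [map_inv₀]
          exact inv_le_one_of_one_le₀ (not_le.1 h2).le }
  have hA : ∀ f, π f ∈ A ↔ ∀ᶠ i in (φ : Filter I), w (f i) ≤ 1 := by
    intro f
    constructor
    · rintro ⟨g, hg, h1⟩
      rw [h.eq_iff] at hg
      filter_upwards [hg, h1] with i h2 h3
      rwa [← h2]
    · exact fun hf => ⟨f, rfl, hf⟩
  refine ⟨A, fun f g => ?_⟩
  by_cases h0 : π g = 0
  · rw [h0, map_zero, le_zero_iff, map_eq_zero, ← map_zero π, h.eq_iff]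
    rw [← map_zero π, h.eq_iff] at h0
    constructor <;> intro h1
    · filter_upwards [h0, h1] with i h2 h3
      rw [h2, h3]
    · filter_upwards [h0, h1] with i h2 h3
      rw [h2] at h3
      simpa using h3
  · rw [val_le_iff A h0, div_eq_mul_inv, hinv, ← map_mul, hA]
    rw [← map_zero π, h.eq_iff, ← Ultrafilter.eventually_not] at h0
    refine eventually_congr ?_
    filter_upwards [h0] with i hi
    rw [Pi.mul_apply, map_mul, map_inv₀, ← div_eq_mul_inv,
      div_le_one₀ (zero_lt_iff.2 (w.ne_zero_iff.2 hi))]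

theorem Ultra.isAlgClosed [IsAlgClosed K] {π : (I → K) →+* Ω} (h : Ultra φ π) :
    IsAlgClosed Ω := by
  refine IsAlgClosed.of_exists_root Ω fun p hp hirr => ?_
  choose s hs using h.surj
  have hdeg : p.natDegree ≠ 0 := hirr.natDegree_pos.ne'
  have hroot : ∀ i : I, ∃ z : K, z ^ p.natDegree +
      ∑ j ∈ Finset.range p.natDegree, s (p.coeff j) i * z ^ j = 0 := by
    intro i
    set q : Polynomial K := Polynomial.X ^ p.natDegree +
      ∑ j ∈ Finset.range p.natDegree, Polynomial.C (s (p.coeff j) i) * Polynomial.X ^ j with hq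
    have hlt : (∑ j ∈ Finset.range p.natDegree,
        Polynomial.C (s (p.coeff j) i) * Polynomial.X ^ j).degree < (p.natDegree : WithBot ℕ) := by
      refine (Polynomial.degree_sum_le _ _).trans_lt ?_
      refine (Finset.sup_lt_iff (WithBot.bot_lt_coe _)).2 fun j hj => ?_
      exact (Polynomial.degree_C_mul_X_pow_le _ _).trans_lt
        (by exact_mod_cast Finset.mem_range.1 hj)
    have hdq : q.degree = p.natDegree := by
      rw [hq, Polynomial.degree_add_eq_left_of_degree_lt] <;> rw [Polynomial.degree_X_pow]
      exact hlt
    obtain ⟨z, hz⟩ := IsAlgClosed.exists_root q (by rw [hdq]; exact_mod_cast hdeg)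
    refine ⟨z, ?_⟩
    simpa [hq, Polynomial.eval_finset_sum] using hz
  choose z hz using hroot
  refine ⟨π z, ?_⟩
  have h1 : p.eval (π z) = π (z ^ p.natDegree +
      ∑ j ∈ Finset.range p.natDegree, s (p.coeff j) * z ^ j) := by
    rw [Polynomial.eval_eq_sum_range, Finset.sum_range_succ, Polynomial.coeff_natDegree,
      hp.leadingCoeff, one_mul, add_comm, map_add, map_sum, map_pow]
    simp only [map_mul, map_pow, hs]
  rw [h1, ← map_zero π]
  congr 1
  ext i
  simpa using hz i

theorem Ultra.exists_map {π : (I → K) →+* Ω} (h : Ultra φ π) {π' : (I → L) →+* Λ}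
    (h' : Ultra φ π') :
    ∃ j : Ω →+* Λ, ∀ f, j (π f) = π' (fun i => algebraMap K L (f i)) := by
  let g : (I → K) →+* Λ := π'.comp
    ((RingHom.pi fun i => (algebraMap K L).comp (Pi.evalRingHom (fun _ : I => K) i)))
  have hg : ∀ f, g f = π' (fun i => algebraMap K L (f i)) := fun f => rfl
  have hker : RingHom.ker π ≤ RingHom.ker g := by
    intro f hf
    rw [RingHom.mem_ker] at hf ⊢
    rw [← map_zero π, h.eq_iff] at hf
    rw [hg, ← map_zero π', h'.eq_iff]
    filter_upwards [hf] with i hi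
    rw [hi]; simp
  exact ⟨π.liftOfSurjective h.surj ⟨g, hker⟩, fun f => by
    rw [RingHom.liftOfRightInverse_comp_apply, hg]⟩

end ultra

end GST


set_option linter.unusedSectionVars false

namespace GST

universe u

section mono

variable {K Λ Γ : Type*} [Field K] [Field Λ] [Algebra K Λ] [LinearOrderedCommGroupWithZero Γ]

theorem near_val {v : Valuation Λ Γ} {y d : Λ} (h : v (y - d) < v y) : v d = v y :=
  (ENorm.self (E := Λ) v).eq_of_sub_lt h

theorem near_mul {v : Valuation Λ Γ} {y z d e : Λ} (hy : v (y - d) < v y) (hz : v (z - e) < v z) :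
    v (y * z - d * e) < v (y * z) := by
  have h1 : 0 < v y := lt_of_le_of_lt zero_le hy
  have h2 : 0 < v z := lt_of_le_of_lt zero_le hz
  have : y * z - d * e = (y - d) * z + d * (z - e) := by ring
  rw [this, map_mul]
  refine v.map_add_lt ?_ ?_
  · rw [map_mul]; exact mul_lt_mul_of_pos_right hy h2
  · rw [map_mul, near_val hy]; exact mul_lt_mul_of_pos_left hz h1

theorem near_inv {v : Valuation Λ Γ} {y d : Λ} (hy : v (y - d) < v y) :
    v (y⁻¹ - d⁻¹) < v y⁻¹ := by
  have h1 : 0 < v y := lt_of_le_of_lt zero_le hy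
  have hd := near_val hy
  have hy0 : y ≠ 0 := v.ne_zero_iff.1 h1.ne'
  have hd0 : d ≠ 0 := v.ne_zero_iff.1 (hd ▸ h1.ne')
  have : y⁻¹ - d⁻¹ = (d - y) * (y⁻¹ * d⁻¹) := by field_simp
  rw [this, map_mul, map_mul, v.map_sub_swap, map_inv₀, map_inv₀, hd]
  calc _ < v y * ((v y)⁻¹ * (v y)⁻¹) := mul_lt_mul_of_pos_right hy (zero_lt_iff.2 (by simp [hy0]))
    _ = _ := by field_simp

/-- value independence -/
def VI (K : Type*) {Λ Γ : Type*} [Field K] [Field Λ] [Algebra K Λ]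
    [LinearOrderedCommGroupWithZero Γ] (v : Valuation Λ Γ) (x : Λ) : Prop :=
  x ≠ 0 ∧ ∀ (t : ℤ) (c : K), c ≠ 0 → v (x ^ t) = v (algebraMap K Λ c) → t = 0

variable {v : Valuation Λ Γ} {x : Λ}

theorem VI.mono_inj (h : VI K v x) {c d : K} (hc : c ≠ 0) (hd : d ≠ 0) {s t : ℤ}
    (he : v (algebraMap K Λ c * x ^ s) = v (algebraMap K Λ d * x ^ t)) : s = t := by
  have hc' : algebraMap K Λ c ≠ 0 := by simpa using hc
  have hd' : algebraMap K Λ d ≠ 0 := by simpa using hd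
  have := h.2 (s - t) (d / c) (div_ne_zero hd hc) (by
    rw [zpow_sub₀ h.1, map_div₀ v, map_div₀ (algebraMap K Λ), map_div₀ v,
      div_eq_div_iff (v.ne_zero_iff.2 (zpow_ne_zero _ h.1)) (v.ne_zero_iff.2 hc'),
      mul_comm, ← map_mul, he, map_mul])
  omega

theorem VI.poly (h : VI K v x) {p : Polynomial K} (hp : p ≠ 0) :
    ∃ c : K, c ≠ 0 ∧ ∃ t : ℕ, v (Polynomial.aeval x p - algebraMap K Λ c * x ^ t) <
      v (Polynomial.aeval x p) := by
  obtain ⟨m, hm, hmax⟩ := Finset.exists_max_image p.support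
    (fun j => v (algebraMap K Λ (p.coeff j) * x ^ j)) (Polynomial.nonempty_support_iff.2 hp)
  have hm0 : p.coeff m ≠ 0 := Polynomial.mem_support_iff.1 hm
  refine ⟨p.coeff m, hm0, m, ?_⟩
  have hs : Polynomial.aeval x p = ∑ j ∈ p.support, algebraMap K Λ (p.coeff j) * x ^ j := by
    rw [Polynomial.aeval_def, Polynomial.eval₂_eq_sum, Polynomial.sum_def]
  have hlt : v (Polynomial.aeval x p - algebraMap K Λ (p.coeff m) * x ^ m) <
      v (algebraMap K Λ (p.coeff m) * x ^ m) := by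
    rw [hs, ← Finset.add_sum_erase _ _ hm, add_sub_cancel_left]
    refine v.map_sum_lt (v.ne_zero_iff.2 (mul_ne_zero (by simpa using hm0) (pow_ne_zero _ h.1)))
      fun j hj => ?_
    obtain ⟨hjm, hj⟩ := Finset.mem_erase.1 hj
    refine lt_of_le_of_ne (hmax j hj) fun he => hjm ?_
    have := h.mono_inj (Polynomial.mem_support_iff.1 hj) hm0 (s := j) (t := m)
      (by simpa using he)
    exact_mod_cast this
  rwa [(ENorm.self (E := K) v).eq_of_sub_lt' hlt]

theorem VI.approx (h : VI K v x) {f : Λ} (hf : f ∈ IntermediateField.adjoin K {x}) (hf0 : f ≠ 0) :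
    ∃ c : K, c ≠ 0 ∧ ∃ t : ℤ, v (f - algebraMap K Λ c * x ^ t) < v f := by
  obtain ⟨r, s, hrs⟩ := (IntermediateField.mem_adjoin_simple_iff K (α := x) f).1 hf
  have hr : r ≠ 0 := by rintro rfl; exact hf0 (by rw [hrs]; simp)
  have hs : s ≠ 0 := by rintro rfl; exact hf0 (by rw [hrs]; simp)
  obtain ⟨c, hc, t, h1⟩ := h.poly hr
  obtain ⟨d, hd, t', h2⟩ := h.poly hs
  refine ⟨c / d, div_ne_zero hc hd, t - t', ?_⟩
  have := near_mul h1 (near_inv h2)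
  rw [hrs, div_eq_mul_inv]
  convert this using 3
  rw [zpow_sub₀ h.1, map_div₀]
  simp only [zpow_natCast]
  have := h.1
  field_simp

theorem VI.tor (h : VI K v x) {f : Λ} (hf : IsAlgebraic (IntermediateField.adjoin K {x}) f)
    (hf0 : f ≠ 0) : ∃ k : ℕ, k ≠ 0 ∧ ∃ c : K, c ≠ 0 ∧ ∃ t : ℤ,
      v f ^ k = v (algebraMap K Λ c * x ^ t) := by
  obtain ⟨k, hk, -, g, hg0, hg⟩ := exists_tor v hf0 hf.isIntegral
  obtain ⟨c, hc, t, h1⟩ := h.approx g.2 (by simpa using hg0)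
  exact ⟨k, hk, c, hc, t, by rw [hg, near_val h1]; rfl⟩

end mono

section OB

open Filter

variable {K L : Type u} {Γ : Type*} [Field K] [IsAlgClosed K] [Field L] [Algebra K L]
  [LinearOrderedCommGroupWithZero Γ] {ι : Type*} [Fintype ι] [Nonempty ι]

theorem val_const {I : Type u} {φ : Ultrafilter I} {Ω Λ : Type u} [Field Ω] [Field Λ] [Algebra K Ω]
    {πK : (I → K) →+* Ω} {πL : (I → L) →+* Λ} (hπL : Ultra φ πL)
    (hcK : ∀ c : K, algebraMap K Ω c = πK (fun _ => c))
    (j : Ω →+* Λ) (hj : ∀ f, j (πK f) = πL (fun i => algebraMap K L (f i)))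
    (v : Valuation K Γ) (A : ValuationSubring Ω)
    (hA : ∀ f g, A.valuation (πK f) ≤ A.valuation (πK g) ↔
      ∀ᶠ i in (φ : Filter I), v (f i) ≤ v (g i))
    (hsK : Function.Surjective πK)
    (K' : IntermediateField K Ω) (hK' : Imm A.valuation K')
    (w : Valuation L Γ) (hw : ∀ e, w (algebraMap K L e) = v e) {x : L} (hx : VI K w x)
    (halg : ∀ y : L, IsAlgebraic (IntermediateField.adjoin K {x}) y)
    {m : ℕ} (b : L) (u : Fin m → L) (a : Fin m → I → K) (ha : ∀ k, πK (a k) ∈ K') :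
    ∃ γ : Γ, ∀ᶠ i in (φ : Filter I), w (b - ∑ k, a k i • u k) = γ := by
  obtain ⟨B, hB⟩ := hπL.exists_val w
  have hBeq : ∀ f g, B.valuation (πL f) = B.valuation (πL g) →
      ∀ᶠ i in (φ : Filter I), w (f i) = w (g i) := fun f g h => by
    filter_upwards [(hB f g).1 h.le, (hB g f).1 h.ge] with i h1 h2 using le_antisymm h1 h2
  let _ : Algebra Ω Λ := j.toAlgebra
  let _ : Algebra L Λ := (πL.comp (Pi.constRingHom I L)).toAlgebra
  let _ : Algebra K Λ := (j.comp (algebraMap K Ω)).toAlgebra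
  have : IsScalarTower K Ω Λ := IsScalarTower.of_algebraMap_eq fun _ => rfl
  have hLΛ : ∀ y, algebraMap L Λ y = πL (fun _ => y) := fun y => rfl
  have : IsScalarTower K L Λ := IsScalarTower.of_algebraMap_eq fun c => by
    change j (algebraMap K Ω c) = _
    rw [hcK, hj, hLΛ]
  have hAB : ∀ a b : Ω, A.valuation a = A.valuation b →
      B.valuation (algebraMap Ω Λ a) = B.valuation (algebraMap Ω Λ b) := by
    have key : ∀ a b : Ω, A.valuation a ≤ A.valuation b →
        B.valuation (algebraMap Ω Λ a) ≤ B.valuation (algebraMap Ω Λ b) := by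
      intro a b h
      obtain ⟨f, rfl⟩ := hsK a
      obtain ⟨g, rfl⟩ := hsK b
      change B.valuation (j _) ≤ B.valuation (j _)
      rw [hj, hj, hB]
      rw [hA] at h
      simpa only [hw] using h
    exact fun a b h => le_antisymm (key _ _ h.le) (key _ _ h.ge)
  have hVI : VI K' B.valuation (algebraMap L Λ x) := by
    refine ⟨by simpa using hx.1, fun t c hc h => ?_⟩
    obtain ⟨d, hd0, hd, -⟩ := (hK' c.1 c.2 (by simpa using hc)).val
    have h1 := hAB _ _ hd
    have h2 : B.valuation (πL fun _ => x ^ t) = B.valuation (πL fun _ => algebraMap K L d) := by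
      rw [← hLΛ, ← hLΛ, map_zpow₀, h]
      exact h1.symm.trans (by rw [← IsScalarTower.algebraMap_apply, ← IsScalarTower.algebraMap_apply])
    obtain ⟨i, hi⟩ := (hBeq _ _ h2).exists
    exact hx.2 t d hd0 hi
  set y : Λ := algebraMap L Λ b - ∑ k, algebraMap Ω Λ (πK (a k)) * algebraMap L Λ (u k) with hy
  have hyπ : y = πL (fun i => b - ∑ k, a k i • u k) := by
    have : (fun i => b - ∑ k, a k i • u k) =
        (fun _ => b) - ∑ k, (fun i => algebraMap K L (a k i)) * (fun _ => u k) := by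
      ext i
      simp [Algebra.smul_def]
    rw [this, map_sub, map_sum, hy]
    simp only [map_mul]
    rw [← hLΛ]
    congr 1
    refine Finset.sum_congr rfl fun k _ => ?_
    rw [← hj, ← hLΛ]; rfl
  by_cases hy0 : y = 0
  · refine ⟨0, ?_⟩
    rw [hyπ, ← map_zero πL, hπL.eq_iff] at hy0
    filter_upwards [hy0] with i hi
    rw [hi]; simp
  have halg' : ∀ l : L, IsAlgebraic (IntermediateField.adjoin K' {algebraMap L Λ x})
      (algebraMap L Λ l) := by
    intro l
    set E := IntermediateField.adjoin K' {algebraMap L Λ x}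
    have hle : ∀ z ∈ IntermediateField.adjoin K {x}, algebraMap L Λ z ∈ E := by
      intro z hz
      have : IntermediateField.adjoin K {x} ≤
          (E.restrictScalars K).comap (IsScalarTower.toAlgHom K L Λ) := by
        rw [IntermediateField.adjoin_simple_le_iff]
        exact IntermediateField.mem_adjoin_simple_self K' _
      exact this hz
    let g : IntermediateField.adjoin K {x} →+* E :=
      ((algebraMap L Λ).comp (algebraMap (IntermediateField.adjoin K {x}) L)).codRestrict
        E.toSubfield.toSubring (fun z => hle z.1 z.2)
    refine (halg l).ringHom_of_comp_eq g (algebraMap L Λ) g.injective ?_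
    rfl
  have hyalg : IsAlgebraic (IntermediateField.adjoin K' {algebraMap L Λ x}) y := by
    refine ((halg' b).isIntegral.sub
      (IsIntegral.sum _ fun k _ => IsIntegral.mul ?_ (halg' _).isIntegral)).isAlgebraic
    have := (IntermediateField.adjoin K' {algebraMap L Λ x}).algebraMap_mem ⟨_, ha k⟩
    exact isIntegral_algebraMap (x := (⟨_, this⟩ : IntermediateField.adjoin K' {algebraMap L Λ x}))
  obtain ⟨k, hk, c, hc0, t, hkc⟩ := hVI.tor hyalg hy0
  obtain ⟨d, hd0, hd, -⟩ := (hK' c.1 c.2 (by simpa using hc0)).val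
  have h1 := hAB _ _ hd
  have h2 : B.valuation (πL ((fun i => b - ∑ k, a k i • u k) ^ k)) =
      B.valuation (πL fun _ => algebraMap K L d * x ^ t) := by
    rw [map_pow, map_pow, ← hyπ, hkc, ← hLΛ, map_mul, map_mul, map_mul, ← map_zpow₀]
    congr 1
    exact h1.symm.trans (by rw [← IsScalarTower.algebraMap_apply, ← IsScalarTower.algebraMap_apply])
  have h3 := hBeq _ _ h2
  obtain ⟨i0, hi0⟩ := h3.exists
  refine ⟨w (b - ∑ k, a k i0 • u k), ?_⟩
  filter_upwards [h3] with i hi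
  rw [← hi0] at hi
  simp only [Pi.pow_apply, map_pow] at hi
  exact (pow_left_inj₀ zero_le zero_le hk).1 hi

theorem exists_min {v : Valuation K Γ} {w : ι → Valuation L Γ}
    (hw : ∀ i e, w i (algebraMap K L e) = v e) {x : L} (hx : ∀ i, VI K (w i) x)
    (halg : ∀ y : L, IsAlgebraic (IntermediateField.adjoin K {x}) y)
    {m : ℕ} {u : Fin m → L} (hu : Orth K (fun b => Finset.univ.sup fun i => w i b) u) (b : L) :
    ∃ c : Fin m → K, ∀ c' : Fin m → K, (fun b => Finset.univ.sup fun i => w i b) (b - ∑ k, c k • u k)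
      ≤ (fun b => Finset.univ.sup fun i => w i b) (b - ∑ k, c' k • u k) := by
  set N : L → Γ := fun b => Finset.univ.sup fun i => w i b with hNdef
  have hN : ENorm v N := ENorm.sup hw
  have hne : (⨅ c' : Fin m → K, 𝓟 {c : Fin m → K | N (b - ∑ k, c k • u k) ≤
      N (b - ∑ k, c' k • u k)}).NeBot := by
    refine iInf_neBot_of_directed ?_ fun c' => ?_
    · intro c₁ c₂
      rcases le_total (N (b - ∑ k, c₁ k • u k)) (N (b - ∑ k, c₂ k • u k)) with h | h
      · exact ⟨c₁, le_rfl, principal_mono.2 fun c hc => le_trans hc h⟩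
      · exact ⟨c₂, principal_mono.2 fun c hc => le_trans hc h, le_rfl⟩
    · exact principal_neBot_iff.2 ⟨c', le_rfl⟩
  obtain ⟨φ, hφ⟩ : ∃ φ : Ultrafilter (Fin m → K), ∀ c' : Fin m → K, ∀ᶠ c in (φ : Filter (Fin m → K)),
      N (b - ∑ k, c k • u k) ≤ N (b - ∑ k, c' k • u k) := by
    refine ⟨@Ultrafilter.of _ _ hne, fun c' => @Ultrafilter.of_le _ _ hne _ ?_⟩
    exact mem_iInf_of_mem c' (mem_principal_self _)
  obtain ⟨Ω, iΩ, πK, hπK⟩ : ∃ (Ω : Type u) (_ : Field Ω) (π : ((Fin m → K) → K) →+* Ω),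
    Ultra φ π := ⟨_, _, _, ultra_germ φ K⟩
  obtain ⟨Λ, iΛ, πL, hπL⟩ : ∃ (Λ : Type u) (_ : Field Λ) (π : ((Fin m → K) → L) →+* Λ),
    Ultra φ π := ⟨_, _, _, ultra_germ φ L⟩
  have hcl : IsAlgClosed Ω := hπK.isAlgClosed
  obtain ⟨j, hj⟩ := hπK.exists_map hπL
  obtain ⟨A, hA⟩ := hπK.exists_val v
  let _ : Algebra K Ω := (πK.comp (Pi.constRingHom (Fin m → K) K)).toAlgebra
  have hcK : ∀ c : K, algebraMap K Ω c = πK (fun _ => c) := fun c => rfl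
  obtain ⟨K', hK', hmax⟩ := exists_max_imm (K := K) A.valuation
  have hz : ∀ k (c' : Fin m → K), ∀ᶠ c in (φ : Filter (Fin m → K)),
      v (c k - c' k) * N (u k) ≤ N (b - ∑ k, c' k • u k) := by
    intro k c'
    filter_upwards [hφ c'] with c hc
    have h1 := hu.2 (fun k => c k - c' k) k
    rw [hN.smul] at h1
    refine h1.trans ?_
    have h2 : ∑ k, (c k - c' k) • u k = (b - ∑ k, c' k • u k) - (b - ∑ k, c k • u k) := by
      simp only [sub_smul, Finset.sum_sub_distrib]; abel
    rw [h2]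
    exact (hN.sub_le _ _).trans (max_le le_rfl hc)
  have hlim : ∀ k, ∃ a : (Fin m → K) → K, πK a ∈ K' ∧ ∀ c' : Fin m → K,
      ∀ᶠ c in (φ : Filter (Fin m → K)), v (a c - c' k) * N (u k) ≤ N (b - ∑ k, c' k • u k) := by
    intro k
    by_contra hcon
    push Not at hcon
    have hzK : πK (fun c => c k) ∈ K' := by
      refine hmax _ fun a ha => ?_
      obtain ⟨f, rfl⟩ := hπK.surj a
      obtain ⟨c', hc'⟩ := hcon f ha
      have hlt : A.valuation (πK (fun c => c k) - πK f - (algebraMap K Ω (c' k) - πK f)) <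
          A.valuation (algebraMap K Ω (c' k) - πK f) := by
        rw [sub_sub_sub_cancel_right, hcK, ← map_sub, ← map_sub, ← not_le, hA,
          ← Ultrafilter.eventually_not]
        filter_upwards [hz k c', hc'] with c h1 h2
        rw [not_le]
        simp only [Pi.sub_apply]
        rw [v.map_sub_swap (c' k)]
        exact lt_of_mul_lt_mul_of_nonneg_right (h1.trans_lt h2) zero_le
      refine Appr.of_sub (hK' _ (K'.sub_mem (K'.algebraMap_mem _) ha) fun h0 => ?_) hlt
      rw [h0] at hlt
      simp at hlt
    obtain ⟨c', hc'⟩ := hcon _ hzK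
    obtain ⟨c, h1, h2⟩ := ((hz k c').and hc').exists
    exact h1.not_gt h2
  choose a ha hlim using hlim
  have hγ : ∀ i, ∃ γ : Γ, ∀ᶠ c in (φ : Filter (Fin m → K)), w i (b - ∑ k, a k c • u k) = γ :=
    fun i => val_const hπL hcK j hj v A hA hπK.surj K' hK' (w i) (hw i) (hx i) halg b u a ha
  choose γ hγ using hγ
  rw [← eventually_all] at hγ
  have hNγ : ∀ᶠ c in (φ : Filter (Fin m → K)), N (b - ∑ k, a k c • u k) = Finset.univ.sup γ := by
    filter_upwards [hγ] with c hc
    exact Finset.sup_congr rfl fun i _ => hc i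
  obtain ⟨c0, hc0⟩ := hNγ.exists
  refine ⟨fun k => a k c0, fun c' => ?_⟩
  have h1 := hNγ.and (eventually_all.2 fun k => hlim k c')
  obtain ⟨c, hc, hc1⟩ := h1.exists
  rw [hc0, ← hc]
  have h2 : b - ∑ k, a k c • u k = (b - ∑ k, c' k • u k) - ∑ k, (a k c - c' k) • u k := by
    simp only [sub_smul, Finset.sum_sub_distrib]; abel
  rw [h2]
  refine (hN.sub_le _ _).trans (max_le le_rfl (hN.sum_le fun k _ => ?_))
  rw [hN.smul]; exact hc1 k

theorem exists_orth_basis {v : Valuation K Γ} {w : ι → Valuation L Γ}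
    (hw : ∀ i e, w i (algebraMap K L e) = v e) {x : L} (hx : ∀ i, VI K (w i) x)
    (halg : ∀ y : L, IsAlgebraic (IntermediateField.adjoin K {x}) y)
    {m : ℕ} (l : Fin m → L) (hl : LinearIndependent K l) :
    ∃ u : Fin m → L, Orth K (fun b => Finset.univ.sup fun i => w i b) u ∧
      ∀ k, u k ∈ Submodule.span K (Set.range l) := by
  induction m with
  | zero => exact ⟨l, ⟨fun k => k.elim0, fun _ k => k.elim0⟩, fun k => k.elim0⟩
  | succ m ih =>
    have hN : ENorm v (fun b => Finset.univ.sup fun i => w i b) := ENorm.sup hw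
    obtain ⟨u, hu, hus⟩ := ih (l ∘ Fin.succ) (hl.comp _ (Fin.succ_injective _))
    obtain ⟨c, hc⟩ := exists_min hw hx halg hu (l 0)
    have hsum : ∑ k, c k • u k ∈ Submodule.span K (Set.range (l ∘ Fin.succ)) :=
      Submodule.sum_mem _ fun k _ => Submodule.smul_mem _ _ (hus k)
    have hle : Submodule.span K (Set.range (l ∘ Fin.succ)) ≤ Submodule.span K (Set.range l) :=
      Submodule.span_mono (Set.range_comp_subset_range _ _)
    have hb0 : l 0 - ∑ k, c k • u k ≠ 0 := by
      intro h0
      rw [sub_eq_zero] at h0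
      rw [← h0] at hsum
      have := hl.notMem_span_image (s := Set.range Fin.succ) (x := 0) (by simp)
      rw [← Set.range_comp] at this
      exact this hsum
    have h1 := hu.option hN hb0 (fun c' => by
      have := hc (fun k => c k + c' k)
      simp only [add_smul, Finset.sum_add_distrib] at this
      rwa [sub_sub])
    refine ⟨_, h1.reindex (finSuccEquiv m), fun k => ?_⟩
    refine Fin.cases ?_ (fun k => ?_) k
    · simp only [Function.comp, finSuccEquiv_zero, Option.elim]
      exact Submodule.sub_mem _ (Submodule.subset_span ⟨0, rfl⟩) (hle hsum)
    · simp only [Function.comp, finSuccEquiv_succ, Option.elim]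
      exact hle (hus k)

end OB

end GST


set_option linter.unusedSectionVars false

namespace GST

universe u

theorem ext_nonempty (E L : Type*) [Field E] [Field L] [Algebra E L] (O : ValuationSubring E) :
    (Ext E L O).Nonempty := by
  obtain ⟨B, hB⟩ := LocalSubring.exists_le_valuationSubring
    (LocalSubring.map (algebraMap E L) O.toLocalSubring)
  obtain ⟨h1, h2⟩ := hB
  have hmem : ∀ a ∈ O, algebraMap E L a ∈ B := fun a ha =>
    h1 (Subring.mem_map.2 ⟨a, ha, rfl⟩)
  refine ⟨B, ?_⟩
  change B.comap (algebraMap E L) = O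
  refine le_antisymm (fun y hy => ?_) hmem
  by_contra hyO
  have hy0 : y ≠ 0 := by rintro rfl; exact hyO (zero_mem _)
  have hyi : y⁻¹ ∈ O := (O.mem_or_inv_mem y).resolve_left hyO
  have h3 := h2.1 (a := ⟨algebraMap E L y⁻¹, Subring.mem_map.2 ⟨_, hyi, rfl⟩⟩) (by
    rw [isUnit_iff_exists_inv]
    refine ⟨⟨algebraMap E L y, hy⟩, ?_⟩
    ext
    change algebraMap E L y⁻¹ * algebraMap E L y = 1
    rw [← map_mul, inv_mul_cancel₀ hy0, map_one])
  rw [isUnit_iff_exists_inv] at h3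
  obtain ⟨⟨z, hz⟩, h4⟩ := h3
  obtain ⟨z', hz', rfl⟩ := Subring.mem_map.1 hz
  have h5 : algebraMap E L y⁻¹ * algebraMap E L z' = 1 := congrArg Subtype.val h4
  have h6 : y⁻¹ * z' = 1 := by
    apply (algebraMap E L).injective
    rw [map_mul, map_one]; exact h5
  have h7 : y = z' := by
    have := eq_inv_of_mul_eq_one_right h6
    simpa using this.symm
  exact hyO (h7 ▸ hz')

section spectral

variable {F L : Type*} [Field F] [Field L] [Algebra F L] [FiniteDimensional F L]
  (O : ValuationSubring F)

noncomputable def allX (L : Type*) [Field L] [Algebra F L] [FiniteDimensional F L]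
    (O : ValuationSubring F) : Finset (ValuationSubring L) := (ext_finite F L O).toFinset

theorem mem_allX {O : ValuationSubring F} {W : ValuationSubring L} :
    W ∈ allX L O ↔ W ∈ Ext F L O := by
  simp [allX]

instance : Nonempty (allX L O) := by
  obtain ⟨W, hW⟩ := ext_nonempty F L O
  exact ⟨⟨W, mem_allX.2 hW⟩⟩

noncomputable def cw (W : allX L O) : Valuation L O.ValueGroup := Ext.cv (mem_allX.1 W.2)

noncomputable def sN (b : L) : O.ValueGroup := Finset.univ.sup fun W : allX L O => cw O W b

theorem cw_algebraMap (W : allX L O) (e : F) : cw O W (algebraMap F L e) = vpow F L O e :=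
  Ext.cv_algebraMap _ e

theorem sN_norm : ENorm (vpow F L O) (sN O : L → O.ValueGroup) :=
  ENorm.sup fun W e => cw_algebraMap O W e

theorem cw_le_sN (W : allX L O) (b : L) : cw O W b ≤ sN O b :=
  Finset.le_sup (f := fun W => cw O W b) (Finset.mem_univ W)

theorem exists_cw (b : L) : ∃ W : allX L O, cw O W b = sN O b := by
  obtain ⟨W, -, h⟩ := Finset.exists_mem_eq_sup Finset.univ Finset.univ_nonempty
    (fun W : allX L O => cw O W b)
  exact ⟨W, h.symm⟩

theorem cw_conj (σ : L ≃ₐ[F] L) (W : allX L O) (b : L) : cw O W (σ b) ≤ sN O b := by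
  by_cases hb : b = 0
  · simp [hb]
  have hW := mem_allX.1 W.2
  have hW' : W.1.comap (σ : L →+* L) ∈ Ext F L O := by
    change ((W.1.comap (σ : L →+* L)).comap (algebraMap F L)) = O
    rw [ValuationSubring.comap_comap]
    refine Eq.trans ?_ (show W.1.comap (algebraMap F L) = O from hW)
    congr 1
    ext e; simp
  refine le_trans (le_of_eq ?_) (cw_le_sN O ⟨_, mem_allX.2 hW'⟩ b)
  obtain ⟨c, hc, h⟩ := Ext.tor (E := F) (W := W.1.comap (σ : L →+* L)) b hb
  have h' : W.1.valuation (σ b) ^ (Module.finrank F L).factorial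
      = W.1.valuation (algebraMap F L c) := by
    have hk : ∀ y z : L, (W.1.comap (σ : L →+* L)).valuation y ≤ (W.1.comap (σ : L →+* L)).valuation z
        ↔ W.1.valuation (σ y) ≤ W.1.valuation (σ z) := by
      intro y z
      by_cases hz : z = 0
      · simp [hz]
      rw [val_le_iff _ hz, val_le_iff _ (by simpa using hz), ← map_div₀]
      rfl
    rw [← map_pow] at h ⊢
    rw [← map_pow, ← σ.commutes c]
    exact le_antisymm ((hk _ _).1 h.le) ((hk _ _).1 h.ge)
  exact (Ext.cv_eq hW h').trans (Ext.cv_eq hW' h).symm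

theorem coeff_bound {Γ : Type*} [LinearOrderedCommGroupWithZero Γ] (w : Valuation L Γ) (B : Γ)
    (s : Multiset L) (hs : ∀ a ∈ s, w a ≤ B) :
    ∀ j k, j + k = s.card → w ((s.map fun a => Polynomial.X - Polynomial.C a).prod.coeff j) ≤ B ^ k := by
  classical
  induction s using Multiset.induction_on with
  | empty => intro j k h; simp at h; simp [h]
  | cons a s ih =>
    have ih := ih fun b hb => hs b (Multiset.mem_cons_of_mem hb)
    have ha := hs a (Multiset.mem_cons_self a s)
    intro j k h
    rw [Multiset.card_cons] at h
    rw [Multiset.map_cons, Multiset.prod_cons, sub_mul, Polynomial.coeff_sub, Polynomial.coeff_C_mul]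
    refine (w.map_sub _ _).trans (max_le ?_ ?_)
    · cases j with
      | zero => simp
      | succ j => rw [Polynomial.coeff_X_mul]; exact ih j k (by omega)
    · cases k with
      | zero =>
        rw [Polynomial.coeff_eq_zero_of_natDegree_lt, mul_zero, map_zero]
        · exact zero_le
        · rw [Polynomial.natDegree_multiset_prod_X_sub_C_eq_card]; omega
      | succ k =>
        rw [map_mul, pow_succ']
        exact mul_le_mul' ha (ih j k (by omega))

theorem spectral [Normal F L] (b : L) (hb : b ≠ 0) :
    ∃ j k, 0 < k ∧ j + k = (minpoly F b).natDegree ∧ (minpoly F b).coeff j ≠ 0 ∧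
      vpow F L O ((minpoly F b).coeff j) = sN O b ^ k := by
  classical
  obtain ⟨W, hW⟩ := exists_cw O b
  set P := minpoly F b with hP
  have hint : IsIntegral F b := IsIntegral.of_finite F b
  have hmon : P.Monic := minpoly.monic hint
  have hsp : (P.map (algebraMap F L)).Splits := Normal.splits inferInstance b
  have hB0 : sN O b ≠ 0 := (sN_norm O).ne hb
  have hup : ∀ j k, j + k = P.natDegree → vpow F L O (P.coeff j) ≤ sN O b ^ k := by
    intro j k hjk
    have := coeff_bound (cw O W) (sN O b) (P.map (algebraMap F L)).roots (by
      intro a ha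
      have ha' : Polynomial.aeval a P = 0 := by
        have := Polynomial.isRoot_of_mem_roots ha
        simpa [Polynomial.IsRoot, Polynomial.eval_map_algebraMap] using this
      have hc : IsConjRoot F b a := (isConjRoot_iff_aeval_eq_zero hint).2 ha'
      obtain ⟨σ, hσ⟩ := isConjRoot_iff_exists_algEquiv.1 hc
      rw [← (σ.symm_apply_eq.2 hσ.symm)]
      exact cw_conj O _ W b) j k (by
        rw [hjk, ← hsp.natDegree_eq_card_roots, Polynomial.natDegree_map])
    have h2 := hsp.eq_prod_roots
    rw [Polynomial.leadingCoeff_map, hmon.leadingCoeff, map_one, map_one, one_mul] at h2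
    rw [← h2, Polynomial.coeff_map, cw_algebraMap] at this
    exact this
  by_contra hcon
  push Not at hcon
  have hlt : ∀ j k, 0 < k → j + k = P.natDegree → vpow F L O (P.coeff j) < sN O b ^ k := by
    intro j k hk hjk
    by_cases h0 : P.coeff j = 0
    · rw [h0, map_zero]; exact pow_pos (zero_lt_iff.2 hB0) _
    · exact lt_of_le_of_ne (hup j k hjk) (hcon j k hk hjk h0)
  have hz : Polynomial.aeval b P = 0 := minpoly.aeval F b
  rw [Polynomial.aeval_eq_sum_range, Finset.sum_range_succ, hmon.coeff_natDegree, one_smul] at hz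
  have h3 : cw O W (b ^ P.natDegree) < cw O W (b ^ P.natDegree) := by
    nth_rw 1 [← neg_eq_of_add_eq_zero_right hz]
    rw [Valuation.map_neg]
    refine Valuation.map_sum_lt _ ?_ fun j hj => ?_
    · rw [map_pow, hW]; exact pow_ne_zero _ hB0
    · have hj' := Finset.mem_range.1 hj
      rw [Algebra.smul_def, map_mul, cw_algebraMap, map_pow, map_pow, hW]
      have := hlt j (P.natDegree - j) (by omega) (by omega)
      calc _ < sN O b ^ (P.natDegree - j) * sN O b ^ j :=
            mul_lt_mul_of_pos_right this (pow_pos (zero_lt_iff.2 hB0) _)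
        _ = _ := by rw [← pow_add]; congr 1; omega
  exact lt_irrefl _ h3

end spectral

end GST


set_option linter.unusedSectionVars false

namespace GST

universe u

open Polynomial

section intx

variable {K F L : Type*} [Field K] [Field F] [Algebra K F] [Field L] [Algebra F L]

/-- `b` is integral over the polynomial ring generated by `x` over `K` -/
def IntX (K : Type*) {F L : Type*} [Field K] [Field F] [Algebra K F] [Field L] [Algebra F L]
    (x : F) (b : L) : Prop :=
  ((algebraMap F L).comp (aeval x : K[X] →ₐ[K] F).toRingHom).IsIntegralElem b

variable {x : F}

theorem IntX.add {a b : L} (ha : IntX K x a) (hb : IntX K x b) : IntX K x (a + b) :=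
  RingHom.IsIntegralElem.add _ ha hb

theorem IntX.mul {a b : L} (ha : IntX K x a) (hb : IntX K x b) : IntX K x (a * b) :=
  RingHom.IsIntegralElem.mul _ ha hb

theorem IntX.zero : IntX K x (0 : L) := RingHom.isIntegralElem_zero _

theorem IntX.poly (p : K[X]) : IntX K x (algebraMap F L (aeval x p)) :=
  RingHom.isIntegralElem_map _ (x := p)

theorem IntX.of_monic {b : L} {P : F[X]} (hP : P.Monic) (hb : aeval b P = 0)
    (h : ∀ i, ∃ p : K[X], P.coeff i = aeval x p) : IntX K x b := by
  obtain ⟨Q, h1, -, h2⟩ := lifts_and_natDegree_eq_and_monic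
    (f := (aeval x : K[X] →ₐ[K] F).toRingHom) (p := P)
    ((lifts_iff_coeff_lifts _).2 fun i => by
      obtain ⟨p, hp⟩ := h i
      exact ⟨p, hp.symm⟩) hP
  refine ⟨Q, h2, ?_⟩
  rw [← eval₂_map, h1]
  exact hb

variable (hx : Transcendental K x) (hgen : IntermediateField.adjoin K {x} = ⊤)
include hx hgen

theorem isFrac : @IsFractionRing K[X] _ F _ (aeval x : K[X] →ₐ[K] F).toRingHom.toAlgebra := by
  let _ : Algebra K[X] F := (aeval x : K[X] →ₐ[K] F).toRingHom.toAlgebra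
  have hinj : Function.Injective (algebraMap K[X] F) := by
    have := transcendental_iff_injective.1 hx
    exact this
  have : FaithfulSMul K[X] F := (faithfulSMul_iff_algebraMap_injective _ _).2 hinj
  refine IsFractionRing.of_field K[X] F fun z => ?_
  have hz : z ∈ IntermediateField.adjoin K {x} := by rw [hgen]; trivial
  obtain ⟨r, s, hrs⟩ := (IntermediateField.mem_adjoin_simple_iff K (α := x) z).1 hz
  exact ⟨r, s, hrs⟩

theorem IntX.minpoly_coeff {b : L} (hb : IntX K x b) (i : ℕ) :
    ∃ p : K[X], (minpoly F b).coeff i = aeval x p := by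
  let _ : Algebra K[X] F := (aeval x : K[X] →ₐ[K] F).toRingHom.toAlgebra
  let _ : Algebra K[X] L := ((algebraMap F L).comp (aeval x : K[X] →ₐ[K] F).toRingHom).toAlgebra
  have : IsScalarTower K[X] F L := IsScalarTower.of_algebraMap_eq fun _ => rfl
  have : IsFractionRing K[X] F := isFrac hx hgen
  have : Module.IsTorsionFree K[X] L := Module.IsTorsionFree.trans_faithfulSMul K[X] F L
  have h : IsIntegral K[X] b := hb
  have := minpoly.isIntegrallyClosed_eq_field_fractions' F h
  rw [this, coeff_map]
  exact ⟨_, rfl⟩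

theorem IntX.exists_mul [Algebra.IsAlgebraic F L] (b : L) :
    ∃ q : F, q ≠ 0 ∧ IntX K x (algebraMap F L q * b) := by
  let _ : Algebra K[X] F := (aeval x : K[X] →ₐ[K] F).toRingHom.toAlgebra
  let _ : Algebra K[X] L := ((algebraMap F L).comp (aeval x : K[X] →ₐ[K] F).toRingHom).toAlgebra
  have : IsScalarTower K[X] F L := IsScalarTower.of_algebraMap_eq fun _ => rfl
  have : IsFractionRing K[X] F := isFrac hx hgen
  have h1 : IsAlgebraic K[X] b := (IsFractionRing.isAlgebraic_iff K[X] F L).2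
    (Algebra.IsAlgebraic.isAlgebraic b)
  obtain ⟨y, hy0, hy⟩ := h1.exists_integral_multiple
  refine ⟨aeval x y, ?_, ?_⟩
  · intro h
    exact hy0 ((transcendental_iff.1 hx) _ h)
  · rw [Algebra.smul_def] at hy
    exact hy

theorem IntX.exists_inv [FiniteDimensional F L] {b : L} (hb : IntX K x b) :
    ∃ c : ℕ, ∀ E : ℕ, c ≤ E → IntX K x⁻¹ (algebraMap F L (x⁻¹ ^ E) * b) := by
  have hx0 : x ≠ 0 := by rintro rfl; exact hx (isAlgebraic_zero)
  choose p hp using IntX.minpoly_coeff hx hgen hb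
  set P := minpoly F b
  have hmon : P.Monic := minpoly.monic (IsIntegral.of_finite F b)
  refine ⟨(Finset.range P.natDegree).sup fun i => (p i).natDegree, fun E hE => ?_⟩
  refine IntX.of_monic (P := P.scaleRoots (x⁻¹ ^ E)) ((monic_scaleRoots_iff _).2 hmon)
    (scaleRoots_aeval_eq_zero (minpoly.aeval F b)) fun i => ?_
  rcases lt_trichotomy i P.natDegree with h | h | h
  · have hd : (p i).natDegree ≤ E := (Finset.le_sup (f := fun i => (p i).natDegree)
      (Finset.mem_range.2 h)).trans hE
    obtain ⟨m, hm⟩ : ∃ m, P.natDegree - i = m + 1 := ⟨P.natDegree - i - 1, by omega⟩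
    refine ⟨(∑ j ∈ Finset.range (E + 1), C ((p i).coeff j) * X ^ (E - j)) * X ^ (E * m), ?_⟩
    rw [coeff_scaleRoots, hm, hp, pow_succ', ← pow_mul, map_mul, map_sum]
    rw [aeval_eq_sum_range' (Nat.lt_succ_of_le hd)]
    rw [← mul_assoc, Finset.sum_mul]
    congr 1
    · refine Finset.sum_congr rfl fun j hj => ?_
      have hj' : j ≤ E := by have := Finset.mem_range.1 hj; omega
      rw [map_mul, aeval_C, map_pow, aeval_X, Algebra.smul_def]
      rw [mul_assoc]
      congr 1
      rw [inv_pow, inv_pow]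
      obtain ⟨k, rfl⟩ := Nat.exists_eq_add_of_le hj'
      rw [Nat.add_sub_cancel_left, pow_add]
      field_simp
    · simp
  · refine ⟨1, ?_⟩
    rw [h, coeff_scaleRoots_natDegree, hmon.leadingCoeff, map_one]
  · refine ⟨0, ?_⟩
    rw [coeff_scaleRoots, coeff_eq_zero_of_natDegree_lt h, zero_mul, map_zero]

end intx

end GST


set_option linter.unusedSectionVars false

namespace GST

universe u

open Polynomial

theorem VI.transcendental {K F Γ : Type*} [Field K] [Field F] [Algebra K F]
    [LinearOrderedCommGroupWithZero Γ] {v : Valuation F Γ} {x : F} (h : VI K v x) :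
    Transcendental K x := by
  rw [transcendental_iff]
  intro p hp
  by_contra h0
  obtain ⟨c, -, t, h1⟩ := h.poly h0
  rw [hp, map_zero] at h1
  exact not_lt_zero h1

theorem VI.inv {K F Γ : Type*} [Field K] [Field F] [Algebra K F]
    [LinearOrderedCommGroupWithZero Γ] {v : Valuation F Γ} {x : F} (h : VI K v x) :
    VI K v x⁻¹ :=
  ⟨inv_ne_zero h.1, fun t c hc h1 => by
    have := h.2 (-t) c hc (by rw [← h1, inv_zpow, zpow_neg])
    omega⟩

section slope

variable {K F L : Type*} [Field K] [Field F] [Algebra K F] [Field L] [Algebra F L]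
  [FiniteDimensional F L] {O : ValuationSubring F} {x : F}
  (hx : VI K O.valuation x) (hgen : IntermediateField.adjoin K {x} = ⊤)
include hx hgen

theorem exists_slope (g : O.ValueGroup) (hg : g ≠ 0) :
    ∃ c : K, c ≠ 0 ∧ ∃ s : ℤ, g = O.valuation (algebraMap K F c * x ^ s) := by
  obtain ⟨f, rfl⟩ := O.valuation_surjective g
  obtain ⟨c, hc, s, h⟩ := hx.approx (f := f) (by rw [hgen]; trivial) (by
    rintro rfl; exact hg (map_zero _))
  exact ⟨c, hc, s, (near_val h).symm⟩

theorem slope_bound [Normal F L] {b : L} (hb : b ≠ 0) {E : ℕ} (h1 : IntX K x b)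
    (h2 : IntX K x⁻¹ (algebraMap F L (x⁻¹ ^ E) * b)) :
    ∃ c : K, c ≠ 0 ∧ ∃ s : ℤ, sN O b = O.valuation (algebraMap K F c * x ^ s) ∧ 0 ≤ s ∧
      s ≤ (Module.finrank F L).factorial * E := by
  have hxi := hx.inv
  have hgeni : IntermediateField.adjoin K {x⁻¹} = ⊤ := by
    rw [eq_top_iff, ← hgen, IntermediateField.adjoin_simple_le_iff]
    have := inv_mem (IntermediateField.mem_adjoin_simple_self K x⁻¹)
    simpa using this
  obtain ⟨c, hc, s, hs⟩ := exists_slope hx hgen _ ((sN_norm O).ne hb)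
  refine ⟨c, hc, s, hs, ?_⟩
  obtain ⟨j, k, hk, hjk, hne, heq⟩ := spectral O b hb
  obtain ⟨p, hp⟩ := IntX.minpoly_coeff hx.transcendental hgen h1 j
  obtain ⟨q, hq⟩ := IntX.minpoly_coeff hxi.transcendental hgeni h2 j
  set P := minpoly F b with hP
  have hxE : x⁻¹ ^ E ≠ 0 := pow_ne_zero _ hxi.1
  have hscale : minpoly F (algebraMap F L (x⁻¹ ^ E) * b) = P.scaleRoots (x⁻¹ ^ E) := by
    symm
    have hmon : P.Monic := minpoly.monic (IsIntegral.of_finite F b)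
    refine eq_of_monic_of_dvd_of_natDegree_le (minpoly.monic (IsIntegral.of_finite F _))
      ((monic_scaleRoots_iff _).2 hmon)
      (minpoly.dvd _ _ (scaleRoots_aeval_eq_zero (minpoly.aeval F b))) ?_
    rw [natDegree_scaleRoots]
    have h6 := scaleRoots_aeval_eq_zero (r := (x⁻¹ ^ E)⁻¹)
      (minpoly.aeval F (algebraMap F L (x⁻¹ ^ E) * b))
    rw [← mul_assoc, ← map_mul, inv_mul_cancel₀ hxE, map_one, one_mul] at h6
    have h7 := natDegree_le_of_dvd (minpoly.dvd F b h6)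
      (scaleRoots_ne_zero (minpoly.ne_zero (IsIntegral.of_finite F _)) _)
    rwa [natDegree_scaleRoots] at h7
  rw [hscale, coeff_scaleRoots, show P.natDegree - j = k by omega] at hq
  have hp0 : p ≠ 0 := by rintro rfl; exact hne (by rw [hp, map_zero])
  have hq0 : q ≠ 0 := by
    rintro rfl
    rw [map_zero] at hq
    exact (mul_ne_zero hne (pow_ne_zero _ hxE)) hq
  obtain ⟨d, hd, t, ht⟩ := hx.poly hp0
  obtain ⟨e, he, r, hr⟩ := hxi.poly hq0
  have ht := near_val ht
  have hr := near_val hr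
  rw [← hp] at ht
  rw [← hq] at hr
  set M := (Module.finrank F L).factorial with hM
  have hM0 : 0 < M := Nat.factorial_pos _
  -- slope of the coefficient
  have e1 : (t : ℤ) = E * k - r := by
    refine hx.mono_inj hd he (s := t) (t := E * k - r) ?_
    rw [zpow_natCast, ht]
    have h3 : algebraMap K F e * x ^ ((E * k : ℤ) - r) = algebraMap K F e * x⁻¹ ^ r * x ^ (E * k) := by
      rw [zpow_sub₀ hx.1, inv_pow]
      norm_cast
      field_simp
    rw [h3, map_mul, hr, ← map_mul, mul_assoc]
    rw [inv_pow, inv_pow, ← pow_mul, inv_mul_cancel₀ (pow_ne_zero _ hx.1), mul_one]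
  have e2 : (t : ℤ) * M = s * k := by
    refine hx.mono_inj (pow_ne_zero M hd) (pow_ne_zero k hc) (s := t * M) (t := s * k) ?_
    rw [vpow_apply, hs, ← ht, ← map_pow, ← map_pow, mul_pow, mul_pow] at heq
    rw [map_pow, map_pow, zpow_mul, zpow_mul]
    exact_mod_cast heq
  have hk' : (0 : ℤ) < k := by exact_mod_cast hk
  have hM' : (0 : ℤ) < M := by exact_mod_cast hM0
  constructor
  · by_contra hneg
    push Not at hneg
    have : s * k < 0 := mul_neg_of_neg_of_pos hneg hk'
    have : (0 : ℤ) ≤ t * M := by positivity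
    omega
  · have h5 : s * k ≤ (M * E) * k := by
      rw [← e2, e1]
      have : (0 : ℤ) ≤ r := by positivity
      nlinarith
    exact le_of_mul_le_mul_right h5 hk'

end slope

end GST


set_option linter.unusedSectionVars false

namespace GST

universe u

open Polynomial

section

variable {K F L : Type*} [Field K] [Field F] [Algebra K F] [Field L] [Algebra F L]
  [FiniteDimensional F L] {O : ValuationSubring F} {x : F}
  (hx : VI K O.valuation x) (hgen : IntermediateField.adjoin K {x} = ⊤)
include hx hgen

theorem approx_mono {J : Type*} [Fintype J] {Z : J → L} (hZ : Orth F (sN O) Z)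
    (hsp : Spans F (sN O) Z) (e : J → K) (he : ∀ j, e j ≠ 0) (sl : J → ℤ)
    (hsl : ∀ j, sN O (Z j) = O.valuation (algebraMap K F (e j) * x ^ sl j))
    {b : L} (hb : b ≠ 0) {c : K} (hc : c ≠ 0) {s : ℤ}
    (hs : sN O b = O.valuation (algebraMap K F c * x ^ s)) :
    ∃ (a : J → K) (t : J → ℤ), sN O (b - ∑ j, (algebraMap K F (a j) * x ^ t j) • Z j) < sN O b ∧
      ∀ j, a j = 0 ∨ (Module.finrank F L).factorial * t j + sl j = s := by
  have hN := sN_norm (L := L) O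
  obtain ⟨f, hf⟩ := hsp b hb
  have hfe : sN O (∑ j, f j • Z j) = sN O b := hN.eq_of_sub_lt hf
  have key : ∀ j, ∃ (a : K) (t : ℤ), sN O (f j • Z j - (algebraMap K F a * x ^ t) • Z j) < sN O b ∧
      (a = 0 ∨ (Module.finrank F L).factorial * t + sl j = s) := by
    intro j
    have hle : sN O (f j • Z j) ≤ sN O b := by rw [← hfe]; exact hZ.2 f j
    rcases hle.lt_or_eq with h | h
    · exact ⟨0, 0, by simpa using h, Or.inl rfl⟩
    · have hf0 : f j ≠ 0 := by
        intro h0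
        rw [h0, zero_smul, hN.zero] at h
        exact hN.ne hb h.symm
      obtain ⟨d, hd, t, ht⟩ := hx.approx (f := f j) (by rw [hgen]; trivial) hf0
      refine ⟨d, t, ?_, Or.inr ?_⟩
      · rw [← sub_smul, ← h, hN.smul, hN.smul, vpow_apply, vpow_apply]
        exact mul_lt_mul_of_pos_right (pow_lt_pow_left₀ ht zero_le (Nat.factorial_ne_zero _))
          (hN.pos (hZ.1 j))
      · refine hx.mono_inj (mul_ne_zero (pow_ne_zero (Module.finrank F L).factorial hd) (he j)) hc ?_
        rw [← hs, ← h, hN.smul, vpow_apply, hsl, ← near_val ht, ← map_pow, ← map_mul]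
        congr 1
        rw [zpow_add₀ hx.1, mul_comm ((Module.finrank F L).factorial : ℤ), zpow_mul, map_mul, map_pow]
        rw [zpow_natCast, mul_pow]
        ring
  choose a t h1 h2 using key
  refine ⟨a, t, ?_, h2⟩
  have : b - ∑ j, (algebraMap K F (a j) * x ^ t j) • Z j = (b - ∑ j, f j • Z j) +
      ∑ j, (f j • Z j - (algebraMap K F (a j) * x ^ t j) • Z j) := by
    rw [Finset.sum_sub_distrib]; abel
  rw [this]
  exact hN.add_lt hf (hN.sum_lt (hN.ne hb) fun j _ => h1 j)

end

theorem exists_fam {K F L : Type u} [Field K] [IsAlgClosed K] [Field F] [Algebra K F] [Field L]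
    [Algebra F L] [Algebra K L] [IsScalarTower K F L] [FiniteDimensional F L] [Normal F L]
    {O : ValuationSubring F} {x : F}
    (hx : VI K O.valuation x) (hgen : IntermediateField.adjoin K {x} = ⊤) :
    ∃ c : ℕ, ∀ D : ℕ, ∃ u : Fin ((D + 1) * Module.finrank F L) → L, Orth K (sN O) u ∧
      ∀ k, IntX K x (u k) ∧ IntX K x⁻¹ (algebraMap F L (x⁻¹ ^ (D + c)) * u k) := by
  classical
  have hxt := hx.transcendental
  let l0 := Module.finBasis F L
  choose q hq0 hq using fun i => IntX.exists_mul hxt hgen (l0 i)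
  let lb := l0.isUnitSMul (w := q) fun i => IsUnit.mk0 _ (hq0 i)
  have hlb : ∀ i, IntX K x (lb i) := fun i => by
    rw [Module.Basis.isUnitSMul_apply, Algebra.smul_def]; exact hq i
  choose ci hci using fun i => IntX.exists_inv hxt hgen (hlb i)
  set c := Finset.univ.sup ci with hcdef
  have hci' : ∀ i, IntX K x⁻¹ (algebraMap F L (x⁻¹ ^ c) * lb i) := fun i =>
    hci i c (Finset.le_sup (Finset.mem_univ i))
  refine ⟨c, fun D => ?_⟩
  have hpow : LinearIndependent K (fun t : Fin (D + 1) => x ^ (t : ℕ)) := by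
    have h1 : LinearIndependent K (fun t : ℕ => x ^ t) := by
      rw [linearIndependent_iff']
      intro s g h i hi
      have h3 : aeval x (∑ i ∈ s, C (g i) * X ^ i) = 0 := by
        rw [map_sum, ← h]
        refine Finset.sum_congr rfl fun i _ => ?_
        simp [Algebra.smul_def]
      have h4 := transcendental_iff.1 hxt _ h3
      have h5 := congrArg (fun p => p.coeff i) h4
      simpa [Polynomial.coeff_X_pow, hi] using h5
    exact h1.comp (fun t : Fin (D + 1) => (t : ℕ)) Fin.val_injective
  have hli := linearIndependent_smul hpow lb.linearIndependent
  have hli2 := hli.comp _ (finProdFinEquiv (m := D + 1) (n := Module.finrank F L)).symm.injective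
  obtain ⟨u, hu, humem⟩ := exists_orth_basis (K := K) (v := (vpow F L O).comap (algebraMap K F))
    (w := cw O) (fun W e => by
      rw [IsScalarTower.algebraMap_apply K F L]; exact cw_algebraMap O W (algebraMap K F e)) (x := algebraMap F L x)
    (fun W => ⟨by simpa using hx.1, fun t k hk h => by
      refine hx.2 t k hk ?_
      rw [← map_zpow₀, IsScalarTower.algebraMap_apply K F L, cw_algebraMap, cw_algebraMap,
        vpow_apply, vpow_apply] at h
      exact (pow_left_inj₀ zero_le zero_le (Nat.factorial_ne_zero _)).1 h⟩)
    (fun y => by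
      have hy : IsAlgebraic F y := Algebra.IsAlgebraic.isAlgebraic y
      obtain ⟨p, hp0, hp⟩ := hy
      have hmem : ∀ f : F, algebraMap F L f ∈ IntermediateField.adjoin K {algebraMap F L x} := by
        intro f
        have hf : f ∈ IntermediateField.adjoin K {x} := by rw [hgen]; trivial
        have := (IntermediateField.adjoin_simple_le_iff (K := (IntermediateField.adjoin K
          {algebraMap F L x}).comap (IsScalarTower.toAlgHom K F L)) (α := x)).2 (by
            exact IntermediateField.mem_adjoin_simple_self K _) hf
        exact this
      let g : F →+* IntermediateField.adjoin K {algebraMap F L x} :=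
        (algebraMap F L).codRestrict (IntermediateField.adjoin K {algebraMap F L x}) hmem
      refine ⟨p.map g, (Polynomial.map_ne_zero_iff g.injective).2 hp0, ?_⟩
      rw [aeval_def, eval₂_map]
      exact hp)
    _ hli2
  change Orth K (sN O) u at hu
  -- integrality
  have hint : ∀ k, IntX K x (u k) ∧ IntX K x⁻¹ (algebraMap F L (x⁻¹ ^ (D + c)) * u k) := by
    intro k
    have hk := humem k
    generalize u k = y at hk
    induction hk using Submodule.span_induction with
    | mem y hy =>
      obtain ⟨i, rfl⟩ := hy
      simp only [Function.comp]
      generalize (finProdFinEquiv (m := D + 1) (n := Module.finrank F L)).symm i = p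
      obtain ⟨t, i⟩ := p
      have ht : (t : ℕ) ≤ D := by omega
      simp only [Algebra.smul_def]
      constructor
      · refine IntX.mul ?_ (hlb i)
        simpa using IntX.poly (K := K) (x := x) (L := L) (X ^ (t : ℕ))
      · have h1 := (IntX.poly (K := K) (x := x⁻¹) (L := L) (X ^ (D - (t : ℕ)))).mul (hci' i)
        convert h1 using 1
        rw [← mul_assoc, ← mul_assoc, ← map_mul, ← map_mul]
        congr 2
        rw [map_pow, aeval_X, inv_pow, inv_pow, inv_pow]
        have := hx.1
        obtain ⟨m, hm⟩ := Nat.exists_eq_add_of_le ht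
        rw [show D - (t : ℕ) = m by omega, show D + c = t + m + c by omega, pow_add, pow_add]
        field_simp
    | zero => simpa using ⟨IntX.zero, IntX.zero⟩
    | add y z _ _ hy hz => rw [mul_add]; exact ⟨hy.1.add hz.1, hy.2.add hz.2⟩
    | smul a y _ hy =>
      have h0 : ∀ z : F, IntX K z (algebraMap K L a) := fun z => by
        simpa [← IsScalarTower.algebraMap_apply] using IntX.poly (K := K) (x := z) (L := L) (C a)
      rw [Algebra.smul_def, mul_left_comm]
      exact ⟨(h0 _).mul hy.1, (h0 _).mul hy.2⟩
  exact ⟨u, hu, hint⟩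

theorem card_bound {K F L : Type u} [Field K] [IsAlgClosed K] [Field F] [Algebra K F] [Field L]
    [Algebra F L] [Algebra K L] [IsScalarTower K F L] [FiniteDimensional F L] [Normal F L]
    {O : ValuationSubring F} {x : F}
    (hx : VI K O.valuation x) (hgen : IntermediateField.adjoin K {x} = ⊤)
    {J : Type*} [Fintype J] {Z : J → L} (hZ : Orth F (sN O) Z) (hZs : Spans F (sN O) Z) :
    Module.finrank F L ≤ Fintype.card J := by
  classical
  have hN := sN_norm (L := L) O
  have hNK : ENorm ((vpow F L O).comap (algebraMap K F)) (sN O : L → O.ValueGroup) :=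
    ENorm.sup fun W e => by
      rw [IsScalarTower.algebraMap_apply K F L]; exact cw_algebraMap O W (algebraMap K F e)
  choose e he sl hsl using fun j => exists_slope hx hgen _ (hN.ne (hZ.1 j))
  obtain ⟨c, hfam⟩ := exists_fam (L := L) hx hgen
  set n := Module.finrank F L with hn
  set M := n.factorial with hM
  have hM0 : (0 : ℤ) < M := by exact_mod_cast Nat.factorial_pos _
  set C0 := Finset.univ.sup (fun j => (sl j).natAbs) with hC0
  have hC0' : ∀ j, ((sl j).natAbs : ℤ) ≤ C0 := fun j => by
    exact_mod_cast Finset.le_sup (f := fun j => (sl j).natAbs) (Finset.mem_univ j)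
  have main : ∀ D : ℕ, (D + 1) * n ≤ Fintype.card J * (D + 2 * (c + C0) + 1) := by
    intro D
    obtain ⟨u, hu, hint⟩ := hfam D
    choose cu hcu su hsu hs0 hs1 using fun k =>
      slope_bound (O := O) hx hgen (hu.1 k) (hint k).1 (hint k).2
    choose a t hat hat2 using fun k =>
      approx_mono hx hgen hZ hZs e he sl hsl (hu.1 k) (hcu k) (hsu k)
    have hu' := hu.perturb hNK hat
    have hindep := hu'.linearIndependent hNK
    have hfr := finrank_span_eq_card hindep
    set I := Finset.Icc (-(c + C0 : ℕ) : ℤ) (D + (c + C0 : ℕ)) with hI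
    have hle : Submodule.span K (Set.range fun k => ∑ j, (algebraMap K F (a k j) * x ^ t k j) • Z j)
        ≤ Submodule.span K (Set.range fun p : J × I => x ^ (p.2 : ℤ) • Z p.1) := by
      rw [Submodule.span_le]
      rintro _ ⟨k, rfl⟩
      refine Submodule.sum_mem _ fun j _ => ?_
      rcases hat2 k j with h | h
      · rw [h, map_zero, zero_mul, zero_smul]; exact zero_mem _
      · have htI : t k j ∈ I := by
          have h1 := hs0 k
          have h2 := hs1 k
          have h3 := hC0' j
          have h4 : -(C0 : ℤ) ≤ sl j ∧ sl j ≤ C0 := by omega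
          rw [hI, Finset.mem_Icc]
          push_cast
          rw [← hn, ← hM] at h h2
          have hM1 : (1 : ℤ) ≤ M := hM0
          have hC00 : (0 : ℤ) ≤ C0 := by positivity
          have hc00 : (0 : ℤ) ≤ c := by positivity
          push_cast at h2
          constructor
          · by_contra hlt
            push Not at hlt
            have : (M : ℤ) * t k j ≤ M * (-(c + C0) - 1) :=
              mul_le_mul_of_nonneg_left (by omega) hM0.le
            nlinarith
          · by_contra hlt
            push Not at hlt
            have : (M : ℤ) * (D + (c + C0) + 1) ≤ M * t k j :=
              mul_le_mul_of_nonneg_left (by omega) hM0.le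
            nlinarith
        rw [mul_smul, algebraMap_smul]
        exact Submodule.smul_mem _ _ (Submodule.subset_span ⟨(j, ⟨_, htI⟩), rfl⟩)
    have := FiniteDimensional.span_of_finite K
      (Set.finite_range fun p : J × I => x ^ (p.2 : ℤ) • Z p.1)
    have h1 := Submodule.finrank_mono hle
    rw [hfr] at h1
    have h2 := h1.trans (finrank_range_le_card (R := K) fun p : J × I => x ^ (p.2 : ℤ) • Z p.1)
    rw [Fintype.card_fin, Fintype.card_prod, Fintype.card_coe, hI, Int.card_Icc] at h2
    refine h2.trans (Nat.mul_le_mul_left _ ?_)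
    omega
  by_contra hlt
  push Not at hlt
  set r := Fintype.card J
  have h := main (r * (2 * (c + C0) + 1))
  have : (r * (2 * (c + C0) + 1) + 1) * (r + 1) ≤ (r * (2 * (c + C0) + 1) + 1) * n :=
    Nat.mul_le_mul_left _ hlt
  nlinarith

theorem C5_normal {K F L : Type u} [Field K] [IsAlgClosed K] [Field F] [Algebra K F] [Field L]
    [Algebra F L] [FiniteDimensional F L] [Normal F L] {O : ValuationSubring F} {x : F}
    (hx : VI K O.valuation x) (hgen : IntermediateField.adjoin K {x} = ⊤) : Good L O := by
  classical
  let _ : Algebra K L := ((algebraMap F L).comp (algebraMap K F)).toAlgebra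
  have : IsScalarTower K F L := IsScalarTower.of_algebraMap_eq fun _ => rfl
  choose Z0 hZ0 hZ0s using fun W : allX L O => rk_spec (E := F) W.1
  obtain ⟨Z, hZ, hZs⟩ := (Ext.fam (s := allX L O) fun W hW => mem_allX.1 hW).joint Z0
    (fun W => (orth_cv (mem_allX.1 W.2) _).2 (hZ0 W))
  have hZs := hZs fun W => (spans_cv (mem_allX.1 W.2) _).2 (hZ0s W)
  change Orth F (sN O) Z at hZ
  change Spans F (sN O) Z at hZs
  have hcard := card_bound hx hgen hZ hZs
  refine Good.of_finset (s := allX L O) (fun W hW => mem_allX.1 hW) (hcard.trans (le_of_eq ?_))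
  rw [Fintype.card_sigma]
  simp only [Fintype.card_fin]
  exact Finset.sum_coe_sort (allX L O) (fun W => rk F W)

theorem C5 {K F L : Type u} [Field K] [IsAlgClosed K] [Field F] [Algebra K F] [Field L]
    [Algebra F L] [FiniteDimensional F L] {O : ValuationSubring F} {x : F}
    (hx : VI K O.valuation x) (hgen : IntermediateField.adjoin K {x} = ⊤) : Good L O := by
  let L' := IntermediateField.normalClosure F L (AlgebraicClosure L)
  have : FiniteDimensional F L' := normalClosure.is_finiteDimensional F L _
  have h : Good L' O := C5_normal hx hgen
  have : FiniteDimensional L L' := FiniteDimensional.right F L L'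
  exact (Good.down L h).1

end GST

set_option linter.unusedSectionVars false
namespace GST
universe u

theorem comap_le_iff' {L M : Type*} [Field L] [Field M] (j : L →+* M) (W : ValuationSubring M) (a b : L) :
    (W.comap j).valuation a ≤ (W.comap j).valuation b ↔ W.valuation (j a) ≤ W.valuation (j b) := by
  let _ : Algebra L M := j.toAlgebra
  exact comap_val_le_iff W a b

theorem descent {Fa La : Type u} [Field Fa] [Field La] [Algebra Fa La] [FiniteDimensional Fa La]
    {Oa : ValuationSubring Fa} (h : Good La Oa) : ∃ T : Finset La,
    ∀ (F' L' : Type u) [Field F'] [Field L'] [Algebra F' L'] [FiniteDimensional F' L']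
      (i : F' →+* Fa) (j : L' →+* La) (_ : ∀ a, j (algebraMap F' L' a) = algebraMap Fa La (i a))
      (_ : ∀ t ∈ T, ∃ z, j z = t) (_ : Module.finrank F' L' ≤ Module.finrank Fa La),
      Good L' (Oa.comap i) := by
  classical
  set s := (ext_finite Fa La Oa).toFinset with hs
  choose Z hZ _ using fun W : ValuationSubring La => rk_spec (E := Fa) W
  have hsep : ∀ W W' : ValuationSubring La, ∃ d : La, W ≠ W' → ¬ (d ∈ W ↔ d ∈ W') := by
    intro W W'
    by_cases hW : W = W'
    · exact ⟨0, fun h => absurd hW h⟩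
    · by_contra! hc
      exact hW (SetLike.ext fun d => (hc d).2)
  choose d hd using hsep
  refine ⟨s.biUnion (fun W => Finset.univ.image (Z W)) ∪ Finset.image₂ d s s, ?_⟩
  intro F' L' _ _ _ _ i j hij hT hf
  have hinj : Set.InjOn (fun W : ValuationSubring La => W.comap j) s := by
    intro W hW W' hW' hWW
    by_contra hne
    obtain ⟨z, hz⟩ := hT (d W W') (Finset.mem_union_right _ (Finset.mem_image₂_of_mem hW hW'))
    refine hd W W' hne ?_
    have : z ∈ W.comap j ↔ z ∈ W'.comap j := by
      have hWW : W.comap j = W'.comap j := hWW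
      rw [hWW]
    rw [← hz]
    exact this
  refine Good.of_finset (s := s.image fun W => W.comap j) ?_ ?_
  · intro V hV
    obtain ⟨W, hW, rfl⟩ := Finset.mem_image.1 hV
    have hW : W.comap (algebraMap Fa La) = Oa := (ext_finite Fa La Oa).mem_toFinset.1 hW
    change (W.comap j).comap (algebraMap F' L') = _
    ext a
    rw [← hW]
    change j (algebraMap F' L' a) ∈ W ↔ algebraMap Fa La (i a) ∈ W
    rw [hij]
  · rw [Finset.sum_image hinj]
    refine hf.trans ?_
    have h1 : dg La Oa = Module.finrank Fa La := h
    rw [← h1, dg_eq]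
    refine Finset.sum_le_sum fun W hW => ?_
    choose z hz using fun k => hT (Z W k) (Finset.mem_union_left _
      (Finset.mem_biUnion.2 ⟨W, hW, Finset.mem_image_of_mem _ (Finset.mem_univ k)⟩))
    have : Orth F' (W.comap j).valuation z := by
      refine ⟨fun k hk => (hZ W).1 k (by rw [← hz, hk, map_zero]), fun c k => ?_⟩
      rw [comap_le_iff']
      have := (hZ W).2 (fun l => i (c l)) k
      simpa only [map_sum, Algebra.smul_def, map_mul, hij, hz] using this
    simpa using le_rk this

end GST

set_option linter.unusedSectionVars false
namespace GST
universe u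

theorem comap_eq_iff' {L M : Type*} [Field L] [Field M] (j : L →+* M) (W : ValuationSubring M) (a b : L) :
    (W.comap j).valuation a = (W.comap j).valuation b ↔ W.valuation (j a) = W.valuation (j b) := by
  rw [le_antisymm_iff, le_antisymm_iff, comap_le_iff', comap_le_iff']

theorem VI.comap_iff {K L M : Type*} [Field K] [Field L] [Field M] [Algebra K L] [Algebra K M]
    (j : L →+* M) (hj : ∀ c, j (algebraMap K L c) = algebraMap K M c) (W : ValuationSubring M)
    {x : L} : VI K (W.comap j).valuation x ↔ VI K W.valuation (j x) := by
  simp only [VI, comap_eq_iff', hj]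
  simp only [map_zpow₀]
  simp

theorem VI.algebraic {K K' Λ Γ : Type*} [Field K] [Field K'] [Field Λ] [Algebra K K'] [Algebra K' Λ]
    [Algebra K Λ] [IsScalarTower K K' Λ] [LinearOrderedCommGroupWithZero Γ] {v : Valuation Λ Γ}
    [Algebra.IsAlgebraic K K'] {x : Λ} (h : VI K v x) : VI K' v x := by
  refine ⟨h.1, fun t c hc ht => ?_⟩
  obtain ⟨k, hk, -, c0, hc0, he⟩ := exists_tor (E := K) (v.comap (algebraMap K' Λ)) hc
    (Algebra.IsAlgebraic.isAlgebraic c).isIntegral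
  have := h.2 (t * k) c0 hc0 (by
    rw [zpow_mul, zpow_natCast, map_pow, ht]
    rw [IsScalarTower.algebraMap_apply K K' Λ]
    exact he)
  simpa [hk] using this

theorem orth_lift {K K' F F' Γ ι : Type*} [Field K] [Field K'] [Field F] [Field F'] [Algebra K K']
    [Algebra K F] [Algebra K F'] [Algebra K' F'] [Algebra F F'] [IsScalarTower K K' F']
    [IsScalarTower K F F'] [LinearOrderedCommGroupWithZero Γ] [Fintype ι] {v : Valuation F' Γ}
    {x : F} (hgen : IntermediateField.adjoin K {x} = ⊤) (hx : VI K' v (algebraMap F F' x))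
    {Z : ι → K'} (hZ : Orth K (v.comap (algebraMap K' F')) Z) :
    Orth F v (fun i => algebraMap K' F' (Z i)) := by
  classical
  have hx0 : VI K (v.comap (algebraMap F F')) x := by
    refine ⟨fun h => hx.1 (by simp [h]), fun t c hc ht => ?_⟩
    refine hx.2 t (algebraMap K K' c) (by simpa using hc) ?_
    rw [← IsScalarTower.algebraMap_apply, IsScalarTower.algebraMap_apply K F F', ← map_zpow₀]
    exact ht
  refine ⟨fun j => by simpa using hZ.1 j, fun c j => ?_⟩
  obtain ⟨i0, -, hi0⟩ := Finset.exists_max_image Finset.univ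
    (fun i => v (c i • algebraMap K' F' (Z i))) ⟨j, Finset.mem_univ j⟩
  refine (hi0 j (Finset.mem_univ _)).trans ?_
  by_contra! hlt
  set B := v (c i0 • algebraMap K' F' (Z i0)) with hB
  have hB0 : B ≠ 0 := (zero_le.trans_lt hlt).ne'
  have key : ∀ i, v (c i • algebraMap K' F' (Z i)) = B → ∃ a : K, a ≠ 0 ∧ ∃ t : ℤ,
      v (algebraMap F F' (c i - algebraMap K F a * x ^ t)) < v (algebraMap F F' (c i)) ∧
      v (algebraMap K' F' (algebraMap K K' a * Z i) * algebraMap F F' x ^ t) = B := by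
    intro i hi
    have hc : c i ≠ 0 := by
      rintro h; rw [h, zero_smul, map_zero] at hi; exact hB0 hi.symm
    obtain ⟨a, ha, t, h⟩ := hx0.approx (f := c i) (by rw [hgen]; trivial) hc
    refine ⟨a, ha, t, h, ?_⟩
    have h2 := near_val h
    simp only [Valuation.comap_apply, map_mul, map_zpow₀] at h2
    rw [← hi, Algebra.smul_def, map_mul v (algebraMap F F' (c i)), ← h2]
    simp only [map_mul, map_zpow₀, ← IsScalarTower.algebraMap_apply]
    rw [mul_right_comm]
  obtain ⟨a0, ha0, t, -, ht⟩ := key i0 rfl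
  have key2 : ∀ i, ∃ a : K, v (c i • algebraMap K' F' (Z i) -
      algebraMap K' F' (a • Z i) * algebraMap F F' x ^ t) < B ∧
      (i = i0 → v (algebraMap K' F' (a • Z i) * algebraMap F F' x ^ t) = B) := by
    intro i
    rcases (hi0 i (Finset.mem_univ _)).lt_or_eq with h | h
    · exact ⟨0, by simpa using h, by rintro rfl; exact absurd rfl h.ne⟩
    · obtain ⟨a, ha, s, h1, h2⟩ := key i h
      have hst : s = t := by
        refine hx.mono_inj (c := algebraMap K K' a * Z i) (d := algebraMap K K' a0 * Z i0)
          (mul_ne_zero (by simpa using ha) (hZ.1 i)) (mul_ne_zero (by simpa using ha0) (hZ.1 i0)) ?_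
        rw [h2, ht]
      subst hst
      refine ⟨a, ?_, fun _ => by rw [Algebra.smul_def]; exact h2⟩
      have : c i • algebraMap K' F' (Z i) - algebraMap K' F' (a • Z i) * algebraMap F F' x ^ s =
          algebraMap F F' (c i - algebraMap K F a * x ^ s) * algebraMap K' F' (Z i) := by
        simp only [Algebra.smul_def, map_sub, map_mul, map_zpow₀, ← IsScalarTower.algebraMap_apply]
        ring
      rw [this, map_mul, ← h, Algebra.smul_def, map_mul]
      exact mul_lt_mul_of_pos_right h1 (zero_lt_iff.2 (v.ne_zero_iff.2 (by simpa using hZ.1 i)))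
  choose a h1 h2 using key2
  have h3 := hZ.2 a i0
  simp only [Valuation.comap_apply] at h3
  have h4 : B ≤ v (∑ i, algebraMap K' F' (a i • Z i) * algebraMap F F' x ^ t) := by
    rw [← h2 i0 rfl, ← Finset.sum_mul, map_mul, map_mul, ← map_sum]
    exact mul_le_mul_left h3 _
  refine h4.not_gt ?_
  have : ∑ i, algebraMap K' F' (a i • Z i) * algebraMap F F' x ^ t = ∑ i, c i • algebraMap K' F' (Z i) -
    ∑ i, (c i • algebraMap K' F' (Z i) - algebraMap K' F' (a i • Z i) * algebraMap F F' x ^ t) := by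
    rw [Finset.sum_sub_distrib]; abel
  rw [this]
  refine (v.map_sub _ _).trans_lt (max_lt hlt (v.map_sum_lt hB0 fun i _ => h1 i))

theorem Ext.comap_mem {E L M : Type*} [Field E] [Field L] [Field M] [Algebra E L] [Algebra E M]
    {O : ValuationSubring E} {W : ValuationSubring M} (hW : W ∈ Ext E M O) (j : L →+* M)
    (hj : ∀ c, j (algebraMap E L c) = algebraMap E M c) : W.comap j ∈ Ext E L O := by
  change (W.comap j).comap _ = O
  have hW : W.comap _ = O := hW
  rw [← hW, ValuationSubring.comap_comap]
  congr 1
  ext c; exact hj c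

end GST

set_option linter.unusedSectionVars false
namespace GST
universe u
open Polynomial

theorem lift_sigma {K F : Type*} [Field K] [Field F] [Algebra K F] {x : F} (hx : Transcendental K x)
    (hgen : IntermediateField.adjoin K {x} = ⊤) (σ : K ≃+* K) :
    ∃ τ : F ≃+* F, (∀ c, τ (algebraMap K F c) = algebraMap K F (σ c)) ∧ τ x = x := by
  let _ : Algebra K[X] F := (aeval x : K[X] →ₐ[K] F).toRingHom.toAlgebra
  have hfr : IsFractionRing K[X] F := isFrac hx hgen
  have ha : ∀ p : K[X], algebraMap K[X] F p = aeval x p := fun p => rfl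
  refine ⟨IsFractionRing.ringEquivOfRingEquiv (Polynomial.mapEquiv σ), fun c => ?_, ?_⟩
  · have := IsFractionRing.ringEquivOfRingEquiv_algebraMap (K := F) (L := F) (Polynomial.mapEquiv σ) (C c)
    simpa [ha] using this
  · have := IsFractionRing.ringEquivOfRingEquiv_algebraMap (K := F) (L := F) (Polynomial.mapEquiv σ) X
    simpa [ha] using this

theorem good_lift {K K' F F' : Type u} [Field K] [Field K'] [Field F] [Field F'] [Algebra K K']
    [Algebra K F] [Algebra K F'] [Algebra K' F'] [Algebra F F'] [IsScalarTower K K' F']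
    [IsScalarTower K F F'] [FiniteDimensional K K'] [Normal K K'] [FiniteDimensional F F']
    (hfin : Module.finrank F F' ≤ Module.finrank K K') {O : ValuationSubring F} {x : F}
    (hgen : IntermediateField.adjoin K {x} = ⊤)
    (hgen' : IntermediateField.adjoin K' {algebraMap F F' x} = ⊤)
    (hx : VI K O.valuation x) {W : ValuationSubring F'} (hW : W ∈ Ext F F' O)
    (hg : Good K' (O.comap (algebraMap K F))) : Good F' O := by
  classical
  have hVI : ∀ U ∈ Ext F F' O, VI K' U.valuation (algebraMap F F' x) := by
    intro U hU
    have hU : U.comap (algebraMap F F') = O := hU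
    refine VI.algebraic (K := K) ?_
    refine (VI.comap_iff (algebraMap F F') (fun c => (IsScalarTower.algebraMap_apply K F F' c).symm) U).1 ?_
    rw [hU]; exact hx
  have hext : ∀ U ∈ Ext F F' O, U.comap (algebraMap K' F') ∈ Ext K K' (O.comap (algebraMap K F)) := by
    intro U hU
    have hU : U.comap (algebraMap F F') = O := hU
    change (U.comap (algebraMap K' F')).comap _ = _
    rw [← hU, ValuationSubring.comap_comap, ValuationSubring.comap_comap,
      ← IsScalarTower.algebraMap_eq, ← IsScalarTower.algebraMap_eq]
  have key : ∀ V ∈ Ext K K' (O.comap (algebraMap K F)), ∃ U ∈ Ext F F' O,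
      U.comap (algebraMap K' F') = V := by
    intro V hV
    obtain ⟨σ, hσ⟩ := Ext.conj (hext W hW) hV
    obtain ⟨τ, h1, h2⟩ := lift_sigma (hVI W hW).transcendental hgen' σ.toRingEquiv
    refine ⟨W.comap (τ : F' →+* F'), ?_, ?_⟩
    · have hF : ∀ f : F, τ (algebraMap F F' f) = algebraMap F F' f := by
        intro f
        have hf : f ∈ IntermediateField.adjoin K {x} := by rw [hgen]; trivial
        induction hf using IntermediateField.adjoin_induction with
        | mem y hy => rw [Set.mem_singleton_iff.1 hy]; exact h2
        | algebraMap c =>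
          rw [← IsScalarTower.algebraMap_apply, IsScalarTower.algebraMap_apply K K' F', h1]
          congr 1
          exact σ.commutes c
        | add a b _ _ ha hb => rw [map_add, map_add, ha, hb]
        | mul a b _ _ ha hb => rw [map_mul, map_mul, ha, hb]
        | inv a _ ha => rw [map_inv₀, map_inv₀, ha]
      exact Ext.comap_mem hW _ hF
    · rw [hσ]
      ext c
      change τ (algebraMap K' F' c) ∈ W ↔ algebraMap K' F' (σ c) ∈ W
      rw [h1]; rfl
  have hg' : dg K' (O.comap (algebraMap K F)) = Module.finrank K K' := hg
  rw [dg_eq] at hg'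
  set s := (ext_finite K K' (O.comap (algebraMap K F))).toFinset with hs
  choose! U hU1 hU2 using key
  have hmem : ∀ V, V ∈ s ↔ V ∈ Ext K K' (O.comap (algebraMap K F)) := fun V =>
    (ext_finite K K' (O.comap (algebraMap K F))).mem_toFinset
  refine Good.of_finset (s := s.image U) ?_ ?_
  · intro V hV
    obtain ⟨V', hV', rfl⟩ := Finset.mem_image.1 hV
    exact hU1 V' ((hmem _).1 hV')
  · rw [Finset.sum_image]
    · refine (hfin.trans hg'.ge).trans (Finset.sum_le_sum fun V hV => ?_)
      have hV := (hmem _).1 hV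
      refine (congrArg (rk K) (hU2 V hV)).ge.trans ?_
      obtain ⟨Z, hZ, -⟩ := rk_spec (E := K) ((U V).comap (algebraMap K' F'))
      rw [orth_comap] at hZ
      simpa using le_rk (orth_lift hgen (hVI _ (hU1 V hV)) hZ)
    · intro V hV V' hV' h
      rw [← hU2 V ((hmem _).1 hV), ← hU2 V' ((hmem _).1 hV'), h]

end GST

set_option linter.unusedSectionVars false
namespace GST
universe u
open Polynomial IntermediateField

theorem adj_top {K F Ω : Type*} [Field K] [Field F] [Field Ω] [Algebra K F] [Algebra F Ω]
    [Algebra K Ω] [IsScalarTower K F Ω] {x : F} (hgen : adjoin K {x} = ⊤) (A : IntermediateField K Ω)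
    [Algebra A (adjoin F (A : Set Ω))]
    (hA : ∀ a : A, ((algebraMap A (adjoin F (A : Set Ω)) a : adjoin F (A : Set Ω)) : Ω) = a) :
    adjoin A {algebraMap F (adjoin F (A : Set Ω)) x} = ⊤ := by
  rw [eq_top_iff]
  rintro ⟨z, hz⟩ -
  induction hz using adjoin_induction with
  | mem y hy =>
    convert IntermediateField.algebraMap_mem (adjoin A {algebraMap F (adjoin F (A : Set Ω)) x}) (⟨y, hy⟩ : A) using 1
    exact Subtype.ext (hA ⟨y, hy⟩).symm
  | algebraMap f =>
    change algebraMap F (adjoin F (A : Set Ω)) f ∈ _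
    have hf : f ∈ adjoin K {x} := by rw [hgen]; trivial
    induction hf using adjoin_induction with
    | mem y hy => rw [Set.mem_singleton_iff.1 hy]; exact mem_adjoin_simple_self _ _
    | algebraMap c =>
      convert IntermediateField.algebraMap_mem (adjoin A {algebraMap F (adjoin F (A : Set Ω)) x}) (algebraMap K A c) using 1
      refine Subtype.ext ((hA _).trans ?_).symm
      exact IsScalarTower.algebraMap_apply K F Ω c
    | add a b _ _ ha hb => rw [map_add]; exact add_mem ha hb
    | mul a b _ _ ha hb => rw [map_mul]; exact mul_mem ha hb
    | inv a _ ha => rw [map_inv₀]; exact inv_mem ha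
  | add a b _ _ ha hb => exact add_mem ha hb
  | mul a b _ _ ha hb => exact mul_mem ha hb
  | inv a _ ha => exact inv_mem ha

theorem fin_adj {F Ω : Type*} [Field F] [Field Ω] [Algebra F Ω] {A B : Set Ω} (T : Finset Ω)
    (h : ∀ t ∈ T, t ∈ adjoin F (A ∪ B)) :
    ∃ S : Finset Ω, (S : Set Ω) ⊆ A ∧ ∀ t ∈ T, t ∈ adjoin F ((S : Set Ω) ∪ B) := by
  classical
  have key : ∀ t : Ω, ∃ S : Finset Ω, t ∈ T → (S : Set Ω) ⊆ A ∧ t ∈ adjoin F ((S : Set Ω) ∪ B) := by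
    intro t
    by_cases ht : t ∈ T
    · obtain ⟨S, hS, hS'⟩ := exists_finset_of_mem_adjoin (h t ht)
      refine ⟨S.filter (· ∈ A), fun _ => ⟨fun s hs => (Finset.mem_filter.1 hs).2, ?_⟩⟩
      refine adjoin.mono _ _ _ ?_ hS'
      intro s hs
      rcases hS hs with h | h
      · exact Or.inl (by simpa using ⟨hs, h⟩)
      · exact Or.inr h
    · exact ⟨∅, fun h => absurd h ht⟩
  choose S hS using key
  refine ⟨T.biUnion S, ?_, fun t ht => adjoin.mono _ _ _ ?_ (hS t ht).2⟩
  · intro s hs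
    obtain ⟨t, ht, hs⟩ := Finset.mem_biUnion.1 (Finset.mem_coe.1 hs)
    exact (hS t ht).1 hs
  · exact Set.union_subset_union_left _ (Finset.coe_subset.2 (Finset.subset_biUnion_of_mem S ht))

theorem finrank_adj {F Ω ι : Type*} [Field F] [Field Ω] [Algebra F Ω] (L : IntermediateField F Ω)
    [Algebra.IsAlgebraic F Ω]
    (F' : IntermediateField F Ω) {n : ℕ} (e : Fin n → Ω) (b : ι → L) (hb : ⊤ ≤ Submodule.span F (Set.range b))
    (h : ∀ i, (b i : Ω) ∈ Submodule.span F' (Set.range e)) :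
    Module.finrank F' (adjoin F' (L : Set Ω)) ≤ n := by
  have h1 : (adjoin F' (L : Set Ω)).toSubalgebra.toSubmodule ≤ Submodule.span F' (Set.range e) := by
    have : Algebra.IsAlgebraic F' Ω := Algebra.IsAlgebraic.tower_top (K := F) F'
    rw [adjoin_toSubalgebra_of_isAlgebraic fun x _ => Algebra.IsAlgebraic.isAlgebraic x,
      Algebra.adjoin_eq_span]
    rw [Submodule.span_le]
    intro y hy
    have hy : y ∈ L := by
      have : Submonoid.closure (L : Set Ω) ≤ L.toSubfield.toSubmonoid := Submonoid.closure_le.2 fun z hz => hz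
      exact this hy
    have hy2 : (⟨y, hy⟩ : L) ∈ Submodule.span F (Set.range b) := hb trivial
    have : ∀ z ∈ Submodule.span F (Set.range b), (z : Ω) ∈ Submodule.span F' (Set.range e) := by
      intro z hz
      induction hz using Submodule.span_induction with
      | mem z hz => obtain ⟨i, rfl⟩ := hz; exact h i
      | zero => exact zero_mem _
      | add a b _ _ ha hb => exact add_mem ha hb
      | smul c a _ ha =>
        have : ((c • a : L) : Ω) = algebraMap F F' c • (a : Ω) := by
          rw [algebraMap_smul]; rfl
        rw [this]; exact Submodule.smul_mem _ _ ha
    exact this _ hy2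
  have : Module.Finite F' (Submodule.span F' (Set.range e)) := Module.Finite.span_of_finite _ (Set.finite_range e)
  exact (Submodule.finrank_mono h1).trans ((finrank_range_le_card e).trans (by simp))

theorem normal_adj {K F Ω : Type*} [Field K] [Field F] [Field Ω] [Algebra K F] [Algebra F Ω]
    [Algebra K Ω] [IsScalarTower K F Ω] [IsAlgClosed Ω] [Algebra.IsAlgebraic F Ω]
    (A : IntermediateField K Ω) [Normal K A] : Normal F (adjoin F (A : Set Ω)) := by
  have : Normal F Ω := normal_iff.2 fun x => ⟨(Algebra.IsAlgebraic.isAlgebraic x).isIntegral, IsAlgClosed.splits _⟩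
  rw [normal_iff_forall_map_le]
  intro σ
  rw [adjoin_map]
  refine adjoin.mono _ _ _ ?_
  rintro _ ⟨a, ha, rfl⟩
  have h := AlgHom.fieldRange_of_normal (E := A) (((σ.restrictScalars K).comp A.val))
  change σ a ∈ A
  rw [← h]
  exact ⟨⟨a, ha⟩, rfl⟩

theorem normal_adj2 {F Ω : Type*} [Field F] [Field Ω] [Algebra F Ω]
    [IsAlgClosed Ω] [Algebra.IsAlgebraic F Ω]
    (L F' : IntermediateField F Ω) [Normal F L] [Normal F F'] : Normal F (adjoin F' (L : Set Ω)) := by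
  have h : Normal F ((F' ⊔ L : IntermediateField F Ω)) := inferInstance
  have h2 : F' ⊔ L = (adjoin F' (L : Set Ω)).restrictScalars F := by
    rw [restrictScalars_adjoin, adjoin_union, adjoin_self, adjoin_self]
  rw [h2] at h
  exact h

theorem exists_K' {K Ω : Type*} [Field K] [Field Ω] [Algebra K Ω] [IsAlgClosed Ω] (S : Finset Ω)
    (hS : (S : Set Ω) ⊆ algebraicClosure K Ω) : ∃ K' : IntermediateField K Ω,
    (S : Set Ω) ⊆ K' ∧ FiniteDimensional K K' ∧ Normal K K' ∧ K' ≤ algebraicClosure K Ω := by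
  classical
  have hm : ∀ s ∈ S, IsIntegral K s := fun s hs => ((mem_algebraicClosure_iff).1 (hS hs)).isIntegral
  set Q : K[X] := ∏ s ∈ S, minpoly K s with hQ
  have hQ0 : Q ≠ 0 := Finset.prod_ne_zero_iff.2 fun s hs => minpoly.ne_zero (hm s hs)
  have hsp := adjoin_rootSet_isSplittingField (K := K) (L := Ω) (p := Q) (IsAlgClosed.splits _)
  have hfd : FiniteDimensional K (adjoin K (Q.rootSet Ω)) := IsSplittingField.finiteDimensional _ Q
  refine ⟨adjoin K (Q.rootSet Ω), ?_, hfd, Normal.of_isSplittingField Q, ?_⟩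
  · intro s hs
    refine subset_adjoin _ _ (mem_rootSet.2 ⟨hQ0, ?_⟩)
    rw [hQ, map_prod]
    exact Finset.prod_eq_zero hs (minpoly.aeval K s)
  · intro z hz
    rw [mem_algebraicClosure_iff]
    exact isAlgebraic_iff.1 (Algebra.IsAlgebraic.isAlgebraic (R := K) (⟨z, hz⟩ : adjoin K (Q.rootSet Ω)))

end GST

set_option linter.unusedSectionVars false
namespace GST
universe u
open Polynomial IntermediateField

section
variable {K F Ω : Type u} [Field K] [Field F] [Field Ω] [Algebra K F] [Algebra F Ω]
    [Algebra K Ω] [IsScalarTower K F Ω] [IsAlgClosed Ω] [Algebra.IsAlgebraic F Ω]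

/-- Step 1: find a finite normal extension of the ground field. -/
theorem C3_step1 {O : ValuationSubring F} {x : F} (hgen : adjoin K {x} = ⊤) (hx : VI K O.valuation x)
    {W : ValuationSubring Ω} (hW : W ∈ Ext F Ω O) (L : IntermediateField F Ω) [FiniteDimensional F L] :
    ∃ K' : IntermediateField K Ω, FiniteDimensional K K' ∧ Normal K K' ∧
      ∀ F' : IntermediateField F Ω, F' = adjoin F (K' : Set Ω) →
      FiniteDimensional F' (adjoin F' (L : Set Ω)) ∧
      Good (adjoin F' (L : Set Ω)) (W.comap (algebraMap F' Ω)) := by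
  classical
  have hW' : W.comap (algebraMap F Ω) = O := hW
  have hfd : ∀ F' : IntermediateField F Ω, FiniteDimensional F' (adjoin F' (L : Set Ω)) := by
    intro F'
    have := adjoin_rank_le_of_isAlgebraic_right (F := F) F' L
    exact Module.rank_lt_aleph0_iff.1 (this.trans_lt (Module.rank_lt_aleph0 F L))
  let Ka := algebraicClosure K Ω
  let Fa := adjoin F (Ka : Set Ω)
  let La := adjoin Fa (L : Set Ω)
  have : IsAlgClosed Ka := IsAlgClosure.isAlgClosed K
  let ia : Ka →+* Fa := (algebraMap Ka Ω).codRestrict Fa fun a => subset_adjoin F _ a.2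
  let _ : Algebra Ka Fa := ia.toAlgebra
  have : FiniteDimensional Fa La := hfd Fa
  have hgood : Good La (W.comap (algebraMap Fa Ω)) := by
    refine C5 (K := Ka) (x := algebraMap F Fa x) ?_ (adj_top hgen Ka fun a => rfl)
    refine (VI.comap_iff (K := Ka) (algebraMap Fa Ω) (fun c => rfl) W).2 ?_
    refine VI.algebraic (K := K) ?_
    refine (VI.comap_iff (algebraMap F Ω) (fun c => (IsScalarTower.algebraMap_apply K F Ω c).symm) W).1 ?_
    rw [hW']; exact hx
  obtain ⟨T, hT⟩ := descent hgood
  let n := Module.finrank Fa La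
  let e : Module.Basis (Fin n) Fa La := Module.finBasis Fa La
  let b := Module.finBasis F L
  have hbLa : ∀ i, (b i : Ω) ∈ La := fun i => subset_adjoin _ _ (b i).2
  let a : _ → _ → Fa := fun i k => e.repr ⟨b i, hbLa i⟩ k
  let T1 : Finset Ω := T.image Subtype.val
  let T2 : Finset Ω := Finset.univ.image fun p : _ × _ => ((a p.1 p.2 : Fa) : Ω)
  obtain ⟨S1, hS1, hS1'⟩ := fin_adj (F := F) (A := (Ka : Set Ω)) (B := (L : Set Ω)) T1 (by
    intro t ht
    obtain ⟨t, -, rfl⟩ := Finset.mem_image.1 ht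
    have h := t.2
    have h2 : (t : Ω) ∈ (adjoin Fa (L : Set Ω)).restrictScalars F := h
    rw [adjoin_adjoin_left] at h2
    exact h2)
  obtain ⟨S2, hS2, hS2'⟩ := fin_adj (F := F) (A := (Ka : Set Ω)) (B := ∅) T2 (by
    intro t ht
    obtain ⟨p, -, rfl⟩ := Finset.mem_image.1 ht
    rw [Set.union_empty]
    exact (a p.1 p.2).2)
  obtain ⟨K', hSK, hfdK, hnK, hKa⟩ := exists_K' (K := K) (S1 ∪ S2) (by
    rw [Finset.coe_union]; exact Set.union_subset hS1 hS2)
  rw [Finset.coe_union, Set.union_subset_iff] at hSK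
  refine ⟨K', hfdK, hnK, ?_⟩
  rintro F' rfl
  set F' := adjoin F (K' : Set Ω) with hF'
  have : FiniteDimensional F' (adjoin F' (L : Set Ω)) := hfd F'
  refine ⟨this, ?_⟩
  have hFle : F' ≤ Fa := adjoin.mono _ _ _ hKa
  let i : F' →+* Fa := (inclusion hFle).toRingHom
  have hLle : ∀ z : adjoin F' (L : Set Ω), (z : Ω) ∈ La := by
    rintro ⟨z, hz⟩
    have h2 : z ∈ (adjoin F' (L : Set Ω)).restrictScalars F := hz
    rw [restrictScalars_adjoin] at h2
    have h3 : z ∈ (adjoin Fa (L : Set Ω)).restrictScalars F := by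
      rw [restrictScalars_adjoin]
      exact adjoin.mono _ _ _ (Set.union_subset_union_left _ hFle) h2
    exact h3
  let j : adjoin F' (L : Set Ω) →+* La := (algebraMap (adjoin F' (L : Set Ω)) Ω).codRestrict La hLle
  refine hT F' (adjoin F' (L : Set Ω)) i j (fun c => rfl) ?_ ?_
  · intro t ht
    have h1 := hS1' t (Finset.mem_image_of_mem _ ht)
    have h2 : (t : Ω) ∈ (adjoin F' (L : Set Ω)).restrictScalars F := by
      rw [restrictScalars_adjoin]
      exact adjoin.mono _ _ _ (Set.union_subset_union_left _ (hSK.1.trans (subset_adjoin F _))) h1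
    exact ⟨⟨t, h2⟩, rfl⟩
  · refine finrank_adj L F' (fun k => (e k : Ω)) b b.span_eq.ge fun l => ?_
    have h1 := congrArg (Subtype.val) (e.sum_repr ⟨b l, hbLa l⟩)
    have h2 : (b l : Ω) = ∑ k, (a l k : Ω) * (e k : Ω) := by
      rw [← h1]
      push_cast
      rfl
    rw [h2]
    refine sum_mem fun k _ => ?_
    have h3 : (a l k : Ω) ∈ F' := by
      have := hS2' (a l k : Ω) (Finset.mem_image.2 ⟨(l, k), Finset.mem_univ _, rfl⟩)
      rw [Set.union_empty] at this
      exact adjoin.mono _ _ _ hSK.2 this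
    exact Submodule.smul_mem _ (⟨_, h3⟩ : F') (Submodule.subset_span ⟨k, rfl⟩)

theorem C3_normal {O : ValuationSubring F} {x : F} (hgen : adjoin K {x} = ⊤) (hx : VI K O.valuation x)
    (hs : Stable K (O.comap (algebraMap K F)))
    (L : IntermediateField F Ω) [FiniteDimensional F L] [Normal F L] : Good L O := by
  obtain ⟨W, hW⟩ := ext_nonempty F Ω O
  have hW' : W.comap (algebraMap F Ω) = O := hW
  obtain ⟨K', hfK, hnK, hK'⟩ := C3_step1 hgen hx hW L
  set F' := adjoin F (K' : Set Ω) with hF'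
  obtain ⟨hfd, hg⟩ := hK' F' rfl
  set L' := adjoin F' (L : Set Ω) with hL'
  let ik : K' →+* F' := (algebraMap K' Ω).codRestrict F' fun a => subset_adjoin F _ a.2
  let _ : Algebra K' F' := ik.toAlgebra
  have : IsScalarTower K K' F' := IsScalarTower.of_algebraMap_eq fun c =>
    Subtype.ext ((congrArg Subtype.val (IsScalarTower.algebraMap_apply K F F' c)).trans
      (IsScalarTower.algebraMap_apply K F Ω c).symm)
  have hr := adjoin_rank_le_of_isAlgebraic_right (F := K) F K'
  have hfF : FiniteDimensional F F' := Module.rank_lt_aleph0_iff.1 (hr.trans_lt (Module.rank_lt_aleph0 K K'))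
  have hfin : Module.finrank F F' ≤ Module.finrank K K' :=
    Cardinal.toNat_le_toNat hr (Module.rank_lt_aleph0 K K')
  have hnF : Normal F F' := normal_adj K'
  have hnL : Normal F L' := normal_adj2 L F'
  have hWF : W.comap (algebraMap F' Ω) ∈ Ext F F' O := Ext.comap_mem hW _ fun c => rfl
  have h1 : Good F' O := good_lift (K' := K') hfin hgen (adj_top hgen K' fun a => rfl) hx hWF (hs K')
  have : FiniteDimensional F L' := FiniteDimensional.trans F F' L'
  have h2 : Good L' O := by
    refine Good.tower F' h1 fun U hU => ?_
    obtain ⟨σ, hσ⟩ := Ext.conj hWF hU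
    have := Good.equiv σ.toRingEquiv (AlgEquiv.liftNormal σ L').toRingEquiv
      (fun c => AlgEquiv.liftNormal_commutes σ L' c) hg
    rw [hσ]; exact this
  let il : L →+* L' := (algebraMap L Ω).codRestrict L' fun a => subset_adjoin F' _ a.2
  let _ : Algebra L L' := il.toAlgebra
  have : IsScalarTower F L L' := IsScalarTower.of_algebraMap_eq fun c => rfl
  have : FiniteDimensional L L' := FiniteDimensional.right F L L'
  exact (Good.down L h2).1

end

theorem C3 {K F : Type u} [Field K] [Field F] [Algebra K F] {O : ValuationSubring F} {x : F}
    (hgen : adjoin K {x} = ⊤) (hx : VI K O.valuation x)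
    (hs : Stable K (O.comap (algebraMap K F))) : Stable F O := by
  intro L _ _ _
  let Ω := AlgebraicClosure L
  let _ : Algebra K Ω := ((algebraMap F Ω).comp (algebraMap K F)).toAlgebra
  have : IsScalarTower K F Ω := IsScalarTower.of_algebraMap_eq fun _ => rfl
  have : Algebra.IsAlgebraic F Ω := Algebra.IsAlgebraic.trans F L Ω
  let L' := normalClosure F L Ω
  have : FiniteDimensional F L' := normalClosure.is_finiteDimensional F L _
  have h : Good L' O := C3_normal hgen hx hs L'
  have : FiniteDimensional L L' := FiniteDimensional.right F L L'
  exact (Good.down L h).1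

end GST

set_option linter.unusedSectionVars false
namespace GST
universe u
open Polynomial IntermediateField

def RI (K : Type*) {Λ Γ : Type*} [Field K] [Field Λ] [Algebra K Λ]
    [LinearOrderedCommGroupWithZero Γ] (v : Valuation Λ Γ) (x : Λ) : Prop :=
  v x ≤ 1 ∧ ∀ p : K[X], (∀ i, v (algebraMap K Λ (p.coeff i)) ≤ 1) →
    (∃ i, v (algebraMap K Λ (p.coeff i)) = 1) → 1 ≤ v (aeval x p)

theorem RI.composite {K F : Type*} [Field K] [Field F] [Algebra K F] {O : ValuationSubring F} {x : F}
    (hx : RI K O.valuation x) : ∃ O' ≤ O, O'.comap (algebraMap K F) = O.comap (algebraMap K F) ∧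
      VI K O'.valuation x := by
  set R := O.comap (algebraMap K F) with hR
  set v := O.valuation with hv
  let ev : R[X] →+* F := eval₂RingHom ((algebraMap K F).comp R.subtype) x
  have hRv : ∀ c : R, v (algebraMap K F c) ≤ 1 := fun c => (O.valuation_le_one_iff _).2 c.2
  have hev : ∀ p, ev p = aeval x (p.map R.subtype) := by
    intro p
    rw [aeval_def, eval₂_map]; rfl
  have hevle : ∀ p, v (ev p) ≤ 1 := by
    intro p
    change v (eval₂ _ x p) ≤ 1
    rw [eval₂_eq_sum, Polynomial.sum]
    refine v.map_sum_le fun i _ => ?_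
    rw [map_mul, map_pow]
    exact mul_le_one' (hRv _) (pow_le_one' hx.1 _)
  have hle : ∀ {f : F} {p}, v (f - ev p) < 1 → v f ≤ 1 := by
    intro f p h
    have := v.map_add_le h.le (hevle p)
    simpa using this
  have hmul : ∀ {f g : F} {p q}, v (f - ev p) < 1 → v (g - ev q) < 1 → v (f * g - ev (p * q)) < 1 := by
    intro f g p q h1 h2
    have : f * g - ev (p * q) = f * (g - ev q) + (f - ev p) * ev q := by rw [map_mul]; ring
    rw [this]
    refine v.map_add_lt ?_ ?_
    · rw [map_mul]; exact (mul_le_of_le_one_left' (hle h1)).trans_lt h2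
    · rw [map_mul]; exact (mul_le_of_le_one_right' (hevle q)).trans_lt h1
  have hadd : ∀ {f g : F} {p q}, v (f - ev p) < 1 → v (g - ev q) < 1 → v (f + g - ev (p + q)) < 1 := by
    intro f g p q h1 h2
    have : f + g - ev (p + q) = (f - ev p) + (g - ev q) := by rw [map_add]; ring
    rw [this]
    exact v.map_add_lt h1 h2
  let A : Subring F :=
    { carrier := {f | ∃ p : R[X], v (f - ev p) < 1}
      mul_mem' := fun ⟨p, hp⟩ ⟨q, hq⟩ => ⟨p * q, hmul hp hq⟩
      one_mem' := ⟨1, by simp⟩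
      add_mem' := fun ⟨p, hp⟩ ⟨q, hq⟩ => ⟨p + q, hadd hp hq⟩
      zero_mem' := ⟨0, by simp⟩
      neg_mem' := fun {f} ⟨p, hp⟩ => ⟨-p, by
        rw [map_neg, ← neg_sub', Valuation.map_neg]; exact hp⟩ }
  let I : Ideal A :=
    { carrier := {f | ∃ p : R[X], v (algebraMap K F (p.coeff 0)) < 1 ∧ v ((f : F) - ev p) < 1}
      add_mem' := fun ⟨p, hp0, hp⟩ ⟨q, hq0, hq⟩ => ⟨p + q, by
        rw [coeff_add, show ((p.coeff 0 + q.coeff 0 : R) : K) = p.coeff 0 + q.coeff 0 from rfl, map_add (algebraMap K F)]; exact v.map_add_lt hp0 hq0, hadd hp hq⟩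
      zero_mem' := ⟨0, by simp⟩
      smul_mem' := fun ⟨g, q, hq⟩ f ⟨p, hp0, hp⟩ => ⟨q * p, by
        rw [mul_coeff_zero, show ((q.coeff 0 * p.coeff 0 : R) : K) = q.coeff 0 * p.coeff 0 from rfl,
          map_mul, map_mul]
        exact (mul_le_of_le_one_left' (hRv _)).trans_lt hp0, hmul hq hp⟩ }
  have hI : I ≠ ⊤ := by
    rw [Ideal.ne_top_iff_one]
    rintro ⟨p, hp0, hp⟩
    have h1 := hx.2 ((1 - p).map R.subtype) (fun i => by rw [coeff_map]; exact hRv _) ⟨0, by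
      rw [coeff_map, coeff_sub, coeff_one_zero]
      simp only [map_sub, map_one]
      exact v.map_one_sub_of_lt hp0⟩
    rw [← hev, map_sub, map_one] at h1
    exact h1.not_gt hp
  obtain ⟨B, hAB, hIB⟩ := Ideal.image_subset_nonunits_valuationSubring I hI
  have hm : ∀ f, v f < 1 → B.valuation f < 1 := by
    intro f hf
    have hf' : v (f - ev 0) < 1 := by simpa using hf
    rw [← B.mem_nonunits_iff]
    exact hIB ⟨⟨f, 0, hf'⟩, ⟨0, by simp, hf'⟩, rfl⟩
  have hBO : B ≤ O := by
    intro b hb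
    by_contra hbO
    have hb0 : b ≠ 0 := by rintro rfl; exact hbO (zero_mem O)
    have h1 : 1 < v b := by
      rw [← not_le]; exact fun h => hbO ((O.valuation_le_one_iff _).1 h)
    have h2 := hm b⁻¹ (by rw [map_inv₀]; exact inv_lt_one_of_one_lt₀ h1)
    have h3 := (B.valuation_le_one_iff _).2 hb
    rw [map_inv₀] at h2
    exact h3.not_gt ((inv_lt_one₀ (zero_lt_iff.2 (by simpa using hb0))).1 h2)
  have hBK : B.comap (algebraMap K F) = R := by
    ext c
    refine ⟨fun h => hBO h, fun h => hAB ?_⟩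
    refine ⟨C ⟨c, h⟩, ?_⟩
    have : ev (C ⟨c, h⟩) = algebraMap K F c := by
      change eval₂ _ x _ = _
      rw [eval₂_C]; rfl
    rw [this, sub_self, map_zero]; exact zero_lt_one
  refine ⟨B, hBO, hBK, ?_⟩
  have hxX : v (x - ev X) < 1 := by
    have : ev X = x := by change eval₂ _ x _ = _; rw [eval₂_X]
    rw [this, sub_self, map_zero]; exact zero_lt_one
  have hxB : B.valuation x < 1 := by
    rw [← B.mem_nonunits_iff]
    exact hIB ⟨⟨x, X, hxX⟩, ⟨X, by simp, hxX⟩, rfl⟩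
  have hx1 : v x = 1 := by
    refine le_antisymm hx.1 ?_
    have := hx.2 X (fun i => by rw [coeff_X]; split_ifs <;> simp) ⟨1, by simp⟩
    simpa using this
  have hx0 : x ≠ 0 := by rintro rfl; simp at hx1
  refine ⟨hx0, fun t c hc h => ?_⟩
  have hc' : algebraMap K F c ≠ 0 := by simpa using hc
  have hvle : ∀ {a : F}, B.valuation a ≤ 1 → v a ≤ 1 := fun h =>
    (O.valuation_le_one_iff _).2 (hBO ((B.valuation_le_one_iff _).1 h))
  have hc1 : v (algebraMap K F c) = 1 := by
    have h1 : B.valuation (x ^ t / algebraMap K F c) = 1 := by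
      rw [map_div₀, h, div_self (by simpa using hc)]
    have h2 : B.valuation (algebraMap K F c / x ^ t) = 1 := by
      rw [map_div₀, h, div_self (by simpa using hc)]
    have h3 := hvle h1.le
    have h4 := hvle h2.le
    rw [map_div₀, map_zpow₀, hx1, one_zpow] at h3 h4
    rw [div_one] at h4
    refine le_antisymm h4 ?_
    rwa [one_div, inv_le_one₀ (zero_lt_iff.2 (by simpa using hc))] at h3
  have hB : ∀ c : K, v (algebraMap K F c) ≤ 1 → B.valuation (algebraMap K F c) ≤ 1 := by
    intro c h
    have : c ∈ R := (O.valuation_le_one_iff _).1 h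
    rw [← hBK] at this
    exact (B.valuation_le_one_iff _).2 this
  have hBc : B.valuation (algebraMap K F c) = 1 := by
    refine le_antisymm (hB c hc1.le) ?_
    have := hB c⁻¹ (by rw [map_inv₀, map_inv₀, hc1, inv_one])
    rwa [map_inv₀, map_inv₀, inv_le_one₀ (zero_lt_iff.2 (by simpa using hc))] at this
  rw [hBc, map_zpow₀] at h
  exact (zpow_eq_one_iff_right₀ zero_le hxB.ne).1 h

theorem C4 {K F : Type u} [Field K] [Field F] [Algebra K F] {O : ValuationSubring F} {x : F}
    (hgen : adjoin K {x} = ⊤) (hx : RI K O.valuation x)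
    (hs : Stable K (O.comap (algebraMap K F))) : Stable F O := by
  obtain ⟨O', hle, h1, h2⟩ := hx.composite
  refine Stable.coarse hle (C3 hgen h2 ?_)
  rw [h1]; exact hs

end GST

set_option linter.unusedSectionVars false
namespace GST
universe u
open Polynomial IntermediateField

theorem gen_top {K F : Type*} [Field K] [Field F] [Algebra K F] (x : F) :
    adjoin K {AdjoinSimple.gen K x} = ⊤ := by
  rw [eq_top_iff]
  rintro ⟨z, hz⟩ -
  induction hz using adjoin_induction with
  | mem y hy =>
    rw [Set.mem_singleton_iff] at hy
    subst hy
    exact mem_adjoin_simple_self K _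
  | algebraMap f => exact IntermediateField.algebraMap_mem _ f
  | add a b ha hb h1 h2 => exact add_mem h1 h2
  | mul a b ha hb h1 h2 => exact mul_mem h1 h2
  | inv a ha h1 => exact inv_mem h1

theorem fg_up {K F : Type*} [Field K] [Field F] [Algebra K F] (K1 : IntermediateField K F)
    {S : Set F} (h : adjoin K S = ⊤) : adjoin K1 S = ⊤ := by
  rw [eq_top_iff]
  rintro z -
  have hz : z ∈ adjoin K S := h ▸ mem_top
  induction hz using adjoin_induction with
  | mem y hy => exact subset_adjoin _ _ hy
  | algebraMap f => exact IntermediateField.algebraMap_mem _ (algebraMap K K1 f)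
  | add a b ha hb h1 h2 => exact add_mem h1 h2
  | mul a b ha hb h1 h2 => exact mul_mem h1 h2
  | inv a ha h1 => exact inv_mem h1

theorem trdeg_up {K F : Type u} [Field K] [Field F] [Algebra K F] {x : F}
    (hx : Transcendental K x) {n : ℕ} (h : Algebra.trdeg K F ≤ (n + 1 : ℕ)) :
    Algebra.trdeg (adjoin K {x}) F ≤ n := by
  have h1 := trdeg_add_eq K (adjoin K {x}) (A := F)
  have : Algebra.Transcendental K (adjoin K {x}) := by
    refine ⟨AdjoinSimple.gen K x, fun hh => hx ?_⟩
    have := hh.algebraMap (A := F)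
    simpa using this
  have h2 : 1 ≤ Algebra.trdeg K (adjoin K {x}) :=
    Cardinal.one_le_iff_pos.2 (trdeg_pos K _)
  have h3 : 1 + Algebra.trdeg (adjoin K {x}) F ≤ (n + 1 : ℕ) :=
    (add_le_add_left h2 _).trans (h1.le.trans h)
  have h4 : Algebra.trdeg (adjoin K {x}) F < Cardinal.aleph0 :=
    (le_add_self.trans h3).trans_lt (Cardinal.natCast_lt_aleph0)
  obtain ⟨k, hk⟩ := Cardinal.lt_aleph0.1 h4
  rw [hk] at h3 ⊢
  norm_cast at h3 ⊢
  omega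

theorem stable_VI {K F : Type u} [Field K] [Field F] [Algebra K F] {O : ValuationSubring F} {x : F}
    (hx : VI K O.valuation x) (hs : Stable K (O.comap (algebraMap K F))) :
    Stable (adjoin K {x}) (O.comap (algebraMap (adjoin K {x}) F)) := by
  refine C3 (gen_top x) ?_ hs
  exact (VI.comap_iff (K := K) (x := AdjoinSimple.gen K x) (algebraMap (adjoin K {x}) F) (fun c => rfl) O).2 hx

theorem stable_RI {K F : Type u} [Field K] [Field F] [Algebra K F] {O : ValuationSubring F} {x : F}
    (hx : RI K O.valuation x) (hs : Stable K (O.comap (algebraMap K F))) :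
    Stable (adjoin K {x}) (O.comap (algebraMap (adjoin K {x}) F)) := by
  refine C4 (gen_top x) ?_ hs
  have hle : ∀ a b, _ := comap_le_iff' (algebraMap (adjoin K {x}) F) O
  have h1 : ∀ a, (O.comap (algebraMap (adjoin K {x}) F)).valuation a ≤ 1 ↔ O.valuation (a : F) ≤ 1 := by
    intro a; have := hle a 1; rwa [map_one, map_one, map_one] at this
  have h2 : ∀ a, 1 ≤ (O.comap (algebraMap (adjoin K {x}) F)).valuation a ↔ 1 ≤ O.valuation (a : F) := by
    intro a; simpa using hle 1 a
  have h3 : ∀ a, (O.comap (algebraMap (adjoin K {x}) F)).valuation a = 1 ↔ O.valuation (a : F) = 1 := by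
    intro a; rw [le_antisymm_iff, le_antisymm_iff, h1, h2]
  refine ⟨(h1 _).2 hx.1, fun p hp hp' => (h2 _).2 ?_⟩
  have := hx.2 p (fun i => (h1 _).1 (hp i)) (hp'.imp fun i => (h3 _).1)
  convert this using 2
  have := aeval_algebraMap_apply F (AdjoinSimple.gen K x) p
  exact this.symm

def VIn (K : Type*) {Λ Γ : Type*} [Field K] [Field Λ] [Algebra K Λ]
    [LinearOrderedCommGroupWithZero Γ] (v : Valuation Λ Γ) {n : ℕ} (x : Fin n → Λ) : Prop :=
  (∀ i, x i ≠ 0) ∧ ∀ (e : Fin n → ℤ) (c : K), c ≠ 0 →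
    v (∏ i, x i ^ e i) = v (algebraMap K Λ c) → e = 0

def MI (K : Type*) {Λ Γ : Type*} [Field K] [Field Λ] [Algebra K Λ]
    [LinearOrderedCommGroupWithZero Γ] (v : Valuation Λ Γ) {n : ℕ} (y : Fin n → Λ) : Prop :=
  (∀ i, v (y i) ≤ 1) ∧ ∀ (s : Finset (Fin n → ℕ)) (c : (Fin n → ℕ) → K), ∀ m ∈ s,
    v (algebraMap K Λ (c m)) ≤ v (∑ m ∈ s, algebraMap K Λ (c m) * ∏ i, y i ^ m i)

def MI1 (K : Type*) {Λ Γ : Type*} [Field K] [Field Λ] [Algebra K Λ]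
    [LinearOrderedCommGroupWithZero Γ] (v : Valuation Λ Γ) (y : Λ) : Prop :=
  v y ≤ 1 ∧ ∀ (p : K[X]) i, v (algebraMap K Λ (p.coeff i)) ≤ v (aeval y p)

section
variable {K Λ Γ : Type*} [Field K] [Field Λ] [Algebra K Λ]
    [LinearOrderedCommGroupWithZero Γ] {v : Valuation Λ Γ}

theorem VIn.head {n : ℕ} {x : Fin (n + 1) → Λ} (h : VIn K v x) : VI K v (x 0) := by
  refine ⟨h.1 0, fun t c hc hv => ?_⟩
  have := h.2 (Fin.cons t 0) c hc (by rw [Fin.prod_univ_succ]; simpa using hv)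
  exact congrFun this 0

theorem VIn.tail {n : ℕ} {x : Fin (n + 1) → Λ} (h : VIn K v x) :
    VIn (adjoin K {x 0}) v (Fin.tail x) := by
  refine ⟨fun i => h.1 _, fun e c hc hv => ?_⟩
  obtain ⟨c0, hc0, t, ht⟩ := h.head.approx c.2 (by simpa using hc)
  have h1 := near_val ht
  have h2 := h.2 (Fin.cons (-t) e) c0 hc0 (by
    rw [Fin.prod_univ_succ]
    simp only [Fin.cons_zero, Fin.cons_succ]
    rw [map_mul]
    refine Eq.trans (congrArg _ (hv.trans h1.symm)) ?_
    rw [map_mul, mul_left_comm, ← map_mul, ← zpow_add₀ (h.1 0)]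
    simp)
  funext i
  exact congrFun h2 i.succ

theorem MI1.RI {y : Λ} (h : MI1 K v y) : RI K v y :=
  ⟨h.1, fun p _ ⟨i, hi⟩ => hi ▸ h.2 p i⟩

theorem MI1.exists_max {y : Λ} (h : MI1 K v y) {p : K[X]} (hp : p ≠ 0) :
    ∃ i, p.coeff i ≠ 0 ∧ v (aeval y p) = v (algebraMap K Λ (p.coeff i)) := by
  obtain ⟨i, hi, hm⟩ := Finset.exists_max_image p.support (fun i => v (algebraMap K Λ (p.coeff i)))
    (by simpa using hp)
  refine ⟨i, by simpa using hi, le_antisymm ?_ (h.2 p i)⟩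
  rw [aeval_eq_sum_range]
  refine v.map_sum_le fun j _ => ?_
  rw [Algebra.smul_def, map_mul, map_pow]
  refine (mul_le_of_le_one_right' (pow_le_one' h.1 _)).trans ?_
  by_cases hj : p.coeff j = 0
  · simp [hj]
  · exact hm j (by simpa using hj)

theorem MI1.transcendental {y : Λ} (h : MI1 K v y) : Transcendental K y := by
  rintro ⟨p, hp, h0⟩
  obtain ⟨i, hi, hv⟩ := h.exists_max hp
  rw [h0, map_zero, eq_comm] at hv
  simp [hi] at hv

theorem MI1.frac {y : Λ} (h : MI1 K v y) (f : adjoin K {y}) : ∃ p q : K[X], q ≠ 0 ∧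
    (f : Λ) * aeval y q = aeval y p := by
  obtain ⟨r, s, hrs⟩ := (mem_adjoin_simple_iff K (α := y) (f : Λ)).1 f.2
  by_cases hs : aeval y s = 0
  · exact ⟨0, 1, one_ne_zero, by simp [hrs, hs]⟩
  · exact ⟨r, s, fun h => hs (by simp [h]), by rw [hrs, div_mul_cancel₀ _ hs]⟩

theorem MI1.val {y : Λ} (h : MI1 K v y) (f : adjoin K {y}) (hf : f ≠ 0) : ∃ c : K, c ≠ 0 ∧
    v (f : Λ) = v (algebraMap K Λ c) := by
  obtain ⟨p, q, hq, e⟩ := h.frac f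
  have hq' : aeval y q ≠ 0 := fun h0 => h.transcendental ⟨q, hq, h0⟩
  have hp : p ≠ 0 := by
    rintro rfl
    rw [map_zero] at e
    rcases mul_eq_zero.1 e with e | e
    · exact hf (by exact_mod_cast e)
    · exact hq' e
  obtain ⟨i, hi, h1⟩ := h.exists_max hp
  obtain ⟨j, hj, h2⟩ := h.exists_max hq
  refine ⟨p.coeff i / q.coeff j, div_ne_zero hi hj, ?_⟩
  rw [map_div₀, map_div₀, ← h1, ← h2, ← e, map_mul, mul_div_cancel_right₀]
  simpa using hq'

theorem MI.head {n : ℕ} {y : Fin (n + 1) → Λ} (h : MI K v y) : MI1 K v (y 0) := by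
  classical
  refine ⟨h.1 0, fun p i => ?_⟩
  by_cases hi : p.coeff i = 0
  · simp [hi]
  let φ : ℕ → (Fin (n + 1) → ℕ) := fun k => Fin.cons k 0
  have := h.2 ((Finset.range (p.natDegree + 1)).image φ) (fun m => p.coeff (m 0)) (φ i)
    (Finset.mem_image_of_mem _ (Finset.mem_range.2 (Nat.lt_succ_of_le (le_natDegree_of_ne_zero hi))))
  rw [Finset.sum_image] at this
  · simp only [φ, Fin.cons_zero, Fin.prod_univ_succ, Fin.cons_succ] at this
    rw [aeval_eq_sum_range]
    simpa [Algebra.smul_def] using this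
  · intro a _ b _ hab
    exact congrFun hab 0

theorem MI.tail {n : ℕ} {y : Fin (n + 1) → Λ} (h : MI K v y) :
    MI (adjoin K {y 0}) v (Fin.tail y) := by
  classical
  refine ⟨fun i => h.1 _, fun s c m hm => ?_⟩
  choose p q hq e using fun m => h.head.frac (c m)
  let H : K[X] := ∏ m ∈ s, q m
  have hH : aeval (y 0) H ≠ 0 := fun h0 =>
    h.head.transcendental ⟨H, Finset.prod_ne_zero_iff.2 fun m _ => hq m, h0⟩
  let g : (Fin n → ℕ) → K[X] := fun m => p m * ∏ m' ∈ s.erase m, q m'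
  have hg : ∀ m ∈ s, (c m : Λ) * aeval (y 0) H = aeval (y 0) (g m) := by
    intro m hm
    simp only [H, g]
    rw [← Finset.mul_prod_erase s q hm, map_mul, map_mul, ← mul_assoc, e]
  let N := s.sup (fun m => (g m).natDegree) + 1
  have hN : ∀ m ∈ s, (g m).natDegree < N := fun m hm =>
    Nat.lt_succ_of_le (Finset.le_sup (f := fun m => (g m).natDegree) hm)
  let φ : ℕ × (Fin n → ℕ) → (Fin (n + 1) → ℕ) := fun a => Fin.cons a.1 a.2
  have hφ : Function.Injective φ := by
    intro a b hab
    exact Prod.ext (congrFun hab 0) (funext fun i => congrFun hab i.succ)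
  let S := (Finset.range N ×ˢ s).image φ
  have hS : ∑ m ∈ S, algebraMap K Λ ((g (Fin.tail m)).coeff (m 0)) * ∏ i, y i ^ m i
      = (∑ m ∈ s, (c m : Λ) * ∏ i, Fin.tail y i ^ m i) * aeval (y 0) H := by
    rw [Finset.sum_image hφ.injOn, Finset.sum_product_right, Finset.sum_mul]
    refine Finset.sum_congr rfl fun m hm => ?_
    rw [mul_right_comm, hg m hm, aeval_eq_sum_range' (hN m hm), Finset.sum_mul]
    refine Finset.sum_congr rfl fun k _ => ?_
    simp only [φ, Fin.tail_cons, Fin.cons_zero, Fin.prod_univ_succ, Fin.cons_succ, Algebra.smul_def]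
    rw [mul_assoc]; rfl
  have hpos : 0 < v (aeval (y 0) H) := zero_lt_iff.2 (by simpa using hH)
  refine le_of_mul_le_mul_right ?_ hpos
  rw [← map_mul, ← map_mul]
  change v ((c m : Λ) * _) ≤ v ((∑ m ∈ s, (c m : Λ) * ∏ i, Fin.tail y i ^ m i) * _)
  rw [hg m hm, ← hS]
  by_cases h0 : g m = 0
  · rw [h0]; simp
  obtain ⟨k, hk, hv⟩ := h.head.exists_max h0
  rw [hv]
  have := h.2 S (fun m => (g (Fin.tail m)).coeff (m 0)) (φ (k, m)) (Finset.mem_image_of_mem _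
    (Finset.mem_product.2 ⟨Finset.mem_range.2 ((le_natDegree_of_ne_zero hk).trans_lt (hN m hm)), hm⟩))
  simpa only [φ, Fin.tail_cons, Fin.cons_zero] using this

theorem VIn.up {y : Λ} (h : MI1 K v y) {n : ℕ} {x : Fin n → Λ} (hx : VIn K v x) :
    VIn (adjoin K {y}) v x := by
  refine ⟨hx.1, fun e c hc hv => ?_⟩
  obtain ⟨c0, hc0, h1⟩ := h.val c hc
  exact hx.2 e c0 hc0 (hv.trans h1)
end

theorem stable_fin {K F : Type u} [Field K] [Field F] [Algebra K F] {O : ValuationSubring F}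
    [FiniteDimensional K F] (hs : Stable K (O.comap (algebraMap K F))) : Stable F O := by
  intro L _ _ _
  let _ : Algebra K L := ((algebraMap F L).comp (algebraMap K F)).toAlgebra
  have : IsScalarTower K F L := IsScalarTower.of_algebraMap_eq fun c => rfl
  have : FiniteDimensional K L := FiniteDimensional.trans K F L
  exact (Good.down F (hs L)).2 O rfl

theorem main_base {K F : Type u} [Field K] [Field F] [Algebra K F] {O : ValuationSubring F}
    (hs : Stable K (O.comap (algebraMap K F))) {S : Finset F} (hS : adjoin K (S : Set F) = ⊤)
    (ht : Algebra.trdeg K F ≤ (0 : ℕ)) : Stable F O := by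
  have h0 : Algebra.trdeg K F = 0 := by simpa using ht
  have hal : Algebra.IsAlgebraic K F := (trdeg_eq_zero_iff).1 h0
  have : FiniteDimensional K F := by
    have h1 : FiniteDimensional K (adjoin K (S : Set F)) :=
      finiteDimensional_adjoin fun x _ => (hal.isAlgebraic x).isIntegral
    rw [hS] at h1
    exact topEquiv.toLinearEquiv.finiteDimensional
  exact stable_fin hs

theorem main_VI {F : Type u} [Field F] {O : ValuationSubring F} (n : ℕ) :
    ∀ {K : Type u} [Field K] [Algebra K F]
    (_ : Stable K (O.comap (algebraMap K F))) {S : Finset F} (_ : adjoin K (S : Set F) = ⊤)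
    (_ : Algebra.trdeg K F ≤ (n : ℕ)) {x : Fin n → F} (_ : VIn K O.valuation x), Stable F O := by
  induction n with
  | zero => intro K _ _ hs S hS ht x hx; exact main_base hs hS ht
  | succ n ih =>
    intro K _ _ hs S hS ht x hx
    exact ih (stable_VI hx.head hs) (fg_up _ hS) (trdeg_up hx.head.transcendental ht) hx.tail

theorem main_MI {F : Type u} [Field F] {O : ValuationSubring F} {n : ℕ} {x : Fin n → F} (τ : ℕ) :
    ∀ {K : Type u} [Field K] [Algebra K F]
    (_ : Stable K (O.comap (algebraMap K F))) {S : Finset F} (_ : adjoin K (S : Set F) = ⊤)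
    (_ : Algebra.trdeg K F ≤ (n + τ : ℕ)) (_ : VIn K O.valuation x)
    {y : Fin τ → F} (_ : MI K O.valuation y), Stable F O := by
  induction τ with
  | zero => intro K _ _ hs S hS ht hx y hy; exact main_VI n hs hS ht hx
  | succ τ ih =>
    intro K _ _ hs S hS ht hx y hy
    exact ih (stable_RI hy.head.RI hs) (fg_up _ hS) (trdeg_up hy.head.transcendental ht)
      (hx.up hy.head) hy.tail

open LocalUnif in
theorem VIn.of {F : Type*} [Field F] {K : Subfield F} {O : ValuationSubring F} {n : ℕ}
    {x : Fin n → F} (h : ValIndepMod O K x) : VIn K O.valuation x := by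
  refine ⟨h.1, fun e c hc hv => h.2 e ⟨c, c.2, by simpa using hc, ?_⟩⟩
  rw [isVUnit_iff, map_div₀, hv]
  exact div_self (by simpa using hc)

open LocalUnif in
theorem MI.of {F : Type*} [Field F] {K : Subfield F} {O : ValuationSubring F} {n : ℕ}
    {y : Fin n → F} (h : ResIndep O K y) : MI K O.valuation y := by
  classical
  refine ⟨fun i => (O.valuation_le_one_iff _).2 (h.1 i), fun s c m hm => ?_⟩
  obtain ⟨m0, hm0, hmax⟩ := Finset.exists_max_image s (fun m => O.valuation (c m : F)) ⟨m, hm⟩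
  refine (hmax m hm).trans ?_
  by_cases h0 : (c m0 : F) = 0
  · rw [h0]; simp
  let φ : (Fin n → ℕ) → (Fin n →₀ ℕ) := Finsupp.equivFunOnFinite.symm
  let p : MvPolynomial (Fin n) F := ∑ m ∈ s, MvPolynomial.monomial (φ m) ((c m : F) / c m0)
  have hp : ∀ m, p.coeff (φ m) = if m ∈ s then (c m : F) / c m0 else 0 := by
    intro m
    simp only [p, MvPolynomial.coeff_sum, MvPolynomial.coeff_monomial]
    simp only [φ, Finsupp.equivFunOnFinite.symm.injective.eq_iff]
    simp
  have hsurj : ∀ m, ∃ m', φ m' = m := Finsupp.equivFunOnFinite.symm.surjective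
  have hpos : 0 < O.valuation (c m0 : F) := zero_lt_iff.2 (by simpa using h0)
  have h1 := h.2 p ?_ ⟨φ m0, ?_⟩
  · rw [inMax_iff, not_lt] at h1
    have he : MvPolynomial.eval y p = (∑ m ∈ s, (c m : F) * ∏ i, y i ^ m i) / c m0 := by
      simp only [p, map_sum, MvPolynomial.eval_monomial, Finset.sum_div]
      refine Finset.sum_congr rfl fun m _ => ?_
      rw [Finsupp.prod_fintype _ _ (fun i => pow_zero _)]
      simp only [φ, Finsupp.equivFunOnFinite_symm_apply_apply]
      ring
    rw [he, map_div₀, one_le_div₀ hpos] at h1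
    exact h1
  · intro m
    obtain ⟨m, rfl⟩ := hsurj m
    rw [hp]
    split_ifs with hms
    · refine ⟨div_mem (c m).2 (c m0).2, (O.valuation_le_one_iff _).1 ?_⟩
      rw [map_div₀, div_le_one₀ hpos]
      exact hmax m hms
    · exact ⟨zero_mem _, zero_mem _⟩
  · rw [hp, if_pos hm0, isVUnit_iff, div_self h0, map_one]

open LocalUnif in
theorem final {F : Type u} [Field F] (K : Subfield F) (O : ValuationSubring F)
    (hfg : ∃ S : Finset F, IntermediateField.adjoin ↥K (S : Set F) = ⊤)
    (hntd : ∃ d ρ τ : ℕ, d = ρ + τ ∧ TrdegEq K d ∧ RatRankEq O K ρ ∧ ResTrdegEq O K τ)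
    (hdl : IsDefectless ↥K (O.comap K.subtype)) :
    IsDefectless F O := by
  obtain ⟨d, ρ, τ, rfl, ⟨t, ht⟩, ⟨⟨x, hx⟩, -⟩, ⟨⟨y, hy⟩, -⟩⟩ := hntd
  obtain ⟨S, hS⟩ := hfg
  refine Stable.isDefectless (main_MI (K := K) τ (Stable.of_isDefectless hdl) hS ?_ (VIn.of hx) (MI.of hy))
  have := ht.lift_cardinalMk_eq_trdeg
  have h2 : Algebra.trdeg K F = (ρ + τ : ℕ) := by simpa [eq_comm] using this
  exact h2.le

end GST

open LocalUnif in
/-- Theorem 1.14 of the paper, the Stability Theorem. Let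
`(F|K, P)` be a valued function field without transcendence defect (`P` not
necessarily trivial on `K`). If `(K, P)` is a defectless field, then `(F, P)` is a
defectless field. -/
theorem statement_8
    (F : Type*) [Field F] (K : Subfield F) (O : ValuationSubring F)
    (hfg : ∃ S : Finset F, IntermediateField.adjoin ↥K (S : Set F) = ⊤)
    (htr : ∃ x : F, Transcendental ↥K x)
    -- `(F|K, P)` is without transcendence defect:
    -- `trdeg F|K = trdeg FP|KP + dim_ℚ (ℚ ⊗ (v_P F / v_P K))`
    (hntd : ∃ d ρ τ : ℕ, d = ρ + τ ∧ TrdegEq K d ∧ RatRankEq O K ρ ∧ ResTrdegEq O K τ)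
    (hdl : IsDefectless ↥K (O.comap K.subtype)) :
    IsDefectless F O := by
  exact GST.final K O hfg hntd hdl
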